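/- For every positive integer n with n ≡ 0, 1, or 3 (mod 5) and n ∉ {5, 8, 20, 25, 35, 40}, one has N̄(0,5,n) > N̄(1,5,n). -/

import Mathlib

/-- An overpartition of `n`: a partition of `n` together with a chosen subset of its
distinct part sizes (the overlined parts). -/
def Overpartition (n : ℕ) : Type :=
  {P : n.Partition × Finset ℕ // P.2 ⊆ P.1.parts.toFinset}

/-- The Dyson rank of an overpartition: largest part minus number of parts. -/
def Overpartition.rank {n : ℕ} (P : Overpartition n) : ℤ :=
  (P.1.1.parts.sup : ℤ) - (P.1.1.parts.card : ℤ)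

/-- `nbarRank m n` is the number of overpartitions of `n` with rank `m`. -/
noncomputable def nbarRank (m : ℤ) (n : ℕ) : ℕ :=
  Nat.card {P : Overpartition n // P.rank = m}

/-- `nbar a c n` is the number of overpartitions of `n` with rank congruent to `a` mod `c`. -/
noncomputable def nbar (a : ℤ) (c : ℕ) (n : ℕ) : ℕ :=
  Nat.card {P : Overpartition n // P.rank ≡ a [ZMOD (c : ℤ)]}

/-- `pbar n` is the number of overpartitions of `n`. -/
noncomputable def pbar (n : ℕ) : ℕ := Nat.card (Overpartition n)

open Finset

/-! ### Basic real series -/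

noncomputable def sg (n : ℤ) : ℝ := (-1 : ℝ) ^ n

lemma sg_add (m n : ℤ) : sg (m + n) = sg m * sg n := zpow_add₀ (by norm_num) m n
lemma sg_neg (n : ℤ) : sg (-n) = sg n := by
  unfold sg; rw [zpow_neg, ← inv_zpow]; norm_num
lemma sg_sub (m n : ℤ) : sg (m - n) = sg m * sg n := by rw [sub_eq_add_neg, sg_add, sg_neg]
lemma sg_one : sg 1 = -1 := by simp [sg]
lemma sg_zero : sg 0 = 1 := by simp [sg]
lemma sg_mul_self (n : ℤ) : sg n * sg n = 1 := by
  rw [← sg_add, sg, ← two_mul, zpow_mul]; norm_num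
lemma abs_sg (n : ℤ) : |sg n| = 1 := by
  unfold sg; rw [abs_zpow]; norm_num
lemma sg_two_mul (n : ℤ) : sg (2 * n) = 1 := by rw [two_mul, sg_add, sg_mul_self]

lemma summ_quad_w {p : ℝ} (h0 : 0 < p) (h1 : p < 1) (A B : ℤ) (hA : 0 < A) (k : ℕ) :
    Summable fun n : ℤ => (|(n : ℝ)| ^ k) * p ^ (A * n ^ 2 + B * n) := by
  have hl : Real.log p < 0 := Real.log_neg h0 h1
  have hpi := Real.pi_pos
  have key := summable_pow_mul_jacobiTheta₂_term_bound
    (-(|(B : ℝ)| * Real.log p) / (2 * Real.pi)) (T := -(A * Real.log p) / Real.pi)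
    (by
      have : (0 : ℝ) < A := by exact_mod_cast hA
      apply div_pos _ hpi
      nlinarith) k
  refine Summable.of_nonneg_of_le (fun n => by positivity) (fun n => ?_) key
  have e : p ^ (A * n ^ 2 + B * n) = Real.exp (((A * n ^ 2 + B * n : ℤ) : ℝ) * Real.log p) := by
    rw [mul_comm _ (Real.log p), Real.exp_mul, Real.exp_log h0, Real.rpow_intCast]
  rw [e]
  have hh : -Real.pi * (-(A * Real.log p) / Real.pi * (n : ℝ) ^ 2
      - 2 * (-(|(B : ℝ)| * Real.log p) / (2 * Real.pi)) * |(n : ℝ)|)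
      = (A * n ^ 2 - |(B : ℝ)| * |(n : ℝ)|) * Real.log p := by
    field_simp
    ring
  have hb : -(|(B : ℝ)| * |(n : ℝ)|) ≤ B * n := by
    rw [← abs_mul]; exact neg_abs_le _
  push_cast
  refine mul_le_mul_of_nonneg_left (Real.exp_le_exp.mpr ?_) (by positivity)
  have := mul_le_mul_of_nonpos_right
    (show (A * n ^ 2 - |(B : ℝ)| * |(n : ℝ)| : ℝ) ≤ A * n ^ 2 + B * n by linarith) hl.le
  calc _ ≤ _ := this
    _ = _ := by rw [← hh]

lemma summ_bdd {p : ℝ} (h0 : 0 < p) (h1 : p < 1) (A B : ℤ) (hA : 0 < A) (c : ℝ) {f : ℤ → ℝ}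
    (h : ∀ n, |f n| ≤ c * p ^ (A * n ^ 2 + B * n)) : Summable f := by
  have := (summ_quad_w h0 h1 A B hA 0).mul_left c
  refine Summable.of_norm_bounded this (fun n => ?_)
  simpa using h n

lemma summ_bdd_w {p : ℝ} (h0 : 0 < p) (h1 : p < 1) (A B : ℤ) (hA : 0 < A) (c : ℝ) {f : ℤ → ℝ}
    (h : ∀ n : ℤ, |f n| ≤ c * (|(n : ℝ)| * p ^ (A * n ^ 2 + B * n))) : Summable f := by
  have := (summ_quad_w h0 h1 A B hA 1).mul_left c
  refine Summable.of_norm_bounded this (fun n => ?_)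
  simpa using h n

lemma inv_bd {p : ℝ} (h0 : 0 < p) (h1 : p < 1) (l : ℤ) : |(1 - p ^ l)⁻¹| ≤ (1 - p)⁻¹ := by
  have hp : 0 < 1 - p := by linarith
  rcases lt_trichotomy l 0 with h | h | h
  · have h2 : p ^ l ≥ p⁻¹ := by
      rw [← zpow_neg_one]; exact zpow_le_zpow_right_of_le_one₀ h0 h1.le (by omega)
    have h3 : p⁻¹ - 1 = (1 - p) / p := by field_simp
    have h4 : 1 - p ≤ (1 - p) / p := by rw [le_div_iff₀ h0]; nlinarith
    rw [abs_inv, abs_sub_comm, abs_of_nonneg (by linarith)]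
    exact inv_anti₀ hp (by linarith)
  · subst h; simp; linarith
  · have h2 : p ^ l ≤ p := by
      calc p ^ l ≤ p ^ (1 : ℤ) := zpow_le_zpow_right_of_le_one₀ h0 h1.le (by omega)
        _ = p := zpow_one p
    rw [abs_inv, abs_of_nonneg (by linarith)]
    exact inv_anti₀ hp (by linarith)

lemma inv_flip {p : ℝ} (h0 : 0 < p) (l : ℤ) :
    (1 - p ^ l)⁻¹ = - (p ^ (-l) * (1 - p ^ (-l))⁻¹) := by
  have hl : p ^ l ≠ 0 := (zpow_pos h0 l).ne'
  rw [zpow_neg]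
  by_cases h : p ^ l = 1
  · simp [h]
  · have : 1 - p ^ l ≠ 0 := fun h' => h (by linarith)
    have h2 : 1 - (p ^ l)⁻¹ ≠ 0 := by
      intro h'
      have : (p ^ l)⁻¹ = 1 := by linarith
      exact h (by simpa using this)
    have h3 : p ^ l - 1 ≠ 0 := fun h' => h (by linarith)
    field_simp
    ring

lemma inv_bd' {p : ℝ} (h0 : 0 < p) (h1 : p < 1) (l : ℤ) :
    |(1 - p ^ l)⁻¹| ≤ p ^ (-l) * (1 - p)⁻¹ := by
  rw [inv_flip h0, abs_neg, abs_mul, abs_of_pos (zpow_pos h0 _)]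
  exact mul_le_mul_of_nonneg_left (inv_bd h0 h1 _) (zpow_pos h0 _).le

/-- if `p ^ l ≠ 1` -/
lemma one_sub_ne {p : ℝ} (h0 : 0 < p) (h1 : p < 1) {l : ℤ} (hl : l ≠ 0) : 1 - p ^ l ≠ 0 := by
  intro h
  rcases lt_or_gt_of_ne hl with h' | h'
  · have := one_lt_zpow_of_neg₀ h0 h1 h'
    linarith
  · have := zpow_lt_one₀ h0 h1 h'
    linarith

/-- The bilateral geometric (Kronecker) series. -/
noncomputable def KK (p : ℝ) (N a b : ℤ) : ℝ := ∑' n : ℤ, p ^ (a * n) * (1 - p ^ (b + N * n))⁻¹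

lemma summ_KK {p : ℝ} (h0 : 0 < p) (h1 : p < 1) {N a : ℤ} (b : ℤ) (ha : 0 < a) (haN : a < N) :
    Summable fun n : ℤ => p ^ (a * n) * (1 - p ^ (b + N * n))⁻¹ := by
  apply Summable.of_nat_of_neg
  · have : Summable fun n : ℕ => (p ^ a) ^ n * (1 - p)⁻¹ :=
      (summable_geometric_of_lt_one (zpow_pos h0 a).le (zpow_lt_one₀ h0 h1 ha)).mul_right _
    refine Summable.of_norm_bounded this (fun n => ?_)
    rw [Real.norm_eq_abs, abs_mul, abs_of_pos (zpow_pos h0 _), zpow_mul, zpow_natCast]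
    exact mul_le_mul_of_nonneg_left (inv_bd h0 h1 _) (by positivity)
  · have : Summable fun n : ℕ => (p ^ (N - a)) ^ n * (p ^ (-b) * (1 - p)⁻¹) :=
      (summable_geometric_of_lt_one (zpow_pos h0 _).le (zpow_lt_one₀ h0 h1 (by omega))).mul_right _
    refine Summable.of_norm_bounded this (fun n => ?_)
    rw [Real.norm_eq_abs, abs_mul, abs_of_pos (zpow_pos h0 _)]
    refine (mul_le_mul_of_nonneg_left (inv_bd' h0 h1 _) (by positivity)).trans (le_of_eq ?_)
    rw [← zpow_natCast (p ^ (N - a)), ← zpow_mul, ← mul_assoc, ← mul_assoc, ← zpow_add₀ h0.ne',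
      ← zpow_add₀ h0.ne']
    congr 2
    ring

/-- theta series `j(p^y; p^10)` -/
noncomputable def jj (p : ℝ) (y : ℤ) : ℝ := ∑' n : ℤ, sg n * p ^ (5 * n ^ 2 - 5 * n + y * n)
noncomputable def jd (p : ℝ) (y : ℤ) : ℝ :=
  ∑' n : ℤ, (n : ℝ) * (sg n * p ^ (5 * n ^ 2 - 5 * n + y * n))

lemma summ_jj {p : ℝ} (h0 : 0 < p) (h1 : p < 1) (y : ℤ) :
    Summable fun n : ℤ => sg n * p ^ (5 * n ^ 2 - 5 * n + y * n) := by
  refine summ_bdd h0 h1 5 (y - 5) (by norm_num) 1 (fun n => ?_)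
  rw [abs_mul, abs_sg, abs_of_pos (zpow_pos h0 _)]
  refine le_of_eq ?_
  congr 2; ring

lemma summ_jd {p : ℝ} (h0 : 0 < p) (h1 : p < 1) (y : ℤ) :
    Summable fun n : ℤ => (n : ℝ) * (sg n * p ^ (5 * n ^ 2 - 5 * n + y * n)) := by
  refine summ_bdd_w h0 h1 5 (y - 5) (by norm_num) 1 (fun n => ?_)
  rw [abs_mul, abs_mul, abs_sg, abs_of_pos (zpow_pos h0 _), one_mul, one_mul]
  refine le_of_eq ?_
  congr 2; ring

lemma jj_refl (p : ℝ) (y : ℤ) : jj p (10 - y) = jj p y := by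
  unfold jj
  rw [← (Equiv.neg ℤ).tsum_eq]
  refine tsum_congr fun n => ?_
  simp only [Equiv.neg_apply, sg_neg]
  congr 2; ring

lemma jj_neg {p : ℝ} (h0 : 0 < p) (y : ℤ) : jj p (-y) = - (p ^ (-y) * jj p y) := by
  unfold jj
  rw [← (Equiv.subLeft (1 : ℤ)).tsum_eq, ← tsum_mul_left, ← tsum_neg]
  refine tsum_congr fun n => ?_
  simp only [Equiv.subLeft_apply, sg_sub, sg_one]
  rw [show (5 * (1 - n) ^ 2 - 5 * (1 - n) + -y * (1 - n) : ℤ)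
    = -y + (5 * n ^ 2 - 5 * n + y * n) by ring, zpow_add₀ h0.ne']
  ring

lemma jj_add {p : ℝ} (h0 : 0 < p) (y : ℤ) : jj p (10 + y) = - (p ^ (-y) * jj p y) := by
  rw [← jj_neg h0, ← jj_refl p (-y)]; congr 1; ring

lemma jj_zero {p : ℝ} (h0 : 0 < p) : jj p 0 = 0 := by
  have := jj_neg h0 0
  simp at this; linarith

lemma jj_ten_mul {p : ℝ} (h0 : 0 < p) (k : ℤ) : jj p (10 * k) = 0 := by
  induction k using Int.induction_on with
  | zero => simpa using jj_zero h0
  | succ i ih => rw [mul_add, add_comm, mul_one, jj_add h0, ih]; simp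
  | pred i ih =>
    have := jj_add h0 (10 * (-(i : ℤ) - 1))
    rw [show (10 + 10 * (-(i : ℤ) - 1)) = 10 * (-(i : ℤ)) by ring, ih] at this
    have h2 := (zpow_pos h0 (-(10 * (-(i : ℤ) - 1)))).ne'
    have h3 : p ^ (-(10 * (-(i : ℤ) - 1))) * jj p (10 * (-(i : ℤ) - 1)) = 0 := by linarith
    exact (mul_eq_zero.mp h3).resolve_left h2

lemma jd_neg {p : ℝ} (h0 : 0 < p) (h1 : p < 1) (y : ℤ) :
    jd p (-y) = p ^ (-y) * (jd p y - jj p y) := by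
  unfold jj jd
  rw [← (Equiv.subLeft (1 : ℤ)).tsum_eq, ← (summ_jd h0 h1 y).tsum_sub (summ_jj h0 h1 y),
    ← tsum_mul_left]
  refine tsum_congr fun n => ?_
  simp only [Equiv.subLeft_apply, sg_sub, sg_one]
  rw [show (5 * (1 - n) ^ 2 - 5 * (1 - n) + -y * (1 - n) : ℤ)
    = -y + (5 * n ^ 2 - 5 * n + y * n) by ring, zpow_add₀ h0.ne']
  push_cast
  ring

/-- split a bilateral sum by parity -/
lemma tsum_parity {f : ℤ → ℝ} (hf : Summable f) :
    ∑' n, f n = ∑' n, f (2 * n) + ∑' n, f (2 * n + 1) := by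
  have e := (Int.divModEquiv 2).symm.tsum_eq f
  have hs : Summable fun x : ℤ × Fin 2 => f ((Int.divModEquiv 2).symm x) :=
    ((Int.divModEquiv 2).symm.summable_iff (f := f)).mpr hf
  rw [← e, hs.tsum_prod]
  have : ∀ c : ℤ, ∑' b : Fin 2, f ((Int.divModEquiv 2).symm (c, b)) = f (2 * c) + f (2 * c + 1) := by
    intro c
    rw [tsum_fintype, Fin.sum_univ_two]
    simp [Int.divModEquiv, mul_comm]
  simp_rw [this]
  refine Summable.tsum_add ?_ ?_
  · exact hf.comp_injective (i := fun n : ℤ => 2 * n) (fun a b h => by simpa using h)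
  · exact hf.comp_injective (i := fun n : ℤ => 2 * n + 1) (fun a b h => by simpa using h)

lemma KK_parity {p : ℝ} (h0 : 0 < p) (h1 : p < 1) {a : ℤ} (b : ℤ) (ha : 0 < a) (ha5 : a < 5) :
    KK p 5 a b = KK p 10 (2 * a) b + p ^ a * KK p 10 (2 * a) (b + 5) := by
  unfold KK
  rw [tsum_parity (summ_KK h0 h1 b ha ha5), ← tsum_mul_left]
  congr 1
  · refine tsum_congr fun n => ?_
    congr 2 <;> ring_nf
  · refine tsum_congr fun n => ?_
    rw [← mul_assoc, ← zpow_add₀ h0.ne']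
    congr 2 <;> ring_nf


lemma summ_mul_reindex {f g : ℤ → ℝ} (hf : Summable f) (hg : Summable g) :
    Summable fun x : ℤ × ℤ => f x.2 * g (x.2 + x.1) := by
  have h := summable_mul_of_summable_norm hf.norm hg.norm
  have hi : Function.Injective (fun x : ℤ × ℤ => ((x.2, x.2 + x.1) : ℤ × ℤ)) := by
    rintro ⟨a, b⟩ ⟨c, d⟩ h
    simp only [Prod.mk.injEq] at h ⊢
    omega
  exact h.comp_injective hi

lemma mul_reindex {f g : ℤ → ℝ} (hf : Summable f) (hg : Summable g) :
    (∑' n, f n) * (∑' n, g n) = ∑' r, ∑' n, f n * g (n + r) := by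
  rw [tsum_mul_tsum_of_summable_norm hf.norm hg.norm]
  let e : ℤ × ℤ ≃ ℤ × ℤ :=
    { toFun := fun x => (x.2, x.2 + x.1)
      invFun := fun x => (x.2 - x.1, x.1)
      left_inv := fun x => by ext <;> simp
      right_inv := fun x => by ext <;> simp }
  rw [← e.tsum_eq]
  exact (summ_mul_reindex hf hg).tsum_prod

noncomputable def ff (p : ℝ) (b y : ℤ) : ℝ :=
  ∑' n : ℤ, sg n * p ^ (5 * n ^ 2 - 5 * n + y * n) * (1 - p ^ (b + 10 * n))⁻¹

lemma summ_ff {p : ℝ} (h0 : 0 < p) (h1 : p < 1) (b y : ℤ) :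
    Summable fun n : ℤ => sg n * p ^ (5 * n ^ 2 - 5 * n + y * n) * (1 - p ^ (b + 10 * n))⁻¹ := by
  refine summ_bdd h0 h1 5 (y - 5) (by norm_num) (1 - p)⁻¹ (fun n => ?_)
  rw [abs_mul, abs_mul, abs_sg, abs_of_pos (zpow_pos h0 _), one_mul, mul_comm]
  refine (mul_le_mul_of_nonneg_right (inv_bd h0 h1 _) (zpow_pos h0 _).le).trans (le_of_eq ?_)
  congr 2; ring

lemma ff_rec {p : ℝ} (h0 : 0 < p) (h1 : p < 1) (b y : ℤ) (hb : ∀ n : ℤ, b + 10 * n ≠ 0) :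
    ff p b y - p ^ b * ff p b (y + 10) = jj p y := by
  unfold ff jj
  rw [← tsum_mul_left, ← (summ_ff h0 h1 b y).tsum_sub ((summ_ff h0 h1 b (y + 10)).mul_left _)]
  refine tsum_congr fun n => ?_
  have h := one_sub_ne h0 h1 (hb n)
  rw [show (5 * n ^ 2 - 5 * n + (y + 10) * n : ℤ) = (5 * n ^ 2 - 5 * n + y * n) + 10 * n by ring,
    zpow_add₀ h0.ne' (5 * n ^ 2 - 5 * n + y * n) (10 * n)]
  rw [zpow_add₀ h0.ne' b] at h ⊢
  generalize p ^ (5 * n ^ 2 - 5 * n + y * n) = X at *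
  field_simp

lemma ff_rec0 {p : ℝ} (h0 : 0 < p) (h1 : p < 1) (y : ℤ) :
    ff p 0 y - ff p 0 (y + 10) = jj p y - 1 := by
  unfold ff jj
  rw [← (summ_ff h0 h1 0 y).tsum_sub (summ_ff h0 h1 0 (y + 10))]
  have h1' : (1 : ℝ) = ∑' n : ℤ, if n = 0 then (1 : ℝ) else 0 := by simp
  rw [h1', ← (summ_jj h0 h1 y).tsum_sub (by
    apply summable_of_hasFiniteSupport
    exact (Set.finite_singleton (0 : ℤ)).subset (fun n hn => by
      simp only [Function.mem_support, ne_eq, ite_eq_right_iff, Classical.not_imp] at hn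
      exact hn.1)), ← h1']
  refine tsum_congr fun n => ?_
  by_cases hn : n = 0
  · subst hn; simp [sg_zero]
  have h := one_sub_ne h0 h1 (show (0 + 10 * n : ℤ) ≠ 0 by omega)
  rw [if_neg hn, show (5 * n ^ 2 - 5 * n + (y + 10) * n : ℤ)
      = (5 * n ^ 2 - 5 * n + y * n) + (0 + 10 * n) by ring,
    zpow_add₀ h0.ne' _ (0 + 10 * n)]
  field_simp
  ring

lemma ff_ten {p : ℝ} (h0 : 0 < p) (h1 : p < 1) (b : ℤ) (hb : ∀ n : ℤ, b + 10 * n ≠ 0) (r : ℤ) :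
    ff p b (10 * r) = p ^ (-(b * r)) * ff p b 0 := by
  have key : ∀ r : ℤ, ff p b (10 * r) = p ^ b * ff p b (10 * (r + 1)) := by
    intro r
    have := ff_rec h0 h1 b (10 * r) hb
    rw [jj_ten_mul h0] at this
    rw [show (10 * (r + 1) : ℤ) = 10 * r + 10 by ring]
    linarith
  induction r using Int.induction_on with
  | zero => simp
  | succ i ih =>
    rw [key] at ih
    rw [show (-(b * ((i : ℤ) + 1))) = -(b * i) + -b by ring, zpow_add₀ h0.ne', zpow_neg p b]
    have := (zpow_pos h0 b).ne'
    field_simp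
    linarith
  | pred i ih =>
    rw [key, show (-(i : ℤ) - 1 + 1) = -i by ring, ih, ← mul_assoc, ← zpow_add₀ h0.ne']
    congr 2; ring

lemma ff_zero_ten {p : ℝ} (h0 : 0 < p) (h1 : p < 1) (r : ℤ) :
    ff p 0 (10 * r) = ff p 0 0 + r := by
  have key : ∀ r : ℤ, ff p 0 (10 * (r + 1)) = ff p 0 (10 * r) + 1 := by
    intro r
    have := ff_rec0 h0 h1 (10 * r)
    rw [jj_ten_mul h0] at this
    rw [show (10 * (r + 1) : ℤ) = 10 * r + 10 by ring]
    linarith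
  induction r using Int.induction_on with
  | zero => simp
  | succ i ih => rw [key, ih]; push_cast; ring
  | pred i ih =>
    have := key (-(i : ℤ) - 1)
    rw [show (-(i : ℤ) - 1 + 1) = -i by ring, ih] at this
    push_cast at this ⊢
    linarith

lemma ff_zero_zero {p : ℝ} (h0 : 0 < p) (h1 : p < 1) : ff p 0 0 = -1 := by
  have h : ff p 0 20 = - ff p 0 0 := by
    unfold ff
    rw [← (Equiv.neg ℤ).tsum_eq, ← tsum_neg]
    refine tsum_congr fun n => ?_
    simp only [Equiv.neg_apply, sg_neg]
    rw [inv_flip h0, show (-(0 + 10 * -n) : ℤ) = 0 + 10 * n by ring]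
    have : p ^ (5 * (-n) ^ 2 - 5 * -n + 20 * -n) * p ^ (0 + 10 * n)
      = p ^ (5 * n ^ 2 - 5 * n + 0 * n) := by
      rw [← zpow_add₀ h0.ne']; congr 1; ring
    linear_combination (-sg n * (1 - p ^ (0 + 10 * n))⁻¹) * this
  have h2 := ff_zero_ten h0 h1 2
  norm_num at h2
  linarith

/-- shift trick -/
lemma KK_shift {p : ℝ} (h0 : 0 < p) (h1 : p < 1) (a b : ℤ) (ha : 0 < a) (ha' : a < 10) :
    KK p 10 a b * jj p (-a) = ∑' r : ℤ, sg r * p ^ (5 * r ^ 2 - 5 * r + (-a) * r) * ff p b (10 * r) := by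
  unfold KK jj ff
  rw [mul_reindex (summ_KK h0 h1 b ha ha') (summ_jj h0 h1 (-a))]
  refine tsum_congr fun r => ?_
  rw [← tsum_mul_left]
  refine tsum_congr fun n => ?_
  have : p ^ (a * n) * p ^ (5 * (n + r) ^ 2 - 5 * (n + r) + -a * (n + r))
    = p ^ (5 * r ^ 2 - 5 * r + (-a) * r) * p ^ (5 * n ^ 2 - 5 * n + (10 * r) * n) := by
    rw [← zpow_add₀ h0.ne', ← zpow_add₀ h0.ne']; congr 1; ring
  rw [sg_add]
  linear_combination (sg n * sg r * (1 - p ^ (b + 10 * n))⁻¹) * this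

lemma KK_jj {p : ℝ} (h0 : 0 < p) (h1 : p < 1) (a b : ℤ) (ha : 0 < a) (ha' : a < 10)
    (hb : ∀ n : ℤ, b + 10 * n ≠ 0) :
    KK p 10 a b * jj p a = p ^ (-b) * (jj p (a + b) * ff p b 0) := by
  have h := KK_shift h0 h1 a b ha ha'
  have h2 : ∑' r : ℤ, sg r * p ^ (5 * r ^ 2 - 5 * r + (-a) * r) * ff p b (10 * r)
      = jj p (-(a + b)) * ff p b 0 := by
    unfold jj
    rw [← tsum_mul_right]
    refine tsum_congr fun r => ?_
    rw [ff_ten h0 h1 b hb, ← mul_assoc, mul_assoc (sg r), ← zpow_add₀ h0.ne']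
    congr 3; ring
  rw [h2, jj_neg h0, jj_neg h0, neg_add, zpow_add₀ h0.ne'] at h
  have := (zpow_pos h0 (-a)).ne'
  apply mul_left_cancel₀ this
  linear_combination -h

lemma KK_zero_jj {p : ℝ} (h0 : 0 < p) (h1 : p < 1) (a : ℤ) (ha : 0 < a) (ha' : a < 10) :
    KK p 10 a 0 * jj p a = - jd p a := by
  have h := KK_shift h0 h1 a 0 ha ha'
  have h2 : ∑' r : ℤ, sg r * p ^ (5 * r ^ 2 - 5 * r + (-a) * r) * ff p 0 (10 * r)
      = - jj p (-a) + jd p (-a) := by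
    unfold jj jd
    rw [← tsum_neg, ← (summ_jj h0 h1 (-a)).neg.tsum_add (summ_jd h0 h1 (-a))]
    refine tsum_congr fun r => ?_
    rw [ff_zero_ten h0 h1, ff_zero_zero h0 h1]
    ring
  rw [h2, jd_neg h0 h1, jj_neg h0] at h
  have := (zpow_pos h0 (-a)).ne'
  apply mul_left_cancel₀ this
  linear_combination -h


/-! ### double series, symmetry -/
noncomputable def DS (p : ℝ) (a b : ℕ) : ℝ :=
  ∑' x : ℕ × ℕ, p ^ (10 * x.1 * x.2 + a * x.1 + b * x.2)

lemma summ_DS {p : ℝ} (h0 : 0 < p) (h1 : p < 1) {a b : ℕ} (ha : 0 < a) (hb : 0 < b) :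
    Summable fun x : ℕ × ℕ => p ^ (10 * x.1 * x.2 + a * x.1 + b * x.2) := by
  have hg := summable_geometric_of_lt_one h0.le h1
  have := summable_mul_of_summable_norm hg.norm hg.norm
  refine Summable.of_nonneg_of_le (fun x => by positivity) (fun x => ?_) this
  rw [← pow_add]
  apply pow_le_pow_of_le_one h0.le h1.le
  nlinarith [Nat.zero_le (x.1 * x.2), Nat.zero_le x.1, Nat.zero_le x.2]

lemma DS_comm (p : ℝ) (a b : ℕ) : DS p a b = DS p b a := by
  unfold DS
  rw [← (Equiv.prodComm ℕ ℕ).tsum_eq]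
  refine tsum_congr fun x => ?_
  simp only [Equiv.prodComm_apply, Prod.fst_swap, Prod.snd_swap]
  congr 1; ring

lemma KK_eq_DS {p : ℝ} (h0 : 0 < p) (h1 : p < 1) {a b : ℕ} (ha : 0 < a) (hb : 0 < b)
    (ha' : a < 10) (hb' : b < 10) :
    KK p 10 a b = DS p a b - p ^ (10 - a - b : ℤ) * DS p (10 - a) (10 - b) := by
  unfold KK
  have hs := summ_KK h0 h1 (N := 10) (a := (a : ℤ)) (b : ℤ) (by exact_mod_cast ha)
    (by exact_mod_cast ha')
  rw [tsum_of_nat_of_neg_add_one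
    (f := fun n : ℤ => p ^ ((a : ℤ) * n) * (1 - p ^ ((b : ℤ) + 10 * n))⁻¹)
    (hs.comp_injective (i := fun n : ℕ => (n : ℤ)) Nat.cast_injective)
    (hs.comp_injective (i := fun n : ℕ => -((n : ℤ) + 1))
      (fun x y h => by simpa using h))]
  rw [sub_eq_add_neg]
  congr 1
  · unfold DS
    rw [(summ_DS h0 h1 ha hb).tsum_prod]
    refine tsum_congr fun n => ?_
    rw [← tsum_geometric_of_lt_one (zpow_pos h0 _).le (zpow_lt_one₀ h0 h1 (by positivity)),
      ← tsum_mul_left]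
    refine tsum_congr fun m => ?_
    rw [← zpow_natCast (p ^ (_ : ℤ)), ← zpow_mul, ← zpow_add₀ h0.ne', ← zpow_natCast]
    congr 1; push_cast; ring
  · unfold DS
    rw [(summ_DS h0 h1 (by omega) (by omega)).tsum_prod, ← tsum_mul_left, ← tsum_neg]
    refine tsum_congr fun n => ?_
    rw [inv_flip h0, ← tsum_geometric_of_lt_one (zpow_pos h0 _).le
      (zpow_lt_one₀ h0 h1 (by push_cast; nlinarith)), ← tsum_mul_left, ← tsum_mul_left, mul_neg,
      ← tsum_mul_left]
    congr 1
    refine tsum_congr fun m => ?_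
    rw [← zpow_natCast (p ^ (_ : ℤ)), ← zpow_mul, ← zpow_add₀ h0.ne', ← zpow_natCast,
      ← zpow_add₀ h0.ne', ← zpow_add₀ h0.ne']
    congr 1
    push_cast [Nat.cast_sub ha'.le, Nat.cast_sub hb'.le]
    ring

lemma KK_comm {p : ℝ} (h0 : 0 < p) (h1 : p < 1) {a b : ℕ} (ha : 0 < a) (hb : 0 < b)
    (ha' : a < 10) (hb' : b < 10) : KK p 10 a b = KK p 10 b a := by
  rw [KK_eq_DS h0 h1 ha hb ha' hb', KK_eq_DS h0 h1 hb ha hb' ha', DS_comm, DS_comm p (10 - a)]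
  congr 3; ring

/-! ### product identity -/
lemma KK_mul {p : ℝ} (h0 : 0 < p) (h1 : p < 1) (a c b : ℤ) (ha : 0 < a) (hc : 0 < c)
    (hac : a + c < 10) (hb : ∀ n : ℤ, b + 10 * n ≠ 0) :
    KK p 10 a b * KK p 10 c b = ∑' n : ℤ, p ^ ((a + c) * n) * ((1 - p ^ (b + 10 * n))⁻¹) ^ 2
      + KK p 10 (a + c) b * (KK p 10 a 0 + KK p 10 c 0) := by
  have sa := summ_KK h0 h1 b ha (show a < 10 by omega)
  have sc := summ_KK h0 h1 b hc (show c < 10 by omega)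
  have sac := summ_KK h0 h1 b (show 0 < a + c by omega) hac
  have sa0 := summ_KK h0 h1 0 ha (show a < 10 by omega)
  have sc0 := summ_KK h0 h1 0 hc (show c < 10 by omega)
  have sa0' : Summable fun r : ℤ => p ^ (a * (-r)) * (1 - p ^ (0 + 10 * (-r)))⁻¹ :=
    ((Equiv.neg ℤ).summable_iff
      (f := fun n : ℤ => p ^ (a * n) * (1 - p ^ (0 + 10 * n))⁻¹)).mpr sa0
  have hinner : ∀ r : ℤ, ∑' n : ℤ, (p ^ (a * n) * (1 - p ^ (b + 10 * n))⁻¹) *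
      (p ^ (c * (n + r)) * (1 - p ^ (b + 10 * (n + r)))⁻¹)
      = (if r = 0 then ∑' n : ℤ, p ^ ((a + c) * n) * ((1 - p ^ (b + 10 * n))⁻¹) ^ 2 else 0)
        + KK p 10 (a + c) b * (p ^ (a * (-r)) * (1 - p ^ (0 + 10 * (-r)))⁻¹
          + p ^ (c * r) * (1 - p ^ (0 + 10 * r))⁻¹) := by
    intro r
    by_cases hr : r = 0
    · subst hr
      simp only [if_true]
      simp only [neg_zero, mul_zero, add_zero, zpow_zero, sub_self, inv_zero]
      refine tsum_congr fun n => ?_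
      rw [add_mul, zpow_add₀ h0.ne' (a * n)]
      ring
    · rw [if_neg hr, zero_add]
      have e1 : KK p 10 (a + c) b * (p ^ (c * r) * (1 - p ^ (0 + 10 * r))⁻¹)
        = ∑' n : ℤ, (p ^ ((a + c) * n) * (1 - p ^ (b + 10 * n))⁻¹)
            * (p ^ (c * r) * (1 - p ^ (0 + 10 * r))⁻¹) := by
        rw [KK, tsum_mul_right]
      have e2 : KK p 10 (a + c) b * (p ^ (a * (-r)) * (1 - p ^ (0 + 10 * (-r)))⁻¹)
        = ∑' n : ℤ, (p ^ ((a + c) * (n + r)) * (1 - p ^ (b + 10 * (n + r)))⁻¹)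
            * (p ^ (a * (-r)) * (1 - p ^ (0 + 10 * (-r)))⁻¹) := by
        rw [KK, ← tsum_mul_right, ← (Equiv.addRight r).tsum_eq]
        rfl
      have s2 : Summable fun n : ℤ => (p ^ ((a + c) * (n + r)) * (1 - p ^ (b + 10 * (n + r)))⁻¹)
            * (p ^ (a * (-r)) * (1 - p ^ (0 + 10 * (-r)))⁻¹) :=
        (((Equiv.addRight r).summable_iff
          (f := fun n : ℤ => p ^ ((a + c) * n) * (1 - p ^ (b + 10 * n))⁻¹)).mpr sac).mul_right _
      rw [mul_add, e1, e2, ← s2.tsum_add (sac.mul_right _)]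
      refine tsum_congr fun n => ?_
      have n1 := one_sub_ne h0 h1 (hb n)
      have n2 := one_sub_ne h0 h1 (hb (n + r))
      have n3 := one_sub_ne h0 h1 (show (0 + 10 * r : ℤ) ≠ 0 by omega)
      rw [inv_flip h0 (0 + 10 * (-r)), show (-(0 + 10 * -r) : ℤ) = 0 + 10 * r by ring]
      have x1 : p ^ ((a + c) * (n + r)) = p ^ (a * n) * p ^ (c * n) * p ^ (a * r) * p ^ (c * r) := by
        rw [← zpow_add₀ h0.ne', ← zpow_add₀ h0.ne', ← zpow_add₀ h0.ne']; congr 1; ring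
      have x2 : p ^ (c * (n + r)) = p ^ (c * n) * p ^ (c * r) := by
        rw [← zpow_add₀ h0.ne']; congr 1; ring
      have x3 : p ^ ((a + c) * n) = p ^ (a * n) * p ^ (c * n) := by
        rw [← zpow_add₀ h0.ne']; congr 1; ring
      have x4 : p ^ (a * (-r)) = (p ^ (a * r))⁻¹ := by
        rw [← zpow_neg]; congr 1; ring
      have x5 : p ^ (b + 10 * (n + r)) = p ^ (b + 10 * n) * p ^ (0 + 10 * r) := by
        rw [← zpow_add₀ h0.ne']; congr 1; ring
      have x6 := (zpow_pos h0 (a * r)).ne'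
      rw [x5] at n2
      rw [x1, x2, x3, x4, x5]
      generalize p ^ (b + 10 * n) = u at *
      generalize p ^ (0 + 10 * r) = R at *
      generalize p ^ (a * r) = v at *
      field_simp
      ring
  have hd : Summable fun r : ℤ =>
      (if r = 0 then ∑' n : ℤ, p ^ ((a + c) * n) * ((1 - p ^ (b + 10 * n))⁻¹) ^ 2 else (0 : ℝ)) :=
    (hasSum_ite_eq (0 : ℤ) _).summable
  unfold KK
  rw [mul_reindex sa sc, tsum_congr hinner, hd.tsum_add ((sa0'.add sc0).mul_left _), tsum_ite_eq,
    tsum_mul_left, sa0'.tsum_add sc0]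
  congr 3
  exact (Equiv.neg ℤ).tsum_eq (fun n : ℤ => p ^ (a * n) * (1 - p ^ (0 + 10 * n))⁻¹)

/-! ### splitting lemma -/
noncomputable def tE (p : ℝ) (z : ℤ) : ℝ := ∑' n : ℤ, p ^ (10 * n ^ 2 + 2 * z * n)
noncomputable def tb (p : ℝ) (z : ℤ) : ℝ := ∑' n : ℤ, p ^ (z + (10 * n ^ 2 + 10 * n + 2 * z * n))
noncomputable def tE' (p : ℝ) (z : ℤ) : ℝ := ∑' n : ℤ, (2 * n : ℝ) * p ^ (10 * n ^ 2 + 2 * z * n)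
noncomputable def tb' (p : ℝ) (z : ℤ) : ℝ :=
  ∑' n : ℤ, (2 * n + 1 : ℝ) * p ^ (z + (10 * n ^ 2 + 10 * n + 2 * z * n))
noncomputable def br (p : ℝ) (x z : ℤ) : ℝ := tb p x * tE p z - tE p x * tb p z
noncomputable def brd (p : ℝ) (x z : ℤ) : ℝ := tb p x * tE' p z - tE p x * tb' p z

lemma inner_even {p : ℝ} (h0 : 0 < p) (x z d : ℤ) :
    ∑' n : ℤ, (sg n * p ^ (5 * n ^ 2 - 5 * n + (x - z) * n)) *
      (sg (n + 2 * d) * p ^ (5 * (n + 2 * d) ^ 2 - 5 * (n + 2 * d) + (x + z) * (n + 2 * d)))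
    = p ^ x * tb p x * p ^ (10 * d ^ 2 + 2 * z * d) := by
  unfold tb
  rw [← (Equiv.addRight (1 - d)).tsum_eq, ← tsum_mul_left, ← tsum_mul_right]
  refine tsum_congr fun n => ?_
  simp only [Equiv.coe_addRight]
  rw [sg_add _ (2 * d), sg_two_mul, ← zpow_add₀ h0.ne', ← zpow_add₀ h0.ne']
  generalize he : (n + (1 - d)) = k
  have : sg k * p ^ (5 * k ^ 2 - 5 * k + (x - z) * k) * (sg k * 1 *
    p ^ (5 * (k + 2 * d) ^ 2 - 5 * (k + 2 * d) + (x + z) * (k + 2 * d)))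
    = (sg k * sg k) * (p ^ (5 * k ^ 2 - 5 * k + (x - z) * k) *
    p ^ (5 * (k + 2 * d) ^ 2 - 5 * (k + 2 * d) + (x + z) * (k + 2 * d))) := by ring
  rw [this, sg_mul_self, one_mul, ← zpow_add₀ h0.ne', ← he]
  congr 1; ring

lemma inner_odd {p : ℝ} (h0 : 0 < p) (x z d : ℤ) :
    ∑' n : ℤ, (sg n * p ^ (5 * n ^ 2 - 5 * n + (x - z) * n)) *
      (sg (n + (2 * d + 1)) * p ^ (5 * (n + (2 * d + 1)) ^ 2 - 5 * (n + (2 * d + 1))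
        + (x + z) * (n + (2 * d + 1))))
    = - (p ^ x * tE p x * p ^ (z + (10 * d ^ 2 + 10 * d + 2 * z * d))) := by
  unfold tE
  rw [← (Equiv.addRight (- d)).tsum_eq, ← tsum_mul_left, ← tsum_mul_right, ← tsum_neg]
  refine tsum_congr fun n => ?_
  simp only [Equiv.coe_addRight]
  rw [sg_add _ (2 * d + 1), sg_add (2 * d), sg_two_mul, sg_one, ← zpow_add₀ h0.ne',
    ← zpow_add₀ h0.ne']
  generalize he : (n + - d) = k
  have : sg k * p ^ (5 * k ^ 2 - 5 * k + (x - z) * k) * (sg k * (1 * -1) *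
    p ^ (5 * (k + (2 * d + 1)) ^ 2 - 5 * (k + (2 * d + 1)) + (x + z) * (k + (2 * d + 1))))
    = -((sg k * sg k) * (p ^ (5 * k ^ 2 - 5 * k + (x - z) * k) *
    p ^ (5 * (k + (2 * d + 1)) ^ 2 - 5 * (k + (2 * d + 1)) + (x + z) * (k + (2 * d + 1))))) := by
    ring
  rw [this, sg_mul_self, one_mul, ← zpow_add₀ h0.ne', ← he]
  congr 2; ring

lemma split1 {p : ℝ} (h0 : 0 < p) (h1 : p < 1) (x z : ℤ) :
    jj p (x + z) * jj p (x - z) = p ^ x * br p x z := by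
  have s1 := summ_jj h0 h1 (x - z)
  have s2 := summ_jj h0 h1 (x + z)
  rw [mul_comm]
  unfold jj
  rw [mul_reindex s1 s2, tsum_parity ((summ_mul_reindex s1 s2).prod)]
  simp_rw [inner_even h0, inner_odd h0]
  rw [tsum_mul_left, tsum_neg, tsum_mul_left]
  unfold br
  rw [show ∑' d : ℤ, p ^ (10 * d ^ 2 + 2 * z * d) = tE p z from rfl,
    show ∑' d : ℤ, p ^ (z + (10 * d ^ 2 + 10 * d + 2 * z * d)) = tb p z from rfl]
  ring

lemma summ_mul_w {f g : ℤ → ℝ} (hf : Summable f) (hg : Summable g)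
    (hf' : Summable fun n : ℤ => (n : ℝ) * f n) (hg' : Summable fun n : ℤ => (n : ℝ) * g n) :
    Summable fun r : ℤ => (r : ℝ) * ∑' n, f n * g (n + r) := by
  have h1 := (summ_mul_reindex hf hg').sub (summ_mul_reindex hf' hg)
  refine h1.prod.congr fun r => ?_
  rw [← tsum_mul_left]
  refine tsum_congr fun n => ?_
  push_cast
  ring

lemma mul_w {f g : ℤ → ℝ} (hf : Summable f) (hg : Summable g)
    (hf' : Summable fun n : ℤ => (n : ℝ) * f n) (hg' : Summable fun n : ℤ => (n : ℝ) * g n) :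
    (∑' n, f n) * (∑' n : ℤ, (n : ℝ) * g n) - (∑' n : ℤ, (n : ℝ) * f n) * (∑' n, g n)
      = ∑' r : ℤ, (r : ℝ) * ∑' n, f n * g (n + r) := by
  rw [mul_reindex hf hg', mul_reindex hf' hg, ← (summ_mul_reindex hf hg').prod.tsum_sub
    (summ_mul_reindex hf' hg).prod]
  refine tsum_congr fun r => ?_
  have a1 := (summ_mul_reindex hf hg').prod_factor r
  have a2 := (summ_mul_reindex hf' hg).prod_factor r
  simp only at a1 a2
  rw [← a1.tsum_sub a2, ← tsum_mul_left]
  refine tsum_congr fun n => ?_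
  push_cast
  ring

lemma split2 {p : ℝ} (h0 : 0 < p) (h1 : p < 1) (x z : ℤ) :
    jd p (x + z) * jj p (x - z) - jj p (x + z) * jd p (x - z) = p ^ x * brd p x z := by
  have s1 := summ_jj h0 h1 (x - z)
  have s2 := summ_jj h0 h1 (x + z)
  have s1' := summ_jd h0 h1 (x - z)
  have s2' := summ_jd h0 h1 (x + z)
  rw [mul_comm, mul_comm (jj p (x + z))]
  unfold jj jd
  rw [mul_w s1 s2 s1' s2', tsum_parity (summ_mul_w s1 s2 s1' s2')]
  simp_rw [inner_even h0, inner_odd h0]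
  unfold brd tE' tb'
  rw [mul_sub, ← mul_assoc, ← mul_assoc, ← tsum_mul_left, ← tsum_mul_left, sub_eq_add_neg,
    ← tsum_neg]
  congr 1
  · refine tsum_congr fun d => ?_
    push_cast; ring
  · refine tsum_congr fun d => ?_
    push_cast; ring


/-! ### level two Appell sums -/
noncomputable def th (p : ℝ) (y : ℤ) : ℝ := ∑' n : ℤ, sg n * p ^ (5 * n ^ 2 + y * n)
noncomputable def AA (p : ℝ) (b y : ℤ) : ℝ :=
  ∑' n : ℤ, sg n * p ^ (5 * n ^ 2 + y * n) * (1 - p ^ (b + 5 * n))⁻¹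
noncomputable def dlt (b : ℤ) : ℝ := if b = 0 then 1 else 0

lemma th_eq (p : ℝ) (y : ℤ) : th p y = jj p (y + 5) := by
  unfold th jj
  refine tsum_congr fun n => ?_
  congr 2; ring

lemma summ_th {p : ℝ} (h0 : 0 < p) (h1 : p < 1) (y : ℤ) :
    Summable fun n : ℤ => sg n * p ^ (5 * n ^ 2 + y * n) := by
  refine (summ_jj h0 h1 (y + 5)).congr fun n => ?_
  congr 2; ring

lemma summ_AA {p : ℝ} (h0 : 0 < p) (h1 : p < 1) (b y : ℤ) :
    Summable fun n : ℤ => sg n * p ^ (5 * n ^ 2 + y * n) * (1 - p ^ (b + 5 * n))⁻¹ := by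
  refine summ_bdd h0 h1 5 y (by norm_num) (1 - p)⁻¹ (fun n => ?_)
  rw [abs_mul, abs_mul, abs_sg, abs_of_pos (zpow_pos h0 _), one_mul, mul_comm]
  exact (mul_le_mul_of_nonneg_right (inv_bd h0 h1 _) (zpow_pos h0 _).le)

lemma th_neg (p : ℝ) (y : ℤ) : th p (-y) = th p y := by
  rw [th_eq, th_eq, ← jj_refl]; congr 1; ring

lemma th_shift {p : ℝ} (h0 : 0 < p) (y r : ℤ) :
    p ^ (5 * r ^ 2 + y * r) * th p (y + 10 * r) = sg r * th p y := by
  unfold th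
  rw [← tsum_mul_left, ← tsum_mul_left, ← (Equiv.addRight r).tsum_eq
    (fun n : ℤ => sg r * (sg n * p ^ (5 * n ^ 2 + y * n)))]
  refine tsum_congr fun n => ?_
  simp only [Equiv.coe_addRight]
  rw [sg_add]
  have : p ^ (5 * r ^ 2 + y * r) * p ^ (5 * n ^ 2 + (y + 10 * r) * n)
    = p ^ (5 * (n + r) ^ 2 + y * (n + r)) := by
    rw [← zpow_add₀ h0.ne']; congr 1; ring
  rw [← this]
  linear_combination (-sg n * p ^ (5 * r ^ 2 + y * r) * p ^ (5 * n ^ 2 + (y + 10 * r) * n)) *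
    sg_mul_self r

lemma th_five {p : ℝ} (h0 : 0 < p) : th p 5 = 0 := by
  rw [th_eq]; exact jj_ten_mul h0 1

lemma AA_rec {p : ℝ} (h0 : 0 < p) (h1 : p < 1) (b y : ℤ) (hb : b = 0 ∨ ∀ n : ℤ, b + 5 * n ≠ 0) :
    AA p b y - p ^ (2 * b) * AA p b (y + 10) = th p y + p ^ b * th p (y + 5) - 2 * dlt b := by
  unfold AA th
  have hd : ∑' n : ℤ, (if n = 0 then dlt b else 0) = dlt b := tsum_ite_eq _ _
  have hds : Summable fun n : ℤ => (if n = 0 then dlt b else 0) := (hasSum_ite_eq _ _).summable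
  rw [← tsum_mul_left, ← tsum_mul_left, ← (summ_AA h0 h1 b y).tsum_sub
    ((summ_AA h0 h1 b (y + 10)).mul_left _), ← hd, ← tsum_mul_left,
    ← (summ_th h0 h1 y).tsum_add ((summ_th h0 h1 (y + 5)).mul_left _),
    ← ((summ_th h0 h1 y).add ((summ_th h0 h1 (y + 5)).mul_left _)).tsum_sub (hds.mul_left _)]
  refine tsum_congr fun n => ?_
  have x1 : p ^ (5 * n ^ 2 + (y + 10) * n) = p ^ (5 * n ^ 2 + y * n) * (p ^ (5 * n)) ^ 2 := by
    rw [← zpow_natCast, ← zpow_mul, ← zpow_add₀ h0.ne']; congr 1; push_cast; ring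
  have x2 : p ^ (5 * n ^ 2 + (y + 5) * n) = p ^ (5 * n ^ 2 + y * n) * (p ^ (5 * n)) := by
    rw [← zpow_add₀ h0.ne']; congr 1; push_cast; ring
  have x3 : p ^ (2 * b) = (p ^ b) ^ 2 := by
    rw [← zpow_natCast, ← zpow_mul]; congr 1; push_cast; ring
  by_cases h : b + 5 * n = 0
  · have : b = 0 ∧ n = 0 := by
      rcases hb with hb | hb
      · omega
      · exact absurd h (hb n)
    obtain ⟨rfl, rfl⟩ := this
    simp [dlt, sg_zero]
    norm_num
  · have h2 := one_sub_ne h0 h1 h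
    have h3 : (if n = 0 then dlt b else 0) = 0 := by
      unfold dlt
      split_ifs with hn hb
      · omega
      · rfl
      · rfl
    rw [h3, x1, x2, x3]
    rw [zpow_add₀ h0.ne' b] at h2 ⊢
    generalize p ^ (5 * n ^ 2 + y * n) = X at *
    field_simp
    ring

lemma K5_th {p : ℝ} (h0 : 0 < p) (h1 : p < 1) (a b κ : ℤ) (ha : 0 < a) (ha' : a < 5) :
    HasSum (fun r : ℤ => sg r * p ^ (5 * r ^ 2 + κ * r) *
      (p ^ (2 * b * r) * AA p b (a + κ + 2 * b + 10 * r))) (KK p 5 a b * th p (κ + 2 * b)) := by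
  have s1 := summ_KK h0 h1 b ha ha'
  have s2 := summ_th h0 h1 (κ + 2 * b)
  have hi : ∀ r : ℤ, sg r * p ^ (5 * r ^ 2 + κ * r) *
      (p ^ (2 * b * r) * AA p b (a + κ + 2 * b + 10 * r)) =
      ∑' n : ℤ, p ^ (a * n) * (1 - p ^ (b + 5 * n))⁻¹ *
        (sg (n + r) * p ^ (5 * (n + r) ^ 2 + (κ + 2 * b) * (n + r))) := by
    intro r
    unfold AA
    rw [← tsum_mul_left, ← tsum_mul_left]
    refine tsum_congr fun n => ?_
    rw [sg_add]
    have : p ^ (a * n) * p ^ (5 * (n + r) ^ 2 + (κ + 2 * b) * (n + r))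
      = p ^ (5 * r ^ 2 + κ * r) * p ^ (2 * b * r) *
        p ^ (5 * n ^ 2 + (a + κ + 2 * b + 10 * r) * n) := by
      rw [← zpow_add₀ h0.ne', ← zpow_add₀ h0.ne', ← zpow_add₀ h0.ne']; congr 1; ring
    linear_combination (-sg n * sg r * (1 - p ^ (b + 5 * n))⁻¹) * this
  unfold KK th
  rw [mul_reindex s1 s2, ← tsum_congr hi]
  exact ((summ_mul_reindex s1 s2).prod.congr (fun r => (hi r).symm)).hasSum

/-- the three-point relation -/
lemma level2 {p : ℝ} (h0 : 0 < p) (h1 : p < 1) (κ e z : ℤ) (c : ℝ)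
    (ha : 0 < 5 - κ - 2 * z) (ha' : 5 - κ - 2 * z < 5)
    (hc : c * th p 0 = 2 * p ^ e * th p (2 * e))
    (hb1 : z - e = 0 ∨ ∀ n : ℤ, z - e + 5 * n ≠ 0)
    (hb2 : z + e = 0 ∨ ∀ n : ℤ, z + e + 5 * n ≠ 0)
    (hb3 : z = 0 ∨ ∀ n : ℤ, z + 5 * n ≠ 0)
    (hδ : κ = 0 ∨ (z - e ≠ 0 ∧ z + e ≠ 0 ∧ z ≠ 0)) :
    th p κ * (AA p (z - e) (5 - 2 * e) + p ^ (2 * e) * AA p (z + e) (5 + 2 * e) - c * AA p z 5)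
      = KK p 5 (5 - κ - 2 * z) (z - e) * th p (κ + 2 * (z - e))
        + p ^ (2 * e) * (KK p 5 (5 - κ - 2 * z) (z + e) * th p (κ + 2 * (z + e)))
        - c * (KK p 5 (5 - κ - 2 * z) z * th p (κ + 2 * z)) := by
  have k1 := K5_th h0 h1 (5 - κ - 2 * z) (z - e) κ ha ha'
  have k2 := K5_th h0 h1 (5 - κ - 2 * z) (z + e) κ ha ha'
  have k3 := K5_th h0 h1 (5 - κ - 2 * z) z κ ha ha'
  have hκ := (summ_th h0 h1 κ).hasSum
  set d : ℝ := dlt (z - e) + p ^ (2 * e) * dlt (z + e) - c * dlt z with hd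
  -- termwise relation
  let Φ : ℤ → ℝ := fun r => p ^ (2 * (z - e) * r) * AA p (z - e) (5 - 2 * e + 10 * r)
    + p ^ (2 * e) * (p ^ (2 * (z + e) * r) * AA p (z + e) (5 + 2 * e + 10 * r))
    - c * (p ^ (2 * z * r) * AA p z (5 + 10 * r))
  have e1 : ∀ b r : ℤ, (b = 0 ∨ ∀ n : ℤ, b + 5 * n ≠ 0) →
      p ^ (2 * b * r) * AA p b (5 + 2 * (b - z) + 10 * r)
      - p ^ (2 * b * (r + 1)) * AA p b (5 + 2 * (b - z) + 10 * (r + 1)) =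
      sg r * p ^ (-5 * r ^ 2 - 5 * r + 2 * r * z) * (th p (5 + 2 * (b - z))
        + p ^ (-5 * r) * (p ^ b * th p (10 + 2 * (b - z)))) - 2 * dlt b := by
    intro b r hb
    have h := AA_rec h0 h1 b (5 + 2 * (b - z) + 10 * r) hb
    have t1 := th_shift h0 (5 + 2 * (b - z)) r
    have t2 := th_shift h0 (10 + 2 * (b - z)) r
    have hdl : p ^ (2 * b * r) * dlt b = dlt b := by
      unfold dlt
      split_ifs with h
      · simp [h]
      · simp
    rw [show (5 + 2 * (b - z) + 10 * (r + 1) : ℤ) = 5 + 2 * (b - z) + 10 * r + 10 by ring,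
      show (2 * b * (r + 1) : ℤ) = 2 * b * r + 2 * b by ring, zpow_add₀ h0.ne' (2 * b * r)]
    rw [show (5 + 2 * (b - z) + 10 * r + 5 : ℤ) = 10 + 2 * (b - z) + 10 * r by ring] at h
    have q1 : p ^ (2 * b * r) = p ^ (-5 * r ^ 2 - 5 * r + 2 * r * z) *
        p ^ (5 * r ^ 2 + (5 + 2 * (b - z)) * r) := by
      rw [← zpow_add₀ h0.ne']; congr 1; ring
    have q2 : p ^ (2 * b * r) = p ^ (-5 * r ^ 2 - 5 * r + 2 * r * z) * p ^ (-5 * r) *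
        p ^ (5 * r ^ 2 + (10 + 2 * (b - z)) * r) := by
      rw [← zpow_add₀ h0.ne', ← zpow_add₀ h0.ne']; congr 1; ring
    have u1 : p ^ (2 * b * r) * th p (5 + 2 * (b - z) + 10 * r)
        = p ^ (-5 * r ^ 2 - 5 * r + 2 * r * z) * (sg r * th p (5 + 2 * (b - z))) := by
      rw [q1, mul_assoc, t1]
    have u2 : p ^ (2 * b * r) * th p (10 + 2 * (b - z) + 10 * r)
        = p ^ (-5 * r ^ 2 - 5 * r + 2 * r * z) * p ^ (-5 * r) *
          (sg r * th p (10 + 2 * (b - z))) := by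
      rw [q2, mul_assoc, t2]
    linear_combination p ^ (2 * b * r) * h + u1 + p ^ b * u2 - 2 * hdl
  have hΦ : ∀ r : ℤ, Φ r - Φ (r + 1) = - 2 * d := by
    intro r
    have f1 := e1 (z - e) r hb1
    have f2 := e1 (z + e) r hb2
    have f3 := e1 z r hb3
    rw [show (5 + 2 * (z - e - z) : ℤ) = 5 - 2 * e by ring,
      show (10 + 2 * (z - e - z) : ℤ) = 10 - 2 * e by ring] at f1
    rw [show (5 + 2 * (z + e - z) : ℤ) = 5 + 2 * e by ring,
      show (10 + 2 * (z + e - z) : ℤ) = 10 + 2 * e by ring] at f2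
    rw [show (5 + 2 * (z - z) : ℤ) = 5 by ring,
      show (10 + 2 * (z - z) : ℤ) = 10 by ring, th_five h0] at f3
    have g1 : th p (5 - 2 * e) + p ^ (2 * e) * th p (5 + 2 * e) = 0 := by
      have := th_shift h0 (-5 + 2 * e) 1
      rw [sg_one, show (-5 + 2 * e + 10 * 1 : ℤ) = 5 + 2 * e by ring,
        show (5 * 1 ^ 2 + (-5 + 2 * e) * 1 : ℤ) = 2 * e by ring,
        show (-5 + 2 * e : ℤ) = -(5 - 2 * e) by ring, th_neg] at this
      linarith
    have g2 : p ^ (z - e) * th p (10 - 2 * e) + p ^ (2 * e) * (p ^ (z + e) * th p (10 + 2 * e))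
        - c * (p ^ z * th p 10) = 0 := by
      have a1 := th_shift h0 (- (2 * e)) 1
      have a2 := th_shift h0 (2 * e) 1
      have a3 := th_shift h0 0 1
      rw [sg_one, th_neg, show (-(2 * e) + 10 * 1 : ℤ) = 10 - 2 * e by ring,
        show (5 * 1 ^ 2 + -(2 * e) * 1 : ℤ) = 5 + (- (2 * e)) by ring, zpow_add₀ h0.ne'] at a1
      rw [sg_one, show (2 * e + 10 * 1 : ℤ) = 10 + 2 * e by ring,
        show (5 * 1 ^ 2 + (2 * e) * 1 : ℤ) = 5 + 2 * e by ring, zpow_add₀ h0.ne'] at a2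
      rw [sg_one, show (0 + 10 * 1 : ℤ) = 10 by ring,
        show (5 * 1 ^ 2 + 0 * 1 : ℤ) = 5 by ring] at a3
      have b1 : p ^ (z - e) = p ^ z * p ^ e * p ^ (-(2 * e)) := by
        rw [← zpow_add₀ h0.ne', ← zpow_add₀ h0.ne']; congr 1; ring
      have b2 : p ^ (z + e) = p ^ z * p ^ e := zpow_add₀ h0.ne' _ _
      have h5 := (zpow_pos h0 5).ne'
      apply mul_left_cancel₀ h5
      rw [b1, b2]
      linear_combination (p ^ z * p ^ e) * a1 + (p ^ z * p ^ e) * a2 - c * p ^ z * a3 + p ^ z * hc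
    simp only [Φ]
    linear_combination f1 + p ^ (2 * e) * f2 - c * f3 +
      sg r * p ^ (-5 * r ^ 2 - 5 * r + 2 * r * z) * (g1 + p ^ (-5 * r) * g2)
  have hΦ2 : ∀ r : ℤ, Φ r = Φ 0 + 2 * d * r := by
    intro r
    induction r using Int.induction_on with
    | zero => simp
    | succ i ih => have := hΦ i; push_cast at ih ⊢; linarith
    | pred i ih =>
      have := hΦ (-(i : ℤ) - 1)
      rw [show (-(i : ℤ) - 1 + 1) = -i by ring] at this
      push_cast at ih ⊢; linarith
  have hsum := (k1.add (k2.mul_left (p ^ (2 * e)))).sub (k3.mul_left c)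
  have hodd : ∑' r : ℤ, (sg r * p ^ (5 * r ^ 2 + κ * r)) * (2 * d * r) = 0 := by
    rcases hδ with hk | ⟨n1, n2, n3⟩
    · have : ∑' r : ℤ, (sg r * p ^ (5 * r ^ 2 + κ * r)) * (2 * d * r)
        = - ∑' r : ℤ, (sg r * p ^ (5 * r ^ 2 + κ * r)) * (2 * d * r) := by
        conv_lhs => rw [← (Equiv.neg ℤ).tsum_eq]
        rw [← tsum_neg]
        refine tsum_congr fun r => ?_
        simp only [Equiv.neg_apply, sg_neg, hk]
        push_cast
        rw [show (5 * (-r) ^ 2 + 0 * -r : ℤ) = 5 * r ^ 2 + 0 * r by ring]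
        ring
      linarith
    · have : d = 0 := by simp [hd, dlt, n1, n2, n3]
      simp [this]
  have hw : Summable fun r : ℤ => (sg r * p ^ (5 * r ^ 2 + κ * r)) * (2 * d * r) := by
    refine summ_bdd_w h0 h1 5 κ (by norm_num) (|2 * d|) (fun n => ?_)
    rw [abs_mul, abs_mul, abs_sg, abs_of_pos (zpow_pos h0 _), abs_mul]
    apply le_of_eq; ring
  have hfin := (hκ.mul_right (Φ 0)).add hw.hasSum
  rw [hodd, add_zero] at hfin
  have hf : (fun r : ℤ => sg r * p ^ (5 * r ^ 2 + κ * r) * Φ 0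
      + (sg r * p ^ (5 * r ^ 2 + κ * r)) * (2 * d * r)) =
      fun r : ℤ => sg r * p ^ (5 * r ^ 2 + κ * r) *
        (p ^ (2 * (z - e) * r) * AA p (z - e) (5 - κ - 2 * z + κ + 2 * (z - e) + 10 * r)) +
        p ^ (2 * e) * (sg r * p ^ (5 * r ^ 2 + κ * r) *
        (p ^ (2 * (z + e) * r) * AA p (z + e) (5 - κ - 2 * z + κ + 2 * (z + e) + 10 * r))) -
        c * (sg r * p ^ (5 * r ^ 2 + κ * r) *
        (p ^ (2 * z * r) * AA p z (5 - κ - 2 * z + κ + 2 * z + 10 * r))) := by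
    funext r
    have h := hΦ2 r
    rw [show (5 - κ - 2 * z + κ + 2 * (z - e) + 10 * r : ℤ) = 5 - 2 * e + 10 * r by ring,
      show (5 - κ - 2 * z + κ + 2 * (z + e) + 10 * r : ℤ) = 5 + 2 * e + 10 * r by ring,
      show (5 - κ - 2 * z + κ + 2 * z + 10 * r : ℤ) = 5 + 10 * r by ring]
    have h' : Φ r = p ^ (2 * (z - e) * r) * AA p (z - e) (5 - 2 * e + 10 * r)
      + p ^ (2 * e) * (p ^ (2 * (z + e) * r) * AA p (z + e) (5 + 2 * e + 10 * r))
      - c * (p ^ (2 * z * r) * AA p z (5 + 10 * r)) := rfl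
    linear_combination (sg r * p ^ (5 * r ^ 2 + κ * r)) * (h' - h)
  rw [hf] at hfin
  have heq := hfin.unique hsum
  rw [show (∑' r : ℤ, sg r * p ^ (5 * r ^ 2 + κ * r)) = th p κ from rfl] at heq
  rw [← heq]
  simp only [Φ]
  simp


/-! ### theta constants -/
structure Good (p : ℝ) : Prop where
  h0 : 0 < p
  h1 : p < 1
  j1 : jj p 1 ≠ 0
  j2 : jj p 2 ≠ 0
  j3 : jj p 3 ≠ 0
  j4 : jj p 4 ≠ 0
  j5 : jj p 5 ≠ 0

lemma jj6 (p : ℝ) : jj p 6 = jj p 4 := jj_refl p 4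
lemma jj7 (p : ℝ) : jj p 7 = jj p 3 := jj_refl p 3
lemma jj8 (p : ℝ) : jj p 8 = jj p 2 := jj_refl p 2
lemma jj9 (p : ℝ) : jj p 9 = jj p 1 := jj_refl p 1

lemma Good.jne {p : ℝ} (g : Good p) {a : ℤ} (ha : 0 < a) (ha' : a < 10) : jj p a ≠ 0 := by
  interval_cases a
  · exact g.j1
  · exact g.j2
  · exact g.j3
  · exact g.j4
  · exact g.j5
  · rw [jj6]; exact g.j4
  · rw [jj7]; exact g.j3
  · rw [jj8]; exact g.j2
  · rw [jj9]; exact g.j1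

lemma Good.jne' {p : ℝ} (g : Good p) {a : ℤ} (ha : 0 < a) (ha' : a < 20) (h10 : a ≠ 10) :
    jj p a ≠ 0 := by
  rcases lt_or_gt_of_ne h10 with h | h
  · exact g.jne ha h
  · rw [show a = 10 + (a - 10) by ring, jj_add g.h0]
    exact neg_ne_zero.mpr (mul_ne_zero (zpow_pos g.h0 _).ne' (g.jne (by omega) (by omega)))

noncomputable def cc (p : ℝ) (b : ℤ) : ℝ := p ^ (-b) * ff p b 0 * jj p b

lemma Good.cc_eq {p : ℝ} (g : Good p) {a b : ℕ} (ha : 0 < a) (hb : 0 < b)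
    (ha' : a < 10) (hb' : b < 10) (h : a + b ≠ 10) : cc p a = cc p b := by
  have k1 := KK_jj g.h0 g.h1 a b (by omega) (by omega) (fun n => by omega)
  have k2 := KK_jj g.h0 g.h1 b a (by omega) (by omega) (fun n => by omega)
  rw [KK_comm g.h0 g.h1 hb ha hb' ha', add_comm (b : ℤ)] at k2
  have := g.jne' (a := (a : ℤ) + b) (by omega) (by omega) (by omega)
  apply mul_left_cancel₀ this
  unfold cc
  linear_combination jj p b * k1 - jj p a * k2

lemma Good.cc_one {p : ℝ} (g : Good p) {b : ℕ} (hb : 0 < b) (hb' : b < 10) : cc p b = cc p 1 := by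
  by_cases h : b = 9
  · subst h
    rw [g.cc_eq (a := 9) (b := 2) (by omega) (by omega) (by omega) (by omega) (by omega),
      g.cc_eq (a := 2) (b := 1) (by omega) (by omega) (by omega) (by omega) (by omega)]
    rfl
  · exact g.cc_eq hb (b := 1) (by omega) hb' (by omega) (by omega)

lemma Good.K10 {p : ℝ} (g : Good p) {a b : ℕ} (ha : 0 < a) (hb : 0 < b)
    (ha' : a < 10) (hb' : b < 10) :
    KK p 10 a b = cc p 1 * jj p (a + b) / (jj p a * jj p b) := by
  have k1 := KK_jj g.h0 g.h1 a b (by omega) (by omega) (fun n => by omega)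
  have j1 := g.jne (a := (a : ℤ)) (by omega) (by omega)
  have j2 := g.jne (a := (b : ℤ)) (by omega) (by omega)
  rw [← g.cc_one hb hb', eq_div_iff (mul_ne_zero j1 j2)]
  unfold cc
  linear_combination jj p b * k1

lemma jj11 {p : ℝ} (h0 : 0 < p) : jj p 11 = - (jj p 1 / p) := by
  rw [show (11 : ℤ) = 10 + 1 by ring, jj_add h0, zpow_neg_one]; ring
lemma jj12 {p : ℝ} (h0 : 0 < p) : jj p 12 = - (jj p 2 / p ^ 2) := by
  rw [show (12 : ℤ) = 10 + 2 by ring, jj_add h0, zpow_neg, zpow_ofNat]; ring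
lemma jj13 {p : ℝ} (h0 : 0 < p) : jj p 13 = - (jj p 3 / p ^ 3) := by
  rw [show (13 : ℤ) = 10 + 3 by ring, jj_add h0, zpow_neg, zpow_ofNat]; ring
lemma jj14 {p : ℝ} (h0 : 0 < p) : jj p 14 = - (jj p 4 / p ^ 4) := by
  rw [show (14 : ℤ) = 10 + 4 by ring, jj_add h0, zpow_neg, zpow_ofNat]; ring
lemma jj17 {p : ℝ} (h0 : 0 < p) : jj p 17 = - (jj p 3 / p ^ 7) := by
  rw [show (17 : ℤ) = 10 + 7 by ring, jj_add h0, zpow_neg, zpow_ofNat, jj7]; ring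
lemma jj10 {p : ℝ} (h0 : 0 < p) : jj p 10 = 0 := jj_ten_mul h0 1

lemma plucker (p : ℝ) (x y z w : ℤ) :
    br p x y * br p z w - br p x z * br p y w + br p x w * br p y z = 0 := by
  unfold br; ring

lemma br_eq {p : ℝ} (h0 : 0 < p) (h1 : p < 1) (x z : ℤ) :
    br p x z = p ^ (-x) * (jj p (x + z) * jj p (x - z)) := by
  rw [split1 h0 h1, ← mul_assoc, ← zpow_add₀ h0.ne']; simp
lemma brd_eq {p : ℝ} (h0 : 0 < p) (h1 : p < 1) (x z : ℤ) :
    brd p x z = p ^ (-x) * (jd p (x + z) * jj p (x - z) - jj p (x + z) * jd p (x - z)) := by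
  rw [split2 h0 h1, ← mul_assoc, ← zpow_add₀ h0.ne']; simp

lemma jjn1 {p : ℝ} (h0 : 0 < p) : jj p (-1) = - (jj p 1 / p) := by
  rw [jj_neg h0, zpow_neg_one]; ring
lemma jjn2 {p : ℝ} (h0 : 0 < p) : jj p (-2) = - (jj p 2 / p ^ 2) := by
  rw [jj_neg h0, zpow_neg, zpow_ofNat]; ring
lemma jjn4 {p : ℝ} (h0 : 0 < p) : jj p (-4) = - (jj p 4 / p ^ 4) := by
  rw [jj_neg h0, zpow_neg, zpow_ofNat]; ring

lemma rel1 {p : ℝ} (h0 : 0 < p) (h1 : p < 1) :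
    jj p 1 * jj p 4 ^ 2 * jj p 5 - jj p 2 * jj p 3 ^ 2 * jj p 4 + p * jj p 1 * jj p 2 ^ 2 * jj p 3 = 0 := by
  have h := plucker p 3 2 4 0
  simp only [br_eq h0 h1, zpow_neg, zpow_ofNat] at h
  norm_num [jj7, jj6, jjn1 h0, jjn2 h0] at h
  field_simp at h
  linarith

lemma rel2 {p : ℝ} (h0 : 0 < p) (h1 : p < 1) :
    jj p 2 ^ 2 * jj p 3 * jj p 5 - p * jj p 1 ^ 2 * jj p 2 * jj p 4 = jj p 1 * jj p 3 * jj p 4 ^ 2 := by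
  have h := plucker p 4 2 1 0
  simp only [br_eq h0 h1, zpow_neg, zpow_ofNat] at h
  norm_num [jj7, jj6, jjn1 h0, jjn2 h0] at h
  field_simp at h
  linarith

lemma rel3 {p : ℝ} (h0 : 0 < p) (h1 : p < 1) :
    jj p 3 ^ 2 * jj p 4 ^ 2 - jj p 2 * jj p 4 * jj p 5 ^ 2 = p ^ 2 * jj p 1 ^ 2 * jj p 2 ^ 2 := by
  have h := plucker p 5 3 1 0
  simp only [br_eq h0 h1, zpow_neg, zpow_ofNat] at h
  norm_num [jj7, jj6, jj8, jjn1 h0, jjn2 h0] at h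
  field_simp at h
  linarith

lemma jd_refl (p : ℝ) (y : ℤ) : jd p (10 - y) = - jd p y := by
  unfold jd
  rw [← (Equiv.neg ℤ).tsum_eq, ← tsum_neg]
  refine tsum_congr fun n => ?_
  simp only [Equiv.neg_apply, sg_neg]
  rw [show (5 * (-n) ^ 2 - 5 * -n + (10 - y) * -n : ℤ) = 5 * n ^ 2 - 5 * n + y * n by ring]
  push_cast; ring

lemma brd_rel (p : ℝ) (x y z : ℤ) :
    brd p x z * br p y z - brd p y z * br p x z = - (br p x y * brd p z z) := by
  unfold br brd; ring

/-- first Eisenstein relation -/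
lemma Good.S1 {p : ℝ} (g : Good p) :
    1 + 3 * KK p 10 2 0 + KK p 10 4 0 = - jd p 0 * jj p 4 ^ 2 / jj p 2 ^ 3 := by
  have h0 := g.h0
  have h1 := g.h1
  have h := brd_rel p 4 0 2
  have k2 := KK_zero_jj h0 h1 2 (by omega) (by omega)
  have k4 := KK_zero_jj h0 h1 4 (by omega) (by omega)
  have d6 : jd p 6 = - jd p 4 := jd_refl p 4
  have dn2 := jd_neg h0 h1 2
  have e2 : jd p 2 = - (KK p 10 2 0 * jj p 2) := by linarith
  have e4 : jd p 4 = - (KK p 10 4 0 * jj p 4) := by linarith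
  simp only [br_eq h0 h1, brd_eq h0 h1, zpow_neg, zpow_ofNat] at h dn2
  norm_num [jj6, jjn2 h0, jj_zero h0, d6, dn2, e2, e4] at h
  have j2 := g.j2
  have j4 := g.j4
  rw [eq_div_iff (pow_ne_zero _ j2)]
  field_simp at h
  linarith

lemma Good.S2 {p : ℝ} (g : Good p) :
    3 * KK p 10 4 0 - KK p 10 2 0 = p ^ 2 * jd p 0 * jj p 2 ^ 2 / jj p 4 ^ 3 := by
  have h0 := g.h0
  have h1 := g.h1
  have h := brd_rel p 8 0 4
  have k2 := KK_zero_jj h0 h1 2 (by omega) (by omega)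
  have k4 := KK_zero_jj h0 h1 4 (by omega) (by omega)
  have d12 : jd p 12 = - jd p (-2) := by
    rw [← jd_refl]; norm_num
  have dn2 := jd_neg h0 h1 2
  have dn4 := jd_neg h0 h1 4
  have e2 : jd p 2 = - (KK p 10 2 0 * jj p 2) := by linarith
  have e4 : jd p 4 = - (KK p 10 4 0 * jj p 4) := by linarith
  simp only [br_eq h0 h1, brd_eq h0 h1, zpow_neg, zpow_ofNat] at h dn2 dn4
  norm_num [jj8, jjn4 h0, jj12 h0, jj_zero h0, d12, dn2, dn4, e2, e4] at h
  have j2 := g.j2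
  have j4 := g.j4
  rw [eq_div_iff (pow_ne_zero _ j4)]
  field_simp at h
  linarith

lemma Good.C_ne {p : ℝ} (g : Good p) : cc p 1 ≠ 0 := by
  intro hC
  have h := g.K10 (a := 2) (b := 2) (by omega) (by omega) (by omega) (by omega)
  rw [hC, KK_eq_DS g.h0 g.h1 (by omega) (by omega) (by omega) (by omega)] at h
  norm_num at h
  have h0 := g.h0
  have h1 := g.h1
  have s1 := summ_DS h0 h1 (a := 2) (b := 2) (by omega) (by omega)
  have s2 := (summ_DS h0 h1 (a := 8) (b := 8) (by omega) (by omega)).mul_left (p ^ 6)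
  have : p ^ 6 * DS p 8 8 < DS p 2 2 := by
    unfold DS
    rw [← tsum_mul_left]
    refine Summable.tsum_lt_tsum (i := ((0 : ℕ), (0 : ℕ))) (fun x => ?_) ?_ s2 s1
    · rw [← pow_add]
      apply pow_le_pow_of_le_one h0.le h1.le
      omega
    · simp only [mul_zero, add_zero, pow_zero, mul_one]
      exact pow_lt_one₀ h0.le h1 (by omega)
  have h' : DS p 2 2 - p ^ 6 * DS p 8 8 = 0 := h
  linarith

lemma KK_flip {p : ℝ} (h0 : 0 < p) (N a : ℤ) : KK p N (N - a) 0 = - KK p N a 0 := by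
  unfold KK
  rw [← (Equiv.neg ℤ).tsum_eq, ← tsum_neg]
  refine tsum_congr fun n => ?_
  simp only [Equiv.neg_apply]
  rw [inv_flip h0, show (-(0 + N * -n) : ℤ) = 0 + N * n by ring, mul_neg, ← mul_assoc,
    ← zpow_add₀ h0.ne']
  congr 3; ring

lemma Good.C_eq {p : ℝ} (g : Good p) : - jd p 0 = cc p 1 := by
  have h0 := g.h0
  have h1 := g.h1
  have m1 := KK_mul h0 h1 4 4 1 (by omega) (by omega) (by omega) (fun n => by omega)
  have m2 := KK_mul h0 h1 2 6 1 (by omega) (by omega) (by omega) (fun n => by omega)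
  have k41 := g.K10 (a := 4) (b := 1) (by omega) (by omega) (by omega) (by omega)
  have k21 := g.K10 (a := 2) (b := 1) (by omega) (by omega) (by omega) (by omega)
  have k61 := g.K10 (a := 6) (b := 1) (by omega) (by omega) (by omega) (by omega)
  have k81 := g.K10 (a := 8) (b := 1) (by omega) (by omega) (by omega) (by omega)
  have f6 : KK p 10 6 0 = - KK p 10 4 0 := KK_flip h0 10 4
  have S2 := g.S2
  have hC := g.C_ne
  norm_num [jj6, jj7, jj8, jj9] at m1 m2 k41 k21 k61 k81
  have e : KK p 10 4 1 * KK p 10 4 1 - KK p 10 2 1 * KK p 10 6 1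
      = KK p 10 8 1 * (3 * KK p 10 4 0 - KK p 10 2 0) := by
    rw [m1, m2, f6]; ring
  rw [k41, k21, k61, k81, S2] at e
  have := rel3 h0 h1
  have j1 := g.j1
  have j2 := g.j2
  have j3 := g.j3
  have j4 := g.j4
  have j5 := g.j5
  field_simp at e
  have hp := h0.ne'
  have : cc p 1 * (p ^ 2 * jj p 1 ^ 2 * jj p 2 ^ 2) = - jd p 0 * (p ^ 2 * jj p 1 ^ 2 * jj p 2 ^ 2) := by
    linear_combination -e - cc p 1 * this
  exact (mul_right_cancel₀ (by positivity) this).symm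


noncomputable def dd0 (p : ℝ) : ℝ := (KK p 10 1 8 - 3 * p * KK p 10 3 6) / jj p 1
noncomputable def dd1 (p : ℝ) : ℝ := 2 * KK p 10 2 2 / jj p 3 + 6 * p * AA p 2 5 / jj p 5
noncomputable def dd2 (p : ℝ) : ℝ := -2 * KK p 10 1 4 / jj p 5
noncomputable def dd3 (p : ℝ) : ℝ := 4 * KK p 10 2 7 / jj p 1
noncomputable def dd4 (p : ℝ) : ℝ :=
  (2 * jj p 3 * dd3 p - 2 * jj p 1 * dd0 p - 8 * AA p 1 5) / jj p 5

lemma Good.dd4_eq {p : ℝ} (g : Good p) :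
    jj p 5 * dd4 p - 2 * jj p 3 * dd3 p + 2 * jj p 1 * dd0 p = - 8 * AA p 1 5 := by
  unfold dd4
  have := g.j5
  field_simp
  ring

lemma alg1 {p a b c d e : ℝ} (ha : a ≠ 0) (hb : b ≠ 0) (hc : c ≠ 0) (hd : d ≠ 0) (he : e ≠ 0)
    (r1 : a * d ^ 2 * e - b * c ^ 2 * d + p * a * b ^ 2 * c = 0)
    (r2 : b ^ 2 * c * e - p * a ^ 2 * b * d = a * c * d ^ 2) :
    e * (d / (b ^ 2 * c)) - c * (1 / (a * b) - 3 * p / (c * d)) - 2 * p * a / (a * d) = 0 := by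
  field_simp
  linear_combination r1

lemma alg2 {p a b c d e : ℝ} (ha : a ≠ 0) (hb : b ≠ 0) (hc : c ≠ 0) (hd : d ≠ 0) (he : e ≠ 0)
    (r1 : a * d ^ 2 * e - b * c ^ 2 * d + p * a * b ^ 2 * c = 0)
    (r2 : b ^ 2 * c * e - p * a ^ 2 * b * d = a * c * d ^ 2) :
    -2 * e / (a * d) - 4 * c * d / (b ^ 2 * c) + 8 * p * a / (b * c) =
      -6 * (e / (a * d) - 2 * p * c / e * (1 / b - p * a / (c * d)) * b / d) := by
  field_simp
  have hk : (a * d ^ 2) ^ 2 ≠ 0 := by positivity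
  apply mul_left_cancel₀ hk
  linear_combination ( 8 * p * a ^ 3 * b * d ^ 4 + (-4) * p * a * b ^ 4 * c ^ 2 * d + (-4) * a ^ 2 * c * d ^ 5 + 4 * a * b ^ 2 * c * d ^ 3 * e + 4 * b ^ 3 * c ^ 3 * d ^ 2) * r1 + ((-4) * p * a * b ^ 2 * c * d + 4 * b * c ^ 2 * d ^ 2) * (a * d ^ 2 * r2 - b ^ 2 * c * r1)

lemma alg3 {p a b c d e : ℝ} (hp : p ≠ 0) (ha : a ≠ 0) (hb : b ≠ 0) (hc : c ≠ 0) (hd : d ≠ 0) (he : e ≠ 0)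
    (r1 : a * d ^ 2 * e - b * c ^ 2 * d + p * a * b ^ 2 * c = 0)
    (r2 : b ^ 2 * c * e - p * a ^ 2 * b * d = a * c * d ^ 2) :
    4 * e / (b * c) + 4 * c / (a * d) + 2 * p * a *
      ((8 * c / (b * c) - 2 * a * (1 / (a * b) - 3 * p / (c * d))) / e) =
      -8 / p * ((- p * c / (a * b) - p ^ 2 / d) * b / d) := by
  field_simp
  have hk : (a * d ^ 2) ^ 1 ≠ 0 := by positivity
  apply mul_left_cancel₀ hk
  linear_combination ( (-12) * p * a * b ^ 2 * c + 4 * a * d ^ 2 * e) * r1 + ((-12) * p * a) * (a * d ^ 2 * r2 - b ^ 2 * c * r1)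

lemma alg0 {p a b c d e : ℝ} (hp : p ≠ 0) (ha : a ≠ 0) (hb : b ≠ 0) (hc : c ≠ 0) (hd : d ≠ 0) (he : e ≠ 0)
    (r1 : a * d ^ 2 * e - b * c ^ 2 * d + p * a * b ^ 2 * c = 0)
    (r2 : b ^ 2 * c * e - p * a ^ 2 * b * d = a * c * d ^ 2) :
    e * (1 / (a * b) - 3 * p / (c * d)) - 2 * p * c * ((8 * c / (b * c) - 2 * a * (1 / (a * b) - 3 * p / (c * d))) / e)
     + 4 * p * a * (d / (b ^ 2 * c)) =
     (d ^ 2 / b ^ 3 + 3 * p ^ 2 * b ^ 2 / d ^ 3) + 6 * p * (c / (b * e)) - 8 * p ^ 2 * (a / (d * e))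
      - 6 * (2 * p ^ 2 * a / e) * (d / b ^ 2 + p * a / (b * c)) * a / e
      - 8 * (2 * p * c / e) * (c / (d * a) - p * b / d ^ 2) * c / e := by
  field_simp
  have hk : (a * d ^ 2) ^ 3 ≠ 0 := by positivity
  apply mul_left_cancel₀ hk
  linear_combination ( (-8) * p ^ 2 * a ^ 4 * b ^ 3 * c * d ^ 6 + 4 * p ^ 2 * a ^ 2 * b ^ 6 * c ^ 3 * d ^ 3 + 4 * p * a ^ 4 * b * d ^ 8 * e + (-3) * p * a ^ 3 * b ^ 3 * d ^ 6 * e ^ 2 + (-13) * p * a ^ 3 * b ^ 2 * c ^ 2 * d ^ 7 + (-4) * p * a ^ 2 * b ^ 4 * c ^ 2 * d ^ 5 * e + (-5) * p * a * b ^ 5 * c ^ 4 * d ^ 4 + (-1) * a ^ 3 * c * d ^ 9 * e + 1 * a ^ 2 * b ^ 2 * c * d ^ 7 * e ^ 2 + (-1) * a ^ 2 * b * c ^ 3 * d ^ 8 + 1 * a * b ^ 3 * c ^ 3 * d ^ 6 * e + 1 * b ^ 4 * c ^ 5 * d ^ 5) * r1 + ((-12) * p ^ 2 * a ^ 4 *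 b * d ^ 6 + 4 * p ^ 2 * a ^ 2 * b ^ 4 * c ^ 2 * d ^ 3 + (-5) * p * a * b ^ 3 * c ^ 3 * d ^ 4 + 1 * b ^ 2 * c ^ 4 * d ^ 5) * (a * d ^ 2 * r2 - b ^ 2 * c * r1)

/-! shifts of the Appell sums -/
lemma AA_shift {p : ℝ} (h0 : 0 < p) (b y : ℤ) :
    AA p b y = - (p ^ (5 + y) * AA p (b + 5) (y + 10)) := by
  unfold AA
  rw [← (Equiv.addRight (1 : ℤ)).tsum_eq, ← tsum_mul_left, ← tsum_neg]
  refine tsum_congr fun n => ?_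
  simp only [Equiv.coe_addRight, sg_add, sg_one]
  rw [show (b + 5 + 5 * n : ℤ) = b + 5 * (n + 1) by ring,
    show (5 * (n + 1) ^ 2 + y * (n + 1) : ℤ) = (5 + y) + (5 * n ^ 2 + (y + 10) * n) by ring,
    zpow_add₀ h0.ne' (5 + y)]
  ring

lemma AA_flip {p : ℝ} (h0 : 0 < p) (b y : ℤ) :
    AA p b y = - (p ^ (-b) * AA p (-b) (5 - y)) := by
  unfold AA
  rw [← (Equiv.neg ℤ).tsum_eq, ← tsum_mul_left, ← tsum_neg]
  refine tsum_congr fun n => ?_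
  simp only [Equiv.neg_apply, sg_neg]
  rw [inv_flip h0, show (-(b + 5 * -n) : ℤ) = -b + 5 * n by ring]
  have : p ^ (5 * (-n) ^ 2 + y * -n) * p ^ (-b + 5 * n) = p ^ (-b) * p ^ (5 * n ^ 2 + (5 - y) * n) := by
    rw [← zpow_add₀ h0.ne', ← zpow_add₀ h0.ne']; congr 1; ring
  linear_combination (- sg n * (1 - p ^ (-b + 5 * n))⁻¹) * this

lemma Good.eq1 {p : ℝ} (g : Good p) :
    jj p 5 * dd1 p - 2 * jj p 3 * dd0 p + 2 * p * jj p 1 * dd2 p = 6 * p * AA p 2 5 := by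
  have k22 := g.K10 (a := 2) (b := 2) (by omega) (by omega) (by omega) (by omega)
  have k18 := g.K10 (a := 1) (b := 8) (by omega) (by omega) (by omega) (by omega)
  have k36 := g.K10 (a := 3) (b := 6) (by omega) (by omega) (by omega) (by omega)
  have k14 := g.K10 (a := 1) (b := 4) (by omega) (by omega) (by omega) (by omega)
  norm_num [jj6, jj7, jj8, jj9] at k22 k18 k36 k14
  have A := alg1 g.j1 g.j2 g.j3 g.j4 g.j5 (rel1 g.h0 g.h1) (rel2 g.h0 g.h1)
  unfold dd1 dd0 dd2
  rw [k22, k18, k36, k14]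
  have j1 := g.j1
  have j2 := g.j2
  have j3 := g.j3
  have j4 := g.j4
  have j5 := g.j5
  field_simp at A ⊢
  linear_combination 2 * cc p 1 * A

lemma Good.eq2 {p : ℝ} (g : Good p) :
    jj p 5 * dd2 p - 2 * jj p 3 * dd1 p + 2 * p * jj p 1 * dd3 p
      = -6 * (AA p 1 3 + p ^ 2 * AA p 3 7) := by
  have k22 := g.K10 (a := 2) (b := 2) (by omega) (by omega) (by omega) (by omega)
  have k27 := g.K10 (a := 2) (b := 7) (by omega) (by omega) (by omega) (by omega)
  have k14 := g.K10 (a := 1) (b := 4) (by omega) (by omega) (by omega) (by omega)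
  have k41 := g.K10 (a := 4) (b := 1) (by omega) (by omega) (by omega) (by omega)
  have k46 := g.K10 (a := 4) (b := 6) (by omega) (by omega) (by omega) (by omega)
  have k42 := g.K10 (a := 4) (b := 2) (by omega) (by omega) (by omega) (by omega)
  have k47 := g.K10 (a := 4) (b := 7) (by omega) (by omega) (by omega) (by omega)
  norm_num [jj6, jj7, jj8, jj9, jj10 g.h0, jj11 g.h0] at k22 k27 k14 k41 k46 k42 k47
  have A := alg2 g.j1 g.j2 g.j3 g.j4 g.j5 (rel1 g.h0 g.h1) (rel2 g.h0 g.h1)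
  have P1 := KK_parity g.h0 g.h1 (a := 2) 1 (by omega) (by omega)
  have P2 := KK_parity g.h0 g.h1 (a := 2) 2 (by omega) (by omega)
  have hp := g.h0.ne'
  have j1 := g.j1
  have j2 := g.j2
  have j3 := g.j3
  have j4 := g.j4
  have j5 := g.j5
  have L := level2 g.h0 g.h1 (-1) 1 2 (2 * p * jj p 3 / jj p 5) (by omega) (by omega)
    (by simp only [th_eq, zpow_one]; norm_num [jj7]; field_simp)
    (Or.inr fun n => by omega) (Or.inr fun n => by omega) (Or.inr fun n => by omega) (Or.inr (by omega))
  norm_num [th_eq, jj6, jj8, jj10 g.h0] at L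
  norm_num at P1 P2
  rw [P1, P2, k41, k46, k42, k47] at L
  have L' : AA p 1 3 + p ^ 2 * AA p 3 7 = 2 * p * jj p 3 / jj p 5 * AA p 2 5 +
      cc p 1 * (jj p 5 / (jj p 1 * jj p 4) - 2 * p * jj p 3 / jj p 5 *
        (1 / jj p 2 - p * jj p 1 / (jj p 3 * jj p 4)) * jj p 2 / jj p 4) := by
    apply mul_left_cancel₀ j4
    rw [mul_sub] at L
    trans (jj p 4 * (2 * p * jj p 3 / jj p 5 * AA p 2 5) + (cc p 1 * jj p 5 / (jj p 4 * jj p 1) * jj p 4 -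
      2 * p * jj p 3 / jj p 5 * ((cc p 1 * jj p 4 / (jj p 4 * jj p 2) + p ^ 2 *
        (cc p 1 * -(jj p 1 / p) / (jj p 4 * jj p 3))) * jj p 2)))
    · linear_combination L
    · field_simp
      ring
  rw [L', mul_add, mul_left_comm _ (cc p 1), ← A]
  unfold dd1 dd2 dd3
  rw [k22, k14, k27]
  field_simp
  ring

lemma KK_up {p : ℝ} (h0 : 0 < p) (N a b : ℤ) : KK p N a b = p ^ a * KK p N a (b + N) := by
  unfold KK
  rw [← (Equiv.addRight (1 : ℤ)).tsum_eq, ← tsum_mul_left]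
  refine tsum_congr fun n => ?_
  simp only [Equiv.coe_addRight]
  rw [show (b + N + N * n : ℤ) = b + N * (n + 1) by ring, mul_add, add_comm (a * n), mul_one,
    zpow_add₀ h0.ne']
  ring

lemma Good.eq3 {p : ℝ} (g : Good p) :
    jj p 5 * dd3 p - 2 * jj p 3 * dd2 p + 2 * p * jj p 1 * dd4 p
      = -8 * (- AA p 1 4 + p * AA p 2 6) := by
  have k18 := g.K10 (a := 1) (b := 8) (by omega) (by omega) (by omega) (by omega)
  have k36 := g.K10 (a := 3) (b := 6) (by omega) (by omega) (by omega) (by omega)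
  have k27 := g.K10 (a := 2) (b := 7) (by omega) (by omega) (by omega) (by omega)
  have k14 := g.K10 (a := 1) (b := 4) (by omega) (by omega) (by omega) (by omega)
  have k89 := g.K10 (a := 8) (b := 9) (by omega) (by omega) (by omega) (by omega)
  have k84 := g.K10 (a := 8) (b := 4) (by omega) (by omega) (by omega) (by omega)
  have k81 := g.K10 (a := 8) (b := 1) (by omega) (by omega) (by omega) (by omega)
  have k86 := g.K10 (a := 8) (b := 6) (by omega) (by omega) (by omega) (by omega)
  norm_num [jj6, jj7, jj8, jj9, jj12 g.h0, jj14 g.h0, jj17 g.h0] at k18 k36 k27 k14 k89 k84 k81 k86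
  have A := alg3 g.h0.ne' g.j1 g.j2 g.j3 g.j4 g.j5 (rel1 g.h0 g.h1) (rel2 g.h0 g.h1)
  have P1 := KK_parity g.h0 g.h1 (a := 4) (-1) (by omega) (by omega)
  have P2 := KK_parity g.h0 g.h1 (a := 4) 1 (by omega) (by omega)
  have U := KK_up g.h0 10 8 (-1)
  have hp := g.h0.ne'
  have j1 := g.j1
  have j2 := g.j2
  have j3 := g.j3
  have j4 := g.j4
  have j5 := g.j5
  have L := level2 g.h0 g.h1 (-1) 2 1 (2 * p ^ 2 * jj p 1 / jj p 5) (by omega) (by omega)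
    (by simp only [th_eq, zpow_ofNat]; norm_num [jj9]; field_simp)
    (Or.inr fun n => by omega) (Or.inr fun n => by omega) (Or.inr fun n => by omega) (Or.inr (by omega))
  have f1 := AA_flip g.h0 1 4
  have f2 := AA_flip g.h0 2 6
  have f3 := AA_shift g.h0 (-2) (-1)
  norm_num [th_eq, jj6, jj8, jj10 g.h0, jj_refl p 2] at L
  have e3 : th p (-3) = jj p 2 := by rw [th_eq]; norm_num
  norm_num [zpow_neg] at P1 P2 U f1 f2 f3
  rw [P1, P2, U, k81, k89, k84, k86] at L
  have f26 : AA p 2 6 = p ^ 2 * AA p 3 9 := by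
    rw [f2, f3, neg_mul_eq_mul_neg, neg_neg, ← mul_assoc]; congr 1
    field_simp
  have L' : - AA p 1 4 + p * AA p 2 6 = 1 / p * (2 * p ^ 2 * jj p 1 / jj p 5 * AA p 1 5 +
      cc p 1 * ((- p * jj p 3 / (jj p 1 * jj p 2) - p ^ 2 / jj p 4) * jj p 2 / jj p 4)) := by
    rw [f1, f26]
    trans (1 / p * (AA p (-1) 1 + p ^ 4 * AA p 3 9))
    · field_simp
    congr 1
    apply mul_left_cancel₀ j4
    field_simp at L ⊢
    apply mul_left_cancel₀ j2
    linear_combination L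
  rw [L', mul_add, mul_add]
  have A' : -8 * (1 / p * (cc p 1 * ((- p * jj p 3 / (jj p 1 * jj p 2) - p ^ 2 / jj p 4) *
    jj p 2 / jj p 4))) = cc p 1 * (-8 / p * ((- p * jj p 3 / (jj p 1 * jj p 2) - p ^ 2 / jj p 4) *
    jj p 2 / jj p 4)) := by ring
  rw [A', ← A]
  unfold dd4 dd0 dd2 dd3
  rw [k18, k36, k14, k27]
  field_simp
  ring

lemma Good.eq0 {p : ℝ} (g : Good p) :
    jj p 5 * dd0 p - 2 * p * jj p 3 * dd4 p + 2 * p * jj p 1 * dd1 p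
      = 1 + 6 * (AA p 0 1 + p ^ 4 * AA p 4 9) + 8 * (AA p 0 3 + p ^ 2 * AA p 2 7) := by
  have k18 := g.K10 (a := 1) (b := 8) (by omega) (by omega) (by omega) (by omega)
  have k36 := g.K10 (a := 3) (b := 6) (by omega) (by omega) (by omega) (by omega)
  have k27 := g.K10 (a := 2) (b := 7) (by omega) (by omega) (by omega) (by omega)
  have k22 := g.K10 (a := 2) (b := 2) (by omega) (by omega) (by omega) (by omega)
  have k24 := g.K10 (a := 2) (b := 4) (by omega) (by omega) (by omega) (by omega)
  have k29 := g.K10 (a := 2) (b := 9) (by omega) (by omega) (by omega) (by omega)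
  have k62 := g.K10 (a := 6) (b := 2) (by omega) (by omega) (by omega) (by omega)
  have k67 := g.K10 (a := 6) (b := 7) (by omega) (by omega) (by omega) (by omega)
  have k61 := g.K10 (a := 6) (b := 1) (by omega) (by omega) (by omega) (by omega)
  have k66 := g.K10 (a := 6) (b := 6) (by omega) (by omega) (by omega) (by omega)
  have k25 := g.K10 (a := 2) (b := 5) (by omega) (by omega) (by omega) (by omega)
  have k45 := g.K10 (a := 4) (b := 5) (by omega) (by omega) (by omega) (by omega)
  norm_num [jj6, jj7, jj8, jj9, jj11 g.h0, jj12 g.h0, jj13 g.h0] at k18 k36 k27 k22 k24 k29 k62 k67 k61 k66 k25 k45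
  have A := alg0 g.h0.ne' g.j1 g.j2 g.j3 g.j4 g.j5 (rel1 g.h0 g.h1) (rel2 g.h0 g.h1)
  have P14 := KK_parity g.h0 g.h1 (a := 1) 4 (by omega) (by omega)
  have P12 := KK_parity g.h0 g.h1 (a := 1) 2 (by omega) (by omega)
  have P32 := KK_parity g.h0 g.h1 (a := 3) 2 (by omega) (by omega)
  have P31 := KK_parity g.h0 g.h1 (a := 3) 1 (by omega) (by omega)
  have P10 := KK_parity g.h0 g.h1 (a := 1) 0 (by omega) (by omega)
  have P20 := KK_parity g.h0 g.h1 (a := 2) 0 (by omega) (by omega)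
  have F : KK p 5 3 0 = - KK p 5 2 0 := KK_flip g.h0 5 2
  have S1 := g.S1
  have S2 := g.S2
  have hC := g.C_eq
  have hC' : jd p 0 = - cc p 1 := by linarith
  have hp := g.h0.ne'
  have j1 := g.j1
  have j2 := g.j2
  have j3 := g.j3
  have j4 := g.j4
  have j5 := g.j5
  have L := level2 g.h0 g.h1 0 2 2 (2 * p ^ 2 * jj p 1 / jj p 5) (by omega) (by omega)
    (by simp only [th_eq, zpow_ofNat]; norm_num [jj9]; field_simp)
    (Or.inl (by omega)) (Or.inr fun n => by omega) (Or.inr fun n => by omega) (Or.inl (by omega))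
  have M := level2 g.h0 g.h1 0 1 1 (2 * p * jj p 3 / jj p 5) (by omega) (by omega)
    (by simp only [th_eq, zpow_one]; norm_num [jj7]; field_simp)
    (Or.inl (by omega)) (Or.inr fun n => by omega) (Or.inr fun n => by omega) (Or.inl (by omega))
  norm_num [th_eq, jj6, jj7, jj8, jj9, jj10 g.h0, jj13 g.h0] at L M
  norm_num at P14 P12 P32 P31 P10 P20
  rw [F] at M
  rw [P14, P12, k24, k29, k22, k27] at L
  rw [P32, P31, k62, k67, k61, k66] at M
  rw [hC'] at S1 S2
  have L' : AA p 0 1 + p ^ 4 * AA p 4 9 = KK p 5 1 0 + 2 * p ^ 2 * jj p 1 / jj p 5 * AA p 2 5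
      - cc p 1 * ((2 * p ^ 2 * jj p 1 / jj p 5) * (jj p 4 / jj p 2 ^ 2 + p * jj p 1 / (jj p 2 * jj p 3))
        * jj p 1 / jj p 5) := by
    apply mul_left_cancel₀ j5
    field_simp at L ⊢
    linear_combination L
  have M' : AA p 0 3 + p ^ 2 * AA p 2 7 = - KK p 5 2 0 + 2 * p * jj p 3 / jj p 5 * AA p 1 5
      - cc p 1 * ((2 * p * jj p 3 / jj p 5) * (jj p 3 / (jj p 4 * jj p 1) - p * jj p 2 / jj p 4 ^ 2)
        * jj p 3 / jj p 5) := by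
    apply mul_left_cancel₀ j5
    field_simp at M ⊢
    linear_combination M
  have E : 1 + 6 * KK p 5 1 0 - 8 * KK p 5 2 0 = cc p 1 * (jj p 4 ^ 2 / jj p 2 ^ 3
      + 3 * p ^ 2 * jj p 2 ^ 2 / jj p 4 ^ 3 + 6 * p * (jj p 3 / (jj p 2 * jj p 5))
      - 8 * p ^ 2 * (jj p 1 / (jj p 4 * jj p 5))) := by
    rw [P10, P20, k25, k45]
    linear_combination S1 - 3 * S2
  rw [L', M']
  trans (cc p 1 * ((jj p 4 ^ 2 / jj p 2 ^ 3 + 3 * p ^ 2 * jj p 2 ^ 2 / jj p 4 ^ 3)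
      + 6 * p * (jj p 3 / (jj p 2 * jj p 5)) - 8 * p ^ 2 * (jj p 1 / (jj p 4 * jj p 5))
      - 6 * (2 * p ^ 2 * jj p 1 / jj p 5) * (jj p 4 / jj p 2 ^ 2 + p * jj p 1 / (jj p 2 * jj p 3))
        * jj p 1 / jj p 5
      - 8 * (2 * p * jj p 3 / jj p 5) * (jj p 3 / (jj p 4 * jj p 1) - p * jj p 2 / jj p 4 ^ 2)
        * jj p 3 / jj p 5) + 6 * (2 * p ^ 2 * jj p 1 / jj p 5 * AA p 2 5)
        + 8 * (2 * p * jj p 3 / jj p 5 * AA p 1 5))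
  · rw [← A]
    unfold dd4 dd0 dd1 dd3
    rw [k18, k36, k22, k27]
    field_simp
    ring
  · linear_combination -E


lemma tsum_mod5 {f : ℤ → ℝ} (hf : Summable f) :
    ∑' n, f n = ∑' k, f (5 * k) + ∑' k, f (5 * k + 1) + ∑' k, f (5 * k + 2)
      + ∑' k, f (5 * k + 3) + ∑' k, f (5 * k + 4) := by
  have e := (Int.divModEquiv 5).symm.tsum_eq f
  have hs : Summable fun x : ℤ × Fin 5 => f ((Int.divModEquiv 5).symm x) :=
    ((Int.divModEquiv 5).symm.summable_iff (f := f)).mpr hf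
  have inj : ∀ i : ℤ, Summable fun k : ℤ => f (5 * k + i) := fun i =>
    hf.comp_injective (i := fun k : ℤ => 5 * k + i) (fun a b h => by simpa using h)
  have i0 : Summable fun k : ℤ => f (5 * k) := by simpa using inj 0
  rw [← e, hs.tsum_prod]
  simp only [tsum_fintype, Fin.sum_univ_five]
  rw [← i0.tsum_add (inj 1), ← (i0.add (inj 1)).tsum_add (inj 2),
    ← ((i0.add (inj 1)).add (inj 2)).tsum_add (inj 3),
    ← (((i0.add (inj 1)).add (inj 2)).add (inj 3)).tsum_add (inj 4)]
  refine tsum_congr fun k => ?_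
  simp [Int.divModEquiv, mul_comm]

lemma sg_five (k : ℤ) : sg (5 * k) = sg k := by
  rw [show (5 * k : ℤ) = 2 * (2 * k) + k by ring, sg_add, sg_two_mul, one_mul]
lemma sg_two : sg 2 = 1 := by norm_num [sg]
lemma sg_three : sg 3 = -1 := by simp [sg, zpow_ofNat]; norm_num
lemma sg_four : sg 4 = 1 := by simp [sg, zpow_ofNat]; norm_num

noncomputable def phi (q : ℝ) : ℝ := ∑' n : ℤ, sg n * q ^ (n ^ 2)
noncomputable def LL (q : ℝ) : ℝ :=
  1 + ∑' n : ℤ, sg n * q ^ (n ^ 2) * (6 * q ^ n - 8 * q ^ (2 * n)) * (1 - q ^ (5 * n))⁻¹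

lemma summ_phi {q : ℝ} (h0 : 0 < q) (h1 : q < 1) : Summable fun n : ℤ => sg n * q ^ (n ^ 2) := by
  refine summ_bdd h0 h1 1 0 (by norm_num) 1 (fun n => ?_)
  rw [abs_mul, abs_sg, abs_of_pos (zpow_pos h0 _)]
  simp

lemma summ_LL1 {q : ℝ} (h0 : 0 < q) (h1 : q < 1) (y : ℤ) :
    Summable fun n : ℤ => sg n * q ^ (n ^ 2) * q ^ (y * n) * (1 - q ^ (5 * n))⁻¹ := by
  refine summ_bdd h0 h1 1 y (by norm_num) (1 - q)⁻¹ (fun n => ?_)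
  rw [abs_mul, abs_mul, abs_mul, abs_sg, abs_of_pos (zpow_pos h0 _), abs_of_pos (zpow_pos h0 _),
    one_mul, mul_comm, ← zpow_add₀ h0.ne', one_mul]
  exact (mul_le_mul_of_nonneg_right (inv_bd h0 h1 _) (zpow_pos h0 _).le)

lemma summ_LL {q : ℝ} (h0 : 0 < q) (h1 : q < 1) :
    Summable fun n : ℤ => sg n * q ^ (n ^ 2) * (6 * q ^ n - 8 * q ^ (2 * n)) * (1 - q ^ (5 * n))⁻¹ := by
  refine (((summ_LL1 h0 h1 1).mul_left 6).sub ((summ_LL1 h0 h1 2).mul_left 8)).congr (fun n => ?_)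
  rw [one_mul]; ring

lemma zpow5 {q : ℝ} (h0 : 0 < q) (m : ℤ) (r : ℤ) : q ^ (5 * m + r) = q ^ r * (q ^ 5) ^ m := by
  rw [zpow_add₀ h0.ne', zpow_mul, mul_comm]; rfl

lemma phi_dis {q : ℝ} (h0 : 0 < q) (h1 : q < 1) :
    phi q = jj (q ^ 5) 5 - 2 * q * jj (q ^ 5) 3 + 2 * q ^ 4 * jj (q ^ 5) 1 := by
  have p0 : 0 < q ^ 5 := by positivity
  have key : ∀ (i y : ℤ), y = 2 * i → ∑' k : ℤ, sg (5 * k + i) * q ^ ((5 * k + i) ^ 2)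
      = sg i * q ^ (i ^ 2) * th (q ^ 5) y := by
    rintro i y rfl
    unfold th
    rw [← tsum_mul_left]
    refine tsum_congr fun k => ?_
    rw [sg_add, sg_five, show ((5 * k + i) ^ 2 : ℤ) = 5 * (5 * k ^ 2 + 2 * i * k) + i ^ 2 by ring,
      zpow5 h0]
    ring
  have k0 := key 0 0 (by norm_num)
  have k1 := key 1 2 (by norm_num)
  have k2 := key 2 4 (by norm_num)
  have k3 := key 3 6 (by norm_num)
  have k4 := key 4 8 (by norm_num)
  simp only [add_zero] at k0
  unfold phi
  rw [tsum_mod5 (summ_phi h0 h1), k0, k1, k2, k3, k4]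
  simp only [th_eq, sg_zero, sg_one, sg_two, sg_three, sg_four]
  norm_num [jj7, jj9, jj11 p0, jj13 p0]
  field_simp
  ring

lemma LL_dis {q : ℝ} (h0 : 0 < q) (h1 : q < 1) :
    LL q = (1 + 6 * (AA (q ^ 5) 0 1 + (q ^ 5) ^ 4 * AA (q ^ 5) 4 9)
      + 8 * (AA (q ^ 5) 0 3 + (q ^ 5) ^ 2 * AA (q ^ 5) 2 7))
      + q * (6 * q ^ 5 * AA (q ^ 5) 2 5)
      + q ^ 2 * (-6 * (AA (q ^ 5) 1 3 + (q ^ 5) ^ 2 * AA (q ^ 5) 3 7))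
      + q ^ 3 * (-8 * (- AA (q ^ 5) 1 4 + q ^ 5 * AA (q ^ 5) 2 6))
      + q ^ 4 * (-8 * AA (q ^ 5) 1 5) := by
  have p0 : 0 < q ^ 5 := by positivity
  have p1 : q ^ 5 < 1 := pow_lt_one₀ h0.le h1 (by norm_num)
  have key : ∀ (i y z : ℤ), y = 2 * i + 1 → z = 2 * i + 2 →
      ∑' k : ℤ, sg (5 * k + i) * q ^ ((5 * k + i) ^ 2) *
        (6 * q ^ (5 * k + i) - 8 * q ^ (2 * (5 * k + i))) * (1 - q ^ (5 * (5 * k + i)))⁻¹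
      = sg i * q ^ (i ^ 2) * (6 * q ^ i * AA (q ^ 5) i y - 8 * q ^ (2 * i) * AA (q ^ 5) i z) := by
    rintro i y z rfl rfl
    unfold AA
    rw [← tsum_mul_left, ← tsum_mul_left, ← ((summ_AA p0 p1 _ _).mul_left _).tsum_sub
      ((summ_AA p0 p1 _ _).mul_left _), ← tsum_mul_left]
    refine tsum_congr fun k => ?_
    rw [sg_add, sg_five, show ((5 * k + i) ^ 2 : ℤ) = 5 * (5 * k ^ 2 + 2 * i * k) + i ^ 2 by ring,
      zpow5 h0, zpow5 h0 k, show (2 * (5 * k + i) : ℤ) = 5 * (2 * k) + 2 * i by ring, zpow5 h0,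
      show (5 * (5 * k + i) : ℤ) = 5 * (i + 5 * k) + 0 by ring, zpow5 h0 _ 0, zpow_zero, one_mul,
      show (5 * k ^ 2 + (2 * i + 1) * k : ℤ) = (5 * k ^ 2 + 2 * i * k) + k by ring,
      show (5 * k ^ 2 + (2 * i + 2) * k : ℤ) = (5 * k ^ 2 + 2 * i * k) + 2 * k by ring,
      zpow_add₀ p0.ne' (5 * k ^ 2 + 2 * i * k), zpow_add₀ p0.ne' (5 * k ^ 2 + 2 * i * k)]
    ring
  have k0 := key 0 1 2 (by norm_num) (by norm_num)
  have k1 := key 1 3 4 (by norm_num) (by norm_num)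
  have k2 := key 2 5 6 (by norm_num) (by norm_num)
  have k3 := key 3 7 8 (by norm_num) (by norm_num)
  have k4 := key 4 9 10 (by norm_num) (by norm_num)
  simp only [add_zero] at k0
  unfold LL
  rw [tsum_mod5 (summ_LL h0 h1), k0, k1, k2, k3, k4]
  have f1 := AA_flip p0 0 2
  have f2 := AA_flip p0 2 7
  have f3 := AA_shift p0 (-2) (-2)
  have f4 := AA_flip p0 1 5
  have f5 := AA_shift p0 (-1) 0
  norm_num [zpow_neg] at f1 f2 f3 f4 f5
  simp only [sg_zero, sg_one, sg_two, sg_three, sg_four]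
  norm_num
  simp only [zpow_ofNat] at *
  rw [f1, f2, f3, f4, f5]
  field_simp
  ring

theorem main_real {q : ℝ} (h0 : 0 < q) (h1 : q < 1) (g : Good (q ^ 5)) :
    phi q * (dd0 (q ^ 5) + q * dd1 (q ^ 5) + q ^ 2 * dd2 (q ^ 5) + q ^ 3 * dd3 (q ^ 5)
      + q ^ 4 * dd4 (q ^ 5)) = LL q := by
  rw [phi_dis h0 h1, LL_dis h0 h1, ← g.eq0, ← g.eq1, ← g.eq2, ← g.eq3, ← g.dd4_eq]
  ring


/-! ### Combinatorial model -/

abbrev Pt : Type := {s : Multiset ℕ // (0 : ℕ) ∉ s}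

namespace Pt
def sz (s : Pt) : ℕ := s.1.sum
def rk (s : Pt) : ℤ := (s.1.sup : ℤ) - (s.1.card : ℤ)
noncomputable def wt (s : Pt) : ℝ := 2 ^ s.1.toFinset.card
def nil : Pt := ⟨0, by simp⟩

lemma wt_pos (s : Pt) : 0 < s.wt := by unfold wt; positivity

def e1 (x : Pt × ℕ) : Pt := ⟨x.1.1.map Nat.succ + Multiset.replicate x.2 1, by
  intro h
  rcases Multiset.mem_add.1 h with h | h
  · obtain ⟨a, _, ha⟩ := Multiset.mem_map.1 h; omega
  · have := Multiset.eq_of_mem_replicate h; omega⟩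

lemma e1_bij : Function.Bijective e1 := by
  constructor
  · rintro ⟨⟨s, hs⟩, u⟩ ⟨⟨t, ht⟩, v⟩ h
    have h' : s.map Nat.succ + Multiset.replicate u 1 = t.map Nat.succ + Multiset.replicate v 1 :=
      congrArg Subtype.val h
    have hc : ∀ s : Multiset ℕ, 0 ∉ s → (s.map Nat.succ).count 1 = 0 := by
      intro s hs
      rw [Multiset.count_eq_zero]
      intro h
      obtain ⟨a, h1, ha⟩ := Multiset.mem_map.1 h
      have : a = 0 := by omega
      exact hs (this ▸ h1)
    have huv : u = v := by
      have := congrArg (Multiset.count 1) h'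
      rw [Multiset.count_add, Multiset.count_add, hc s hs, hc t ht] at this
      simpa using this
    subst huv
    have h2 := add_right_cancel h'
    have := Multiset.map_injective Nat.succ_injective h2
    subst this; rfl
  · rintro ⟨s, hs⟩
    refine ⟨(⟨(s.filter (fun x => x ≠ 1)).map Nat.pred, ?_⟩, s.count 1), ?_⟩
    · intro h
      obtain ⟨a, h1, ha⟩ := Multiset.mem_map.1 h
      rw [Multiset.mem_filter] at h1
      have : a ≠ 0 := fun h => hs (h ▸ h1.1)
      have h2 := h1.2
      simp only [Nat.pred_eq_sub_one] at ha
      omega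
    · apply Subtype.ext
      change ((s.filter (fun x => x ≠ 1)).map Nat.pred).map Nat.succ + Multiset.replicate (s.count 1) 1 = s
      rw [Multiset.map_map]
      have h1 : (s.filter (fun x => x ≠ 1)).map (Nat.succ ∘ Nat.pred) = s.filter (fun x => x ≠ 1) := by
        conv_rhs => rw [← Multiset.map_id (s.filter (fun x => x ≠ 1))]
        apply Multiset.map_congr rfl
        intro x hx
        have hx1 : x ∈ s := (Multiset.mem_filter.1 hx).1
        have : x ≠ 0 := fun h => hs (h ▸ hx1)
        simp only [Function.comp, id]
        exact Nat.succ_pred this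
      rw [h1, ← Multiset.filter_eq' s 1, add_comm]
      exact Multiset.filter_add_not (fun x => x = 1) s

def e2 (x : Pt × ℕ) : Pt := if h : x.2 = 0 then nil else ⟨x.2 ::ₘ x.1.1, by
  rw [Multiset.mem_cons]; push Not; exact ⟨fun h' => h h'.symm, x.1.2⟩⟩

lemma eq_nil_of_sup {s : Pt} (h : s.1.sup = 0) : s = nil := by
  apply Subtype.ext
  rw [show nil.1 = 0 from rfl, Multiset.eq_zero_iff_forall_notMem]
  intro a ha
  have : a ≤ s.1.sup := Multiset.le_sup ha
  have : a = 0 := by omega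
  exact s.2 (this ▸ ha)

lemma sup_mem {s : Multiset ℕ} (h : s.sup ≠ 0) : s.sup ∈ s := by
  induction s using Multiset.induction_on with
  | empty => simp at h
  | cons a s ih =>
    rw [Multiset.sup_cons] at h ⊢
    rcases le_total a s.sup with h1 | h1
    · rw [sup_eq_right.2 h1] at h ⊢; exact Multiset.mem_cons_of_mem (ih h)
    · rw [sup_eq_left.2 h1]; exact Multiset.mem_cons_self _ _

lemma e2_sup (x : Pt × ℕ) (hx : x.1.1.sup ≤ x.2) : (e2 x).1.sup = x.2 := by
  unfold e2
  split_ifs with h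
  · rw [h]; rfl
  · simp only [Multiset.sup_cons]; exact sup_eq_left.2 hx

lemma e2_bij : Function.Bijective (fun x : {x : Pt × ℕ // x.1.1.sup ≤ x.2} => e2 x.1) := by
  constructor
  · rintro ⟨⟨s, u⟩, hs⟩ ⟨⟨t, v⟩, ht⟩ h
    have h0 : e2 (s, u) = e2 (t, v) := h
    have huv : u = v := by
      have h1 := e2_sup (s, u) hs
      have h2 := e2_sup (t, v) ht
      rw [h0] at h1; exact h1.symm.trans h2
    subst huv
    have : s = t := by
      by_cases hu : u = 0
      · subst hu
        exact (eq_nil_of_sup (Nat.le_zero.1 hs)).trans (eq_nil_of_sup (Nat.le_zero.1 ht)).symm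
      · unfold e2 at h0
        simp only [hu, dif_neg, not_false_eq_true] at h0
        have := congrArg Subtype.val h0
        simp only [Multiset.cons_inj_right] at this
        exact Subtype.ext this
    subst this; rfl
  · intro s
    by_cases h : s.1.sup = 0
    · refine ⟨⟨(nil, 0), by simp [nil]⟩, ?_⟩
      rw [eq_nil_of_sup h]; rfl
    · have hm := sup_mem h
      refine ⟨⟨(⟨s.1.erase s.1.sup, fun h => s.2 (Multiset.mem_of_mem_erase h)⟩, s.1.sup), ?_⟩, ?_⟩
      · exact Multiset.sup_le.2 fun b hb => Multiset.le_sup (Multiset.mem_of_mem_erase hb)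
      · apply Subtype.ext
        unfold e2
        simp only [h, dif_neg, not_false_eq_true]
        exact Multiset.cons_erase hm

end Pt

noncomputable def om (x : ℤ) : ℝ := if x < 0 then 0 else if x = 0 then 1 else 2

lemma om_neg {x : ℤ} (h : x < 0) : om x = 0 := by simp [om, h]
lemma om_zero : om 0 = 1 := by simp [om]
lemma om_pos {x : ℤ} (h : 0 < x) : om x = 2 := by
  unfold om; rw [if_neg (by omega), if_neg (by omega)]
lemma om_nonneg (x : ℤ) : 0 ≤ om x := by unfold om; split_ifs <;> norm_num
lemma om_le (x : ℤ) : om x ≤ 2 := by unfold om; split_ifs <;> norm_num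
lemma om_add (x : ℤ) : om x + om (-x) = 2 := by
  rcases lt_trichotomy x 0 with h | h | h
  · rw [om_neg h, om_pos (by omega)]; norm_num
  · subst h; simp [om]; norm_num
  · rw [om_pos h, om_neg (by omega)]; norm_num

namespace Pt

lemma sz_e1 (t : Pt) (u : ℕ) : (e1 (t, u)).sz = t.sz + t.1.card + u := by
  simp only [e1, sz, Multiset.sum_add, Multiset.sum_replicate, smul_eq_mul, mul_one]
  congr 1
  simp

lemma card_e1 (t : Pt) (u : ℕ) : (e1 (t, u)).1.card = t.1.card + u := by simp [e1]

lemma sup_map_succ (s : Multiset ℕ) (h : s ≠ 0) : (s.map Nat.succ).sup = s.sup + 1 := by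
  induction s using Multiset.induction_on with
  | empty => simp at h
  | cons a s ih =>
    rw [Multiset.map_cons, Multiset.sup_cons, Multiset.sup_cons]
    by_cases hs : s = 0
    · subst hs; simp
    · rw [ih hs]
      simp only [Nat.succ_eq_add_one]
      omega

lemma sup_e1 (t : Pt) (u : ℕ) (h : ¬ (t = nil ∧ u = 0)) : (e1 (t, u)).1.sup = t.1.sup + 1 := by
  simp only [e1, Multiset.sup_add]
  by_cases ht : t = nil
  · have hu : u ≠ 0 := fun hu => h ⟨ht, hu⟩
    subst ht
    obtain ⟨v, rfl⟩ := Nat.exists_eq_succ_of_ne_zero hu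
    have : (Multiset.replicate (v+1) 1).sup ≤ 1 := Multiset.sup_le.2 fun b hb => (Multiset.eq_of_mem_replicate hb).le
    have h2 : 1 ≤ (Multiset.replicate (v+1) 1).sup := Multiset.le_sup (by simp)
    simp only [nil, Multiset.map_zero, Multiset.sup_zero]
    rw [le_antisymm this h2]; simp
  · have h1 : t.1 ≠ 0 := fun h => ht (Subtype.ext h)
    rw [sup_map_succ _ h1]
    have : (Multiset.replicate u 1).sup ≤ 1 := Multiset.sup_le.2 fun b hb => (Multiset.eq_of_mem_replicate hb).le
    omega

lemma wt_e1 (t : Pt) (u : ℕ) : (e1 (t, u)).wt = t.wt * om u := by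
  simp only [wt, e1, Multiset.toFinset_add]
  have h1 : (t.1.map Nat.succ).toFinset = t.1.toFinset.image Nat.succ := by
    ext a; simp
  have h2 : (t.1.toFinset.image Nat.succ).card = t.1.toFinset.card :=
    Finset.card_image_of_injective _ Nat.succ_injective
  rcases Nat.eq_zero_or_pos u with rfl | hu
  · simp [h1, h2, om]
  · rw [om_pos (by omega), h1]
    have h3 : (Multiset.replicate u 1).toFinset = {1} := by
      rw [Multiset.toFinset_replicate, if_neg (by omega)]
    rw [h3, Finset.union_comm, ← Finset.insert_eq, Finset.card_insert_of_notMem, h2, pow_succ]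
    simp
    exact t.2

lemma sz_e2 (t : Pt) (K : ℕ) (h : t.1.sup ≤ K) : (e2 (t, K)).sz = t.sz + K := by
  unfold e2
  split_ifs with hK
  · simp only at hK
    subst hK
    rw [eq_nil_of_sup (Nat.le_zero.1 h)]; rfl
  · simp [sz, add_comm]

lemma wt_e2 (t : Pt) (K : ℕ) (h : t.1.sup ≤ K) : (e2 (t, K)).wt = t.wt * om ((K : ℤ) - t.1.sup) := by
  unfold e2
  split_ifs with hK
  · simp only at hK
    subst hK
    rw [eq_nil_of_sup (Nat.le_zero.1 h)]; simp [nil, wt, om]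
  · simp only at hK
    simp only [wt, Multiset.toFinset_cons]
    rcases Nat.lt_or_eq_of_le h with h1 | h1
    · rw [om_pos (by omega), Finset.card_insert_of_notMem, pow_succ]
      rw [Multiset.mem_toFinset]
      intro h2
      have : K ≤ t.1.sup := Multiset.le_sup h2
      omega
    · have : K ∈ t.1 := by
        rw [← h1]; exact sup_mem (by omega)
      rw [Finset.insert_eq_of_mem (by simpa using this), h1]
      simp [om]

lemma rk_e2 (t : Pt) (K : ℕ) (h : t.1.sup ≤ K) (hK : K ≠ 0) :
    (e2 (t, K)).rk = (K : ℤ) - t.1.card - 1 := by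
  have := e2_sup (t, K) h
  rw [rk, this]
  simp only [e2, hK, dif_neg, not_false_eq_true, Multiset.card_cons]
  push_cast; ring

lemma rk_e1 (t : Pt) (u : ℕ) (h : ¬ (t = nil ∧ u = 0)) :
    (e1 (t, u)).rk = (t.1.sup : ℤ) + 1 - t.1.card - u := by
  rw [rk, sup_e1 t u h, card_e1]; push_cast; ring

lemma e1_nil : e1 (nil, 0) = nil := rfl
lemma e2_nil : e2 (nil, 0) = nil := rfl
lemma rk_nil : nil.rk = 0 := rfl
lemma sz_nil : nil.sz = 0 := rfl
lemma wt_nil : nil.wt = 1 := by simp [nil, wt]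

end Pt


namespace Pt

def fibEquiv (n : ℕ) : {s : Pt // s.sz = n} ≃ n.Partition where
  toFun s := ⟨s.1.1, fun {i} hi => Nat.pos_of_ne_zero fun h => s.1.2 (h ▸ hi), s.2⟩
  invFun π := ⟨⟨π.parts, fun h => absurd (π.parts_pos h) (lt_irrefl 0)⟩, π.parts_sum⟩
  left_inv s := rfl
  right_inv π := rfl

instance (n : ℕ) : Fintype {s : Pt // s.sz = n} := Fintype.ofEquiv _ (fibEquiv n).symm

lemma card_fib (n : ℕ) : Fintype.card {s : Pt // s.sz = n} ≤ 2 ^ n := by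
  rw [Fintype.card_congr (fibEquiv n)]
  calc Fintype.card n.Partition ≤ Fintype.card (Composition n) :=
        Fintype.card_le_of_surjective _ Nat.Partition.ofComposition_surj
    _ = 2 ^ (n - 1) := composition_card n
    _ ≤ 2 ^ n := Nat.pow_le_pow_right (by norm_num) (by omega)

lemma wt_le (s : Pt) : s.wt ≤ 2 ^ s.sz := by
  unfold wt
  apply pow_le_pow_right₀ (by norm_num)
  refine (Multiset.toFinset_card_le _).trans ?_
  have := Multiset.card_nsmul_le_sum (s := s.1) (a := 1) (fun x hx =>
    Nat.one_le_iff_ne_zero.2 fun h => s.2 (h ▸ hx))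
  simpa [sz] using this

lemma summ_base {q : ℝ} (h0 : 0 < q) (hq : q < 1 / 8) : Summable fun s : Pt => s.wt * q ^ s.sz := by
  rw [← (Equiv.sigmaFiberEquiv sz).summable_iff]
  have hnn : ∀ s : Pt, 0 ≤ s.wt * q ^ s.sz := fun s => mul_nonneg s.wt_pos.le (by positivity)
  refine (summable_sigma_of_nonneg (fun x => hnn ((Equiv.sigmaFiberEquiv sz) x))).2 ?_
  refine ⟨fun n => (hasSum_fintype _).summable, ?_⟩
  refine Summable.of_nonneg_of_le (fun n => tsum_nonneg fun x => hnn _) (fun n => ?_)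
    (summable_geometric_of_lt_one (r := 4 * q) (by positivity) (by linarith))
  rw [tsum_fintype]
  calc _ ≤ ∑ _x : {s : Pt // s.sz = n}, (2 : ℝ) ^ n * q ^ n := by
        apply Finset.sum_le_sum
        rintro ⟨s, hs⟩ _
        simp only [Function.comp, Equiv.sigmaFiberEquiv_apply]
        rw [hs]
        have := wt_le s
        rw [hs] at this
        exact mul_le_mul_of_nonneg_right this (by positivity)
    _ = (Fintype.card {s : Pt // s.sz = n} : ℝ) * (2 ^ n * q ^ n) := by
        rw [Finset.sum_const, nsmul_eq_mul]; rfl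
    _ ≤ (2 : ℝ) ^ n * (2 ^ n * q ^ n) := by
        apply mul_le_mul_of_nonneg_right _ (by positivity)
        exact_mod_cast card_fib n
    _ = (4 * q) ^ n := by rw [← mul_assoc, ← mul_pow, ← mul_pow]; norm_num

end Pt

noncomputable def PS (q : ℝ) (χ : Pt → ℝ) : ℝ := ∑' s : Pt, s.wt * q ^ s.sz * χ s

lemma summ_PS {q : ℝ} (h0 : 0 < q) (hq : q < 1 / 8) {χ : Pt → ℝ} (C : ℝ) (hχ : ∀ s, |χ s| ≤ C) :
    Summable fun s : Pt => s.wt * q ^ s.sz * χ s := by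
  refine Summable.of_norm_bounded ((Pt.summ_base h0 hq).mul_right C) fun s => ?_
  have h : 0 ≤ s.wt * q ^ s.sz := mul_nonneg s.wt_pos.le (by positivity)
  rw [Real.norm_eq_abs, abs_mul, abs_of_nonneg h]
  exact mul_le_mul_of_nonneg_left (hχ s) h

noncomputable def UU (q : ℝ) (M : ℤ) : ℝ := PS q fun s => om (s.rk - M)
noncomputable def VV (q : ℝ) (M : ℤ) : ℝ := PS q fun s => om (M + 1 - s.rk)
noncomputable def PB (q : ℝ) : ℝ := PS q fun _ => 1

lemma om_abs (x : ℤ) : |om x| ≤ 2 := by rw [abs_of_nonneg (om_nonneg x)]; exact om_le x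

lemma summ_UU {q : ℝ} (h0 : 0 < q) (hq : q < 1 / 8) (M : ℤ) :
    Summable fun s : Pt => s.wt * q ^ s.sz * om (s.rk - M) :=
  summ_PS h0 hq (χ := fun s => om (s.rk - M)) 2 (fun _ => om_abs _)
lemma summ_VV {q : ℝ} (h0 : 0 < q) (hq : q < 1 / 8) (M : ℤ) :
    Summable fun s : Pt => s.wt * q ^ s.sz * om (M + 1 - s.rk) :=
  summ_PS h0 hq (χ := fun s => om (M + 1 - s.rk)) 2 (fun _ => om_abs _)

lemma UV {q : ℝ} (h0 : 0 < q) (hq : q < 1 / 8) (M : ℤ) : UU q M + VV q (M - 1) = 2 * PB q := by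
  unfold UU VV PB PS
  rw [← (summ_UU h0 hq M).tsum_add (summ_VV h0 hq (M - 1)), ← tsum_mul_left]
  refine tsum_congr fun s => ?_
  have := om_add (s.rk - M)
  rw [show -(s.rk - M) = M - 1 + 1 - s.rk by ring] at this
  linear_combination (s.wt * q ^ s.sz) * this

/-- generic part of the summand -/
noncomputable def GA (q : ℝ) (M : ℤ) (x : Pt × ℕ) : ℝ :=
  x.1.wt * q ^ (x.1.sz + x.2) * (om ((x.2 : ℤ) - x.1.1.sup) * om ((x.2 : ℤ) - x.1.1.card - M - 1))
noncomputable def GB (q : ℝ) (M : ℤ) (x : Pt × ℕ) : ℝ :=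
  x.1.wt * q ^ (x.1.sz + x.1.1.card + x.2) * (om (x.2 : ℤ) * om ((x.2 : ℤ) + x.1.1.card + M + 1 - x.1.1.sup))

lemma summ_exc (c : ℝ) : HasSum (fun x : Pt × ℕ => if x = (Pt.nil, 0) then c else 0) c := by
  convert hasSum_ite_eq (Pt.nil, 0) c using 1

lemma HasSum.congr_fun' {ι : Type*} {f g : ι → ℝ} {a : ℝ} (h : HasSum f a) (hfg : ∀ i, g i = f i) :
    HasSum g a := by
  rwa [show g = f from funext hfg]

lemma hasSum_UU {q : ℝ} (h0 : 0 < q) (hq : q < 1 / 8) (M : ℤ) :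
    HasSum (GA q M) (UU q M - (om (-M) - om (-M - 1))) := by
  have h := (summ_UU h0 hq M).hasSum
  have h1 := (Equiv.ofBijective _ Pt.e2_bij).hasSum_iff.2 h
  have h2 : HasSum (fun x : Pt × ℕ => GA q M x + if x = (Pt.nil, 0) then (om (-M) - om (-M - 1)) else 0)
      (UU q M) := by
    have hh := (hasSum_subtype_iff_of_support_subset (f := fun x : Pt × ℕ => GA q M x +
      if x = (Pt.nil, 0) then (om (-M) - om (-M - 1)) else 0) (s := {x : Pt × ℕ | x.1.1.sup ≤ x.2})
      (a := UU q M) ?_).1 ?_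
    · exact hh
    · intro x hx
      by_contra hc
      apply hx
      have hc' : x.2 < x.1.1.sup := lt_of_not_ge hc
      have : x ≠ (Pt.nil, 0) := by
        rintro rfl; exact absurd hc' (by simp [Pt.nil])
      simp only [if_neg this, GA, om_neg (show (x.2 : ℤ) - x.1.1.sup < 0 by omega)]
      ring
    · refine HasSum.congr_fun' h1 ?_
      rintro ⟨⟨t, K⟩, hx⟩
      have hx' : t.1.sup ≤ K := hx
      simp only [Function.comp, Equiv.ofBijective_apply, GA]
      rw [Pt.wt_e2 t K hx', Pt.sz_e2 t K hx']
      by_cases hK : K = 0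
      · subst hK
        have := Pt.eq_nil_of_sup (Nat.le_zero.1 hx')
        subst this
        rw [if_pos rfl, Pt.e2_nil, Pt.rk_nil, Pt.wt_nil, Pt.sz_nil]
        simp [Pt.nil, om_zero]
      · rw [if_neg (by simp [hK]), Pt.rk_e2 t K hx' hK,
          show (K : ℤ) - t.1.card - 1 - M = (K : ℤ) - t.1.card - M - 1 by ring]
        ring
  have := h2.sub (summ_exc (om (-M) - om (-M - 1)))
  simpa using this

lemma hasSum_VV {q : ℝ} (h0 : 0 < q) (hq : q < 1 / 8) (M : ℤ) :
    HasSum (GB q M) (VV q (M + 1) - (om (M + 2) - om (M + 1))) := by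
  have h := (summ_VV h0 hq (M + 1)).hasSum
  have h1 := (Equiv.ofBijective _ Pt.e1_bij).hasSum_iff.2 h
  have h2 : HasSum (fun x : Pt × ℕ => GB q M x + if x = (Pt.nil, 0) then (om (M + 2) - om (M + 1)) else 0)
      (VV q (M + 1)) := by
    refine HasSum.congr_fun' h1 ?_
    rintro ⟨t, u⟩
    simp only [Function.comp, Equiv.ofBijective_apply, GB]
    rw [Pt.wt_e1, Pt.sz_e1]
    by_cases hK : t = Pt.nil ∧ u = 0
    · obtain ⟨rfl, rfl⟩ := hK
      rw [if_pos rfl, Pt.e1_nil, Pt.rk_nil, Pt.wt_nil, Pt.sz_nil]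
      simp [Pt.nil, om_zero, add_assoc]
    · rw [if_neg (by simpa using hK), Pt.rk_e1 t u hK,
        show M + 1 + 1 - ((t.1.sup : ℤ) + 1 - t.1.card - u) = (u : ℤ) + t.1.card + M + 1 - t.1.sup by ring]
      ring
  have := h2.sub (summ_exc (om (M + 2) - om (M + 1)))
  simpa using this

lemma tsum_nat_int {F : ℤ → ℝ} (h : ∀ n < 0, F n = 0) : ∑' n : ℕ, F n = ∑' n : ℤ, F n :=
  Function.Injective.tsum_eq Nat.cast_injective (by
    intro n hn
    have : 0 ≤ n := by
      by_contra hc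
      exact hn (h n (by omega))
    exact ⟨n.toNat, by simp [this]⟩)

lemma UV_rel {q : ℝ} (h0 : 0 < q) (hq : q < 1 / 8) (M : ℤ) :
    UU q M - (om (-M) - om (-M - 1)) = q ^ (M + 1) * (VV q (M + 1) - (om (M + 2) - om (M + 1))) := by
  have hA := hasSum_UU h0 hq M
  have hB := hasSum_VV h0 hq M
  rw [← hA.tsum_eq, ← hB.tsum_eq, hA.summable.tsum_prod, hB.summable.tsum_prod, ← tsum_mul_left]
  refine tsum_congr fun t => ?_
  have hz : ∀ n : ℕ, q ^ n = q ^ (n : ℤ) := fun n => (zpow_natCast q n).symm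
  have e1 : ∑' K : ℕ, GA q M (t, K) = ∑' K : ℤ, t.wt * q ^ ((t.sz : ℤ) + K) *
      (om (K - t.1.sup) * om (K - t.1.card - M - 1)) := by
    rw [← tsum_nat_int]
    · refine tsum_congr fun K => ?_
      simp only [GA, hz]; push_cast; rfl
    · intro n hn
      rw [om_neg (show n - (t.1.sup : ℤ) < 0 by omega)]; ring
  have e2 : ∑' u : ℕ, GB q M (t, u) = ∑' u : ℤ, t.wt * q ^ ((t.sz : ℤ) + t.1.card + u) *
      (om u * om (u + t.1.card + M + 1 - t.1.sup)) := by
    rw [← tsum_nat_int (F := fun u : ℤ => t.wt * q ^ ((t.sz : ℤ) + t.1.card + u) *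
      (om u * om (u + t.1.card + M + 1 - t.1.sup)))]
    · refine tsum_congr fun K => ?_
      simp only [GB, hz]; push_cast; rfl
    · intro n hn
      rw [om_neg hn]; ring
  rw [e1, e2, ← tsum_mul_left, ← (Equiv.addRight ((t.1.card : ℤ) + M + 1)).tsum_eq]
  refine tsum_congr fun u => ?_
  simp only [Equiv.coe_addRight]
  rw [show (t.sz : ℤ) + (u + (t.1.card + M + 1)) = (M + 1) + (t.sz + t.1.card + u) by ring,
    zpow_add₀ h0.ne', show u + ((t.1.card : ℤ) + M + 1) - t.1.card - M - 1 = u by ring,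
    show u + ((t.1.card : ℤ) + M + 1) = u + t.1.card + M + 1 by ring]
  ring

/-- The recursion for the upper tail. -/
lemma UU_rec {q : ℝ} (h0 : 0 < q) (hq : q < 1 / 8) (m : ℕ) :
    UU q m = (if m = 0 then 1 else 0) + q ^ (m + 1) * (2 * PB q - UU q ((m + 2 : ℕ))) := by
  have h := UV_rel h0 hq m
  have h2 := UV h0 hq (m + 2)
  rw [show (m : ℤ) + 2 - 1 = m + 1 by ring] at h2
  rw [om_pos (show (0 : ℤ) < m + 2 by omega), om_pos (show (0 : ℤ) < m + 1 by omega),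
    om_neg (show -(m : ℤ) - 1 < 0 by omega)] at h
  have h3 : om (-(m : ℤ)) = if m = 0 then 1 else 0 := by
    split_ifs with hm
    · subst hm; simp [om]
    · exact om_neg (by omega)
  rw [h3] at h
  have h4 : q ^ ((m : ℤ) + 1) = q ^ (m + 1) := by rw [← zpow_natCast]; push_cast; rfl
  rw [h4] at h
  push_cast
  linear_combination h + q ^ (m + 1) * h2

lemma VV_rec {q : ℝ} (h0 : 0 < q) (hq : q < 1 / 8) (m : ℕ) :
    VV q (-m - 1) = (if m = 0 then 1 else 0) + q ^ (m + 1) * (2 * PB q - VV q (-((m + 2 : ℕ) : ℤ) - 1)) := by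
  have h := UV_rel h0 hq (-m - 2)
  have h2 := UV h0 hq (-m - 2)
  rw [show -(m : ℤ) - 2 - 1 = -((m + 2 : ℕ) : ℤ) - 1 by push_cast; ring] at h2
  rw [show -(m : ℤ) - 2 + 1 = -((m : ℤ) + 1) by ring, show -(m : ℤ) - 2 + 2 = -m by ring,
    om_neg (show -((m : ℤ) + 1) < 0 by omega),
    om_pos (show (0 : ℤ) < -(-(m : ℤ) - 2) by omega), om_pos (show (0 : ℤ) < -(-(m : ℤ) - 2) - 1 by omega)] at h
  have h3 : om (-(m : ℤ)) = if m = 0 then 1 else 0 := by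
    split_ifs with hm
    · subst hm; simp [om]
    · exact om_neg (by omega)
  rw [h3] at h
  have h4 : q ^ (-((m : ℤ) + 1)) * q ^ (m + 1) = 1 := by
    rw [zpow_neg, ← zpow_natCast q (m + 1)]; push_cast
    exact inv_mul_cancel₀ (zpow_ne_zero _ h0.ne')
  rw [show -(m : ℤ) - 1 = -((m : ℤ) + 1) by ring]
  linear_combination (-q ^ (m + 1)) * h + q ^ (m + 1) * h2 + (-(VV q (-((m : ℤ) + 1))) + (if m = 0 then 1 else 0)) * h4


noncomputable def SS (q : ℝ) (m : ℕ) : ℝ := ∑' r : ℕ, (-1) ^ r * q ^ ((r + 1) ^ 2 + m * (r + 1))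

lemma SS_bd {q : ℝ} (h0 : 0 < q) (h1 : q < 1) (m r : ℕ) :
    ‖(-1) ^ r * q ^ ((r + 1) ^ 2 + m * (r + 1))‖ ≤ q ^ m * q ^ r := by
  rw [norm_mul, norm_pow, norm_neg, norm_one, one_pow, one_mul, Real.norm_eq_abs,
    abs_of_pos (by positivity), ← pow_add]
  apply pow_le_pow_of_le_one h0.le h1.le
  nlinarith

lemma summ_SS {q : ℝ} (h0 : 0 < q) (h1 : q < 1) (m : ℕ) :
    Summable fun r : ℕ => (-1) ^ r * q ^ ((r + 1) ^ 2 + m * (r + 1)) :=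
  Summable.of_norm_bounded ((summable_geometric_of_lt_one h0.le h1).mul_left (q ^ m)) (SS_bd h0 h1 m)

lemma SS_rec {q : ℝ} (h0 : 0 < q) (h1 : q < 1) (m : ℕ) : SS q m = q ^ (m + 1) * (1 - SS q (m + 2)) := by
  unfold SS
  rw [(summ_SS h0 h1 m).tsum_eq_zero_add, mul_sub, ← tsum_mul_left, sub_eq_add_neg, ← tsum_neg]
  congr 1
  · simp [add_comm]
  · refine tsum_congr fun r => ?_
    rw [show (r + 1 + 1) ^ 2 + m * (r + 1 + 1) = (m + 1) + ((r + 1) ^ 2 + (m + 2) * (r + 1)) by ring,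
      pow_add, pow_succ]
    ring

lemma SS_abs {q : ℝ} (h0 : 0 < q) (h1 : q < 1) (m : ℕ) : |SS q m| ≤ (1 - q)⁻¹ := by
  have h := tsum_of_norm_bounded ((hasSum_geometric_of_lt_one h0.le h1).mul_left (q ^ m)) (SS_bd h0 h1 m)
  rw [Real.norm_eq_abs] at h
  refine h.trans ?_
  have : q ^ m ≤ 1 := pow_le_one₀ h0.le h1.le
  have h2 : 0 ≤ (1 - q)⁻¹ := inv_nonneg.2 (by linarith)
  nlinarith

lemma rec_zero {q : ℝ} (h0 : 0 < q) (h1 : q < 1) {d : ℕ → ℝ} {C : ℝ} (hb : ∀ m, |d m| ≤ C)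
    (hd : ∀ m, d m = - (q ^ (m + 1) * d (m + 2))) (m : ℕ) : d m = 0 := by
  have key : ∀ k m, |d m| ≤ q ^ k * C := by
    intro k
    induction k with
    | zero => intro m; simpa using hb m
    | succ k ih =>
      intro m
      rw [hd m, abs_neg, abs_mul, abs_of_pos (by positivity), pow_succ, pow_succ]
      have hm : q ^ m ≤ 1 := pow_le_one₀ h0.le h1.le
      calc q ^ m * q * |d (m + 2)| ≤ 1 * q * (q ^ k * C) := by
            apply mul_le_mul _ (ih _) (abs_nonneg _) (by positivity)
            exact mul_le_mul_of_nonneg_right hm h0.le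
        _ = _ := by ring
  have hlim : Filter.Tendsto (fun k => q ^ k * C) Filter.atTop (nhds (0 * C)) :=
    (tendsto_pow_atTop_nhds_zero_of_lt_one h0.le h1).mul_const C
  rw [zero_mul] at hlim
  have := ge_of_tendsto' hlim (fun k => key k m)
  exact abs_nonpos_iff.1 this

lemma PS_abs {q : ℝ} (h0 : 0 < q) (hq : q < 1 / 8) {χ : Pt → ℝ} (C : ℝ) (hχ : ∀ s, |χ s| ≤ C) :
    |PS q χ| ≤ PB q * C := by
  have hs : Summable fun s : Pt => s.wt * q ^ s.sz * 1 := by simpa using Pt.summ_base h0 hq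
  have h := tsum_of_norm_bounded (f := fun s : Pt => s.wt * q ^ s.sz * χ s) (hs.hasSum.mul_right C) (fun s => by
    have h : 0 ≤ s.wt * q ^ s.sz := mul_nonneg s.wt_pos.le (by positivity)
    rw [Real.norm_eq_abs, abs_mul, abs_of_nonneg h, mul_one]
    exact mul_le_mul_of_nonneg_left (hχ s) h)
  exact h

lemma rec_sol {q : ℝ} (h0 : 0 < q) (h1 : q < 1) {x : ℕ → ℝ} {C P : ℝ} (hb : ∀ m, |x m| ≤ C)
    (hx : ∀ m, x m = (if m = 0 then 1 else 0) + q ^ (m + 1) * (2 * P - x (m + 2))) (m : ℕ) :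
    x m = (if m = 0 then 1 else 0) + 2 * P * SS q m := by
  have := rec_zero h0 h1 (d := fun m => x m - ((if m = 0 then 1 else 0) + 2 * P * SS q m))
    (C := C + (1 + 2 * |P| * (1 - q)⁻¹)) (fun m => by
      refine (abs_sub _ _).trans (add_le_add (hb m) ?_)
      refine (abs_add_le _ _).trans (add_le_add ?_ ?_)
      · split_ifs <;> simp
      · rw [abs_mul, abs_mul, abs_two]
        exact mul_le_mul_of_nonneg_left (SS_abs h0 h1 m) (by positivity)) (fun m => by
      have h2 := SS_rec h0 h1 m
      have h3 := hx m
      simp only [show ¬ (m + 2 = 0) by omega, if_false]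
      linear_combination h3 - 2 * P * h2) m
  linear_combination this

lemma UU_eq {q : ℝ} (h0 : 0 < q) (hq : q < 1 / 8) (m : ℕ) :
    UU q m = (if m = 0 then 1 else 0) + 2 * PB q * SS q m :=
  rec_sol h0 (by linarith) (x := fun m => UU q m) (C := PB q * 2)
    (fun m => PS_abs h0 hq 2 fun s => om_abs _) (fun m => UU_rec h0 hq m) m

lemma VV_eq {q : ℝ} (h0 : 0 < q) (hq : q < 1 / 8) (m : ℕ) :
    VV q (-m - 1) = (if m = 0 then 1 else 0) + 2 * PB q * SS q m :=
  rec_sol h0 (by linarith) (x := fun m : ℕ => VV q (-m - 1)) (C := PB q * 2)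
    (fun m => PS_abs h0 hq 2 fun s => om_abs _) (fun m => VV_rec h0 hq m) m

lemma phi_SS {q : ℝ} (h0 : 0 < q) (h1 : q < 1) : phi q = 1 - 2 * SS q 0 := by
  have hs := summ_phi h0 h1
  have h1' : ∀ n : ℕ, sg (-((n : ℤ) + 1)) * q ^ ((-((n : ℤ) + 1)) ^ 2) =
      - ((-1) ^ n * q ^ ((n + 1) ^ 2 + 0 * (n + 1))) := by
    intro n
    rw [sg_neg, sg_add, sg_one, show (-((n : ℤ) + 1)) ^ 2 = (((n + 1) ^ 2 : ℕ) : ℤ) by push_cast; ring,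
      zpow_natCast]
    simp [sg]
  have h2' : ∀ n : ℕ, sg (((n + 1 : ℕ) : ℤ)) * q ^ ((((n + 1 : ℕ) : ℤ)) ^ 2) =
      - ((-1) ^ n * q ^ ((n + 1) ^ 2 + 0 * (n + 1))) := by
    intro n
    rw [← h1' n, sg_neg]; push_cast; rw [neg_sq]
  have hsN : Summable fun n : ℕ => sg (n : ℤ) * q ^ ((n : ℤ) ^ 2) := hs.comp_injective Nat.cast_injective
  have hsM : Summable fun n : ℕ => sg (-((n : ℤ) + 1)) * q ^ ((-((n : ℤ) + 1)) ^ 2) := by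
    simp only [h1']; exact (summ_SS h0 h1 0).neg
  have e : phi q = _ := tsum_of_nat_of_neg_add_one hsN hsM
  rw [e, hsN.tsum_eq_zero_add, tsum_congr h1', tsum_congr h2', tsum_neg]
  have e2 : ∑' r : ℕ, (-1) ^ r * q ^ ((r + 1) ^ 2 + 0 * (r + 1)) = SS q 0 := rfl
  rw [e2]
  simp only [Nat.cast_zero, sg_zero]
  norm_num
  ring

lemma PB_phi {q : ℝ} (h0 : 0 < q) (hq : q < 1 / 8) : PB q * phi q = 1 := by
  have h1 := UU_eq h0 hq 0
  have h2 := VV_eq h0 hq 0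
  have h3 := UV h0 hq 0
  simp only [Nat.cast_zero, neg_zero, if_true] at h1 h2
  rw [phi_SS h0 (by linarith)]
  linear_combination (h1 + h2 - h3) / 2

noncomputable def fr (q : ℝ) (m : ℤ) : ℝ := PS q fun s => if s.rk = m then 1 else 0

lemma ind_abs (p : Prop) [Decidable p] : |if p then (1 : ℝ) else 0| ≤ 1 := by split_ifs <;> simp

lemma fr_U {q : ℝ} (h0 : 0 < q) (hq : q < 1 / 8) (m : ℤ) :
    UU q m - UU q (m + 1) = fr q m + fr q (m + 1) := by
  unfold UU fr PS
  rw [← (summ_UU h0 hq m).tsum_sub (summ_UU h0 hq (m + 1)),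
    ← (summ_PS h0 hq 1 fun s => ind_abs _).tsum_add (summ_PS h0 hq 1 fun s => ind_abs _)]
  refine tsum_congr fun s => ?_
  rw [← mul_sub, ← mul_add]
  congr 1
  unfold om
  split_ifs <;> first | omega | norm_num

lemma fr_V {q : ℝ} (h0 : 0 < q) (hq : q < 1 / 8) (m : ℤ) :
    VV q (-m - 1) - VV q (-(m + 1) - 1) = fr q (-m) + fr q (-(m + 1)) := by
  unfold VV fr PS
  rw [← (summ_VV h0 hq (-m - 1)).tsum_sub (summ_VV h0 hq (-(m + 1) - 1)),
    ← (summ_PS h0 hq 1 fun s => ind_abs _).tsum_add (summ_PS h0 hq 1 fun s => ind_abs _)]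
  refine tsum_congr fun s => ?_
  rw [← mul_sub, ← mul_add]
  congr 1
  unfold om
  split_ifs <;> first | omega | norm_num

lemma fr_nat {q : ℝ} (h0 : 0 < q) (hq : q < 1 / 8) (m : ℕ) : fr q m = fr q (-m) := by
  induction m with
  | zero => simp
  | succ m ih =>
    have h1 := fr_U h0 hq m
    have h2 := fr_V h0 hq m
    have h3 := UU_eq h0 hq m
    have h4 := UU_eq h0 hq (m + 1)
    have h5 := VV_eq h0 hq m
    have h6 := VV_eq h0 hq (m + 1)
    push_cast at *
    linear_combination -h1 + h2 + h3 - h4 - h5 + h6 - ih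

lemma fr_symm {q : ℝ} (h0 : 0 < q) (hq : q < 1 / 8) (m : ℤ) : fr q (-m) = fr q m := by
  obtain ⟨n, rfl | rfl⟩ := m.eq_nat_or_neg
  · exact (fr_nat h0 hq n).symm
  · rw [neg_neg]; exact fr_nat h0 hq n

lemma PS_ff {q : ℝ} (h0 : 0 < q) (hq : q < 1 / 8) (χ : ℤ → ℝ) (C : ℝ) (hχ : ∀ m, |χ m| ≤ C) :
    PS q (fun s => χ s.rk) = ∑' m : ℤ, χ m * fr q m := by
  have hs := summ_PS h0 hq (χ := fun s => χ s.rk) C (fun s => hχ _)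
  unfold PS
  rw [← (Equiv.sigmaFiberEquiv Pt.rk).tsum_eq]
  refine (Summable.tsum_sigma ((Equiv.sigmaFiberEquiv Pt.rk).summable_iff.2 hs)).trans ?_
  refine tsum_congr fun m => ?_
  unfold fr PS
  rw [← tsum_mul_left]
  have : ∀ s : Pt, χ m * (s.wt * q ^ s.sz * (if s.rk = m then 1 else 0)) =
      Set.indicator {s : Pt | s.rk = m} (fun s => s.wt * q ^ s.sz * χ s.rk) s := by
    intro s
    by_cases h : s.rk = m
    · rw [Set.indicator_of_mem (show s ∈ {s : Pt | s.rk = m} from h), if_pos h, h]; ring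
    · rw [Set.indicator_of_notMem (show s ∉ {s : Pt | s.rk = m} from h), if_neg h]; ring
  simp only [this]
  rw [← _root_.tsum_subtype]
  rfl

lemma PS_symm {q : ℝ} (h0 : 0 < q) (hq : q < 1 / 8) (χ : ℤ → ℝ) (C : ℝ) (hχ : ∀ m, |χ m| ≤ C) :
    PS q (fun s => χ s.rk) = PS q (fun s => χ (-s.rk)) := by
  rw [PS_ff h0 hq χ C hχ, PS_ff h0 hq (fun m => χ (-m)) C (fun m => hχ _),
    ← (Equiv.neg ℤ).tsum_eq]
  refine tsum_congr fun m => ?_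
  simp only [Equiv.neg_apply]
  rw [fr_symm h0 hq]

lemma PS_add {q : ℝ} (h0 : 0 < q) (hq : q < 1 / 8) (χ ψ : Pt → ℝ) (C : ℝ) (hχ : ∀ m, |χ m| ≤ C)
    (hψ : ∀ m, |ψ m| ≤ C) : PS q (fun s => χ s + ψ s) = PS q χ + PS q ψ := by
  unfold PS
  rw [← (summ_PS h0 hq C hχ).tsum_add (summ_PS h0 hq C hψ)]
  refine tsum_congr fun s => by ring

/-- If two statistics have the same symmetrization their weighted sums agree. -/
lemma PS_eq_of_symm {q : ℝ} (h0 : 0 < q) (hq : q < 1 / 8) (χ ψ : ℤ → ℝ) (C : ℝ) (hχ : ∀ m, |χ m| ≤ C)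
    (hψ : ∀ m, |ψ m| ≤ C) (h : ∀ m, χ m + χ (-m) = ψ m + ψ (-m)) :
    PS q (fun s => χ s.rk) = PS q (fun s => ψ s.rk) := by
  have h1 := PS_add h0 hq (fun s => χ s.rk) (fun s => χ (-s.rk)) C (fun s => hχ _) (fun s => hχ _)
  have h2 := PS_add h0 hq (fun s => ψ s.rk) (fun s => ψ (-s.rk)) C (fun s => hψ _) (fun s => hψ _)
  rw [← PS_symm h0 hq χ C hχ] at h1
  rw [← PS_symm h0 hq ψ C hψ] at h2
  have h3 : (fun s : Pt => χ s.rk + χ (-s.rk)) = fun s => ψ s.rk + ψ (-s.rk) := funext fun s => h s.rk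
  rw [h3] at h1
  linarith


/-- periodic coefficients -/
noncomputable def dp (m : ℕ) : ℝ :=
  if m % 5 = 1 then -3 else if m % 5 = 2 then 4 else if m % 5 = 3 then -4 else if m % 5 = 4 then 3 else 0

noncomputable def dq (m : ℕ) : ℝ := dp m + if m = 0 then 1 else 0

lemma dp_abs (m : ℕ) : |dp m| ≤ 4 := by unfold dp; split_ifs <;> norm_num [abs_le]
lemma dq_abs (m : ℕ) : |dq m| ≤ 5 := by
  unfold dq
  refine (abs_add_le _ _).trans ?_
  have := dp_abs m
  have h2 := ind_abs (m = 0)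
  linarith
lemma dp_add (m : ℕ) : dp (m + 5) = dp m := by unfold dp; simp [Nat.add_mod_right]

noncomputable def c5 (r : ℤ) : ℝ := (if r % 5 = 0 then 1 else 0) - (if r % 5 = 1 then 1 else 0)
noncomputable def gam (r : ℤ) : ℝ :=
  if r < 0 then 0 else if r = 0 then 1 else if r % 5 = 0 then 2 else if r % 5 = 1 ∨ r % 5 = 4 then -1 else 0

lemma c5_abs (r : ℤ) : |c5 r| ≤ 2 := by unfold c5; split_ifs <;> norm_num
lemma gam_abs (r : ℤ) : |gam r| ≤ 2 := by unfold gam; split_ifs <;> norm_num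

lemma c5_symm (r : ℤ) : c5 r + c5 (-r) = gam r + gam (-r) := by
  unfold c5 gam
  split_ifs <;> first | contradiction | omega | norm_num

/-- partial sums `∑_{m<k} 2 d_m` -/
lemma dq_sum (k : ℕ) : ∑ m ∈ range (k + 1), 2 * dq m = 
    if k % 5 = 0 then 2 else if k % 5 = 1 then -4 else if k % 5 = 2 then 4 else if k % 5 = 3 then -4 else 2 := by
  induction k with
  | zero => simp [dq, dp]
  | succ k ih =>
    rw [Finset.sum_range_succ, ih]
    unfold dq dp
    split_ifs <;> first | contradiction | omega | norm_num

lemma gam_hasSum (r : ℤ) : HasSum (fun m : ℕ => dq m * om (r - m)) (gam r) := by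
  rcases lt_or_ge r 0 with h | h
  · have : (fun m : ℕ => dq m * om (r - m)) = fun _ => 0 := by
      funext m; rw [om_neg (by omega), mul_zero]
    rw [this, gam, if_pos h]; exact hasSum_zero
  · obtain ⟨k, rfl⟩ := Int.eq_ofNat_of_zero_le h
    have h1 := hasSum_sum_of_ne_finset_zero (L := SummationFilter.unconditional ℕ) (f := fun m : ℕ => dq m * om ((k : ℤ) - m)) (s := range (k + 1))
      (fun m hm => by
        rw [Finset.mem_range] at hm
        rw [om_neg (by omega), mul_zero])
    have h2 : ∑ m ∈ range (k + 1), dq m * om ((k : ℤ) - m) = gam k := by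
      rw [Finset.sum_range_succ, sub_self, om_zero,
        Finset.sum_congr rfl (g := fun m => 2 * dq m) (fun m hm => by
          rw [Finset.mem_range] at hm
          rw [om_pos (by omega)]; ring)]
      rcases Nat.eq_zero_or_pos k with rfl | hk
      · simp [dq, dp, gam]
      · obtain ⟨j, rfl⟩ : ∃ j, k = j + 1 := ⟨k - 1, by omega⟩
        rw [dq_sum]
        unfold gam dq dp
        push_cast
        split_ifs <;> first | contradiction | omega | norm_num
    rw [h2] at h1
    exact h1

lemma UU_nonneg {q : ℝ} (h0 : 0 < q) (M : ℤ) : 0 ≤ UU q M :=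
  tsum_nonneg fun s => mul_nonneg (mul_nonneg s.wt_pos.le (by positivity)) (om_nonneg _)

lemma PB_nonneg {q : ℝ} (h0 : 0 < q) : 0 ≤ PB q :=
  tsum_nonneg fun s => mul_nonneg (mul_nonneg s.wt_pos.le (by positivity)) zero_le_one

lemma summ_UUm {q : ℝ} (h0 : 0 < q) (hq : q < 1 / 8) : Summable fun m : ℕ => UU q m := by
  have hs : Summable fun m : ℕ => (if m = 0 then (1 : ℝ) else 0) + 2 * PB q * q * q ^ m :=
    (hasSum_ite_eq 0 (1 : ℝ)).summable.add ((summable_geometric_of_lt_one h0.le (by linarith)).mul_left _)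
  refine Summable.of_nonneg_of_le (fun m => UU_nonneg h0 _) (fun m => ?_) hs
  rw [UU_rec h0 hq m]
  have := UU_nonneg h0 ((m + 2 : ℕ) : ℤ)
  have h2 : 0 ≤ q ^ (m + 1) * UU q ((m + 2 : ℕ)) := by positivity
  have h3 : q ^ (m + 1) = q ^ m * q := pow_succ _ _
  rw [mul_sub, h3]
  rw [h3] at h2
  linarith

lemma PS_gam {q : ℝ} (h0 : 0 < q) (hq : q < 1 / 8) :
    PS q (fun s => gam s.rk) = ∑' m : ℕ, dq m * UU q m := by
  have hnn : ∀ x : ℕ × Pt, 0 ≤ x.2.wt * q ^ x.2.sz * om (x.2.rk - x.1) := fun x =>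
    mul_nonneg (mul_nonneg x.2.wt_pos.le (by positivity)) (om_nonneg _)
  have hs0 : Summable fun x : ℕ × Pt => x.2.wt * q ^ x.2.sz * om (x.2.rk - x.1) := by
    rw [summable_prod_of_nonneg hnn]
    exact ⟨fun m => summ_UU h0 hq m, summ_UUm h0 hq⟩
  have hs : Summable fun x : ℕ × Pt => dq x.1 * (x.2.wt * q ^ x.2.sz * om (x.2.rk - x.1)) := by
    refine Summable.of_norm_bounded (hs0.mul_left 5) fun x => ?_
    rw [Real.norm_eq_abs, abs_mul, abs_of_nonneg (hnn x)]
    exact mul_le_mul_of_nonneg_right (dq_abs _) (hnn x)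
  have h1 : ∑' m : ℕ, dq m * UU q m = ∑' m : ℕ, ∑' s : Pt, dq m * (s.wt * q ^ s.sz * om (s.rk - m)) :=
    tsum_congr fun m => tsum_mul_left.symm
  rw [h1, ← Summable.tsum_comm (f := fun (m : ℕ) (s : Pt) => dq m * (s.wt * q ^ s.sz * om (s.rk - m))) hs]
  refine tsum_congr fun s => ?_
  change s.wt * q ^ s.sz * gam s.rk = _
  rw [← (gam_hasSum s.rk).tsum_eq, ← tsum_mul_left]
  refine tsum_congr fun m => by ring

lemma dp_gen {x : ℝ} (h0 : 0 < x) (h1 : x < 1) :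
    ∑' m : ℕ, dp m * x ^ m = (-3 * x + 4 * x ^ 2 - 4 * x ^ 3 + 3 * x ^ 4) * (1 - x ^ 5)⁻¹ := by
  have hs : Summable fun m : ℕ => dp m * x ^ m := by
    refine Summable.of_norm_bounded ((summable_geometric_of_lt_one h0.le h1).mul_left 4) fun m => ?_
    rw [Real.norm_eq_abs, abs_mul, abs_of_pos (by positivity : 0 < x ^ m)]
    exact mul_le_mul_of_nonneg_right (dp_abs _) (by positivity)
  have h := hs.sum_add_tsum_nat_add 5
  have h2 : ∑' m : ℕ, dp (m + 5) * x ^ (m + 5) = x ^ 5 * ∑' m : ℕ, dp m * x ^ m := by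
    rw [← tsum_mul_left]
    refine tsum_congr fun m => ?_
    rw [dp_add]; ring
  rw [h2] at h
  have h3 : ∑ m ∈ range 5, dp m * x ^ m = -3 * x + 4 * x ^ 2 - 4 * x ^ 3 + 3 * x ^ 4 := by
    simp [Finset.sum_range_succ, dp]; ring
  rw [h3] at h
  have h5 : 1 - x ^ 5 ≠ 0 := by
    have : x ^ 5 < 1 := pow_lt_one₀ h0.le h1 (by norm_num)
    linarith
  field_simp
  linear_combination -h

lemma dS_sum {q : ℝ} (h0 : 0 < q) (h1 : q < 1) :
    ∑' m : ℕ, dp m * SS q m = ∑' r : ℕ, (-1) ^ r * q ^ ((r + 1) ^ 2) *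
      ((-3 * q ^ (r + 1) + 4 * (q ^ (r + 1)) ^ 2 - 4 * (q ^ (r + 1)) ^ 3 + 3 * (q ^ (r + 1)) ^ 4) *
        (1 - (q ^ (r + 1)) ^ 5)⁻¹) := by
  have hs : Summable fun x : ℕ × ℕ => dp x.1 * ((-1) ^ x.2 * q ^ ((x.2 + 1) ^ 2 + x.1 * (x.2 + 1))) := by
    have hg := summable_geometric_of_lt_one h0.le h1
    refine Summable.of_norm_bounded ((hg.mul_of_nonneg hg (fun _ => by positivity)
      (fun _ => by positivity)).mul_left 4) fun x => ?_
    rw [norm_mul]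
    exact mul_le_mul (dp_abs _) (SS_bd h0 h1 _ _) (norm_nonneg _) (by norm_num)
  have e : ∑' m : ℕ, dp m * SS q m = ∑' m : ℕ, ∑' r : ℕ, dp m * ((-1) ^ r * q ^ ((r + 1) ^ 2 + m * (r + 1))) :=
    tsum_congr fun m => tsum_mul_left.symm
  rw [e, ← Summable.tsum_comm (f := fun m r : ℕ => dp m * ((-1) ^ r * q ^ ((r + 1) ^ 2 + m * (r + 1)))) hs]
  refine tsum_congr fun r => ?_
  have hx1 : q ^ (r + 1) < 1 := pow_lt_one₀ h0.le h1 (by omega)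
  rw [← dp_gen (by positivity) hx1, ← tsum_mul_left]
  refine tsum_congr fun m => ?_
  rw [pow_add, mul_comm m (r + 1), pow_mul]
  ring

lemma LL_SS {q : ℝ} (h0 : 0 < q) (h1 : q < 1) : LL q = 1 + 2 * ∑' m : ℕ, dp m * SS q m := by
  rw [dS_sum h0 h1]
  unfold LL
  congr 1
  have hs := summ_LL h0 h1
  set F : ℤ → ℝ := fun n => sg n * q ^ (n ^ 2) * (6 * q ^ n - 8 * q ^ (2 * n)) * (1 - q ^ (5 * n))⁻¹ with hF
  have hsN : Summable fun n : ℕ => F (n : ℤ) := hs.comp_injective Nat.cast_injective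
  have hsM : Summable fun n : ℕ => F (-((n : ℤ) + 1)) := hs.comp_injective (i := fun n : ℕ => -((n : ℤ) + 1))
    (fun a b h => by simpa using h)
  have e := tsum_of_nat_of_neg_add_one hsN hsM
  rw [e, hsN.tsum_eq_zero_add, show F ((0 : ℕ) : ℤ) = 0 by simp [hF], zero_add,
    ← ((summable_nat_add_iff 1).2 hsN).tsum_add hsM, ← tsum_mul_left]
  refine tsum_congr fun r => ?_
  have hx1 : q ^ (r + 1) < 1 := pow_lt_one₀ h0.le h1 (by omega)
  have hx0 : 0 < q ^ (r + 1) := by positivity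
  simp only [hF]
  have z1 : q ^ (((r + 1 : ℕ) : ℤ)) = q ^ (r + 1) := zpow_natCast _ _
  have z2 : ∀ k : ℕ, q ^ ((k : ℤ) * ((r + 1 : ℕ) : ℤ)) = (q ^ (r + 1)) ^ k := by
    intro k; rw [mul_comm, zpow_mul, z1, zpow_natCast]
  have z3 : ∀ k : ℕ, q ^ ((k : ℤ) * (-((r : ℤ) + 1))) = ((q ^ (r + 1)) ^ k)⁻¹ := by
    intro k
    rw [← z2, ← zpow_neg, mul_neg]; push_cast; rfl
  have z4 : q ^ ((((r + 1 : ℕ) : ℤ)) ^ 2) = q ^ ((r + 1) ^ 2) := by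
    rw [← zpow_natCast]; push_cast; rfl
  have z5 : q ^ ((-((r : ℤ) + 1)) ^ 2) = q ^ ((r + 1) ^ 2) := by
    rw [← z4]; push_cast; rw [neg_sq]
  have z6 : sg (((r + 1 : ℕ) : ℤ)) = - (-1) ^ r := by
    push_cast; rw [sg_add, sg_one]; simp [sg]
  have z7 : sg (-((r : ℤ) + 1)) = - (-1) ^ r := by
    rw [sg_neg, sg_add, sg_one]; simp [sg]
  have a2 := z2 2
  have a5 := z2 5
  have b1 := z3 1
  have b2 := z3 2
  have b5 := z3 5
  rw [Nat.cast_one, one_mul, pow_one] at b1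
  rw [Nat.cast_ofNat] at a2 a5 b2 b5
  rw [z4, z5, z6, z7, a2, a5, b2, b5, z1, b1]
  set x := q ^ (r + 1) with hx
  have hx5 : x ^ 5 < 1 := pow_lt_one₀ hx0.le hx1 (by norm_num)
  have h5 : 1 - x ^ 5 ≠ 0 := by linarith
  have h6 : 1 - (x ^ 5)⁻¹ = -(1 - x ^ 5) * (x ^ 5)⁻¹ := by
    field_simp; ring
  rw [h6, mul_inv, inv_inv, inv_neg]
  field_simp
  ring

theorem phi_D {q : ℝ} (h0 : 0 < q) (hq : q < 1 / 8) : phi q * PS q (fun s => c5 s.rk) = LL q := by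
  have h1 : q < 1 := by linarith
  rw [PS_eq_of_symm h0 hq c5 gam 2 c5_abs gam_abs c5_symm, PS_gam h0 hq, LL_SS h0 h1, ← tsum_mul_left]
  have hP := PB_phi h0 hq
  have e : ∀ m : ℕ, phi q * (dq m * UU q m) = (if m = 0 then 1 else 0) + 2 * (dp m * SS q m) := by
    intro m
    rw [UU_eq h0 hq m]
    unfold dq
    split_ifs with hm
    · subst hm
      rw [show dp 0 = 0 by simp [dp]]
      linear_combination (2 * SS q 0) * hP + phi_SS h0 h1
    · linear_combination (2 * dp m * SS q m) * hP
  have hs : Summable fun m : ℕ => dp m * SS q m := by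
    have := (summ_UUm h0 hq)
    have h3 : Summable fun m : ℕ => dp m * UU q m := by
      refine Summable.of_norm_bounded (this.mul_left 4) fun m => ?_
      rw [Real.norm_eq_abs, abs_mul, abs_of_nonneg (UU_nonneg h0 _)]
      exact mul_le_mul_of_nonneg_right (dp_abs _) (UU_nonneg h0 _)
    have h4 := h3.mul_left (phi q / 2)
    refine h4.congr fun m => ?_
    rw [UU_eq h0 hq m]
    split_ifs with hm
    · subst hm; simp [dp]
    · linear_combination (dp m * SS q m) * hP
  rw [tsum_congr e, (hasSum_ite_eq 0 (1 : ℝ)).summable.tsum_add (hs.mul_left 2), tsum_ite_eq, tsum_mul_left]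


/-! ### Power series representing real functions near `0+` -/

abbrev PSR : Type := PowerSeries ℝ

def PRep (F : PSR) (f : ℝ → ℝ) : Prop :=
  ∃ r > 0, ∀ q : ℝ, 0 < q → q < r → HasSum (fun n => PowerSeries.coeff n F * q ^ n) (f q)

lemma PRep.congr {F : PSR} {f g : ℝ → ℝ} (hF : PRep F f) (r : ℝ) (hr : 0 < r)
    (h : ∀ q, 0 < q → q < r → g q = f q) : PRep F g := by
  obtain ⟨s, hs, H⟩ := hF
  refine ⟨min r s, lt_min hr hs, fun q h0 h1 => ?_⟩
  rw [h q h0 (h1.trans_le (min_le_left _ _))]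
  exact H q h0 (h1.trans_le (min_le_right _ _))

lemma PRep.add {F G : PSR} {f g : ℝ → ℝ} (hF : PRep F f) (hG : PRep G g) : PRep (F + G) (fun q => f q + g q) := by
  obtain ⟨r, hr, H⟩ := hF
  obtain ⟨s, hs, K⟩ := hG
  refine ⟨min r s, lt_min hr hs, fun q h0 h1 => ?_⟩
  refine ((H q h0 (h1.trans_le (min_le_left _ _))).add (K q h0 (h1.trans_le (min_le_right _ _)))).congr_fun' ?_
  intro n; rw [map_add]; ring

lemma PRep.smul {F : PSR} {f : ℝ → ℝ} (c : ℝ) (hF : PRep F f) : PRep (PowerSeries.C c * F) (fun q => c * f q) := by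
  obtain ⟨r, hr, H⟩ := hF
  refine ⟨r, hr, fun q h0 h1 => ?_⟩
  refine ((H q h0 h1).mul_left c).congr_fun' fun n => ?_
  rw [PowerSeries.coeff_C_mul]; ring

lemma PRep.sub {F G : PSR} {f g : ℝ → ℝ} (hF : PRep F f) (hG : PRep G g) : PRep (F - G) (fun q => f q - g q) := by
  obtain ⟨r, hr, H⟩ := hF
  obtain ⟨s, hs, K⟩ := hG
  refine ⟨min r s, lt_min hr hs, fun q h0 h1 => ?_⟩
  refine ((H q h0 (h1.trans_le (min_le_left _ _))).sub (K q h0 (h1.trans_le (min_le_right _ _)))).congr_fun' ?_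
  intro n; rw [map_sub]; ring

lemma PRep.mul {F G : PSR} {f g : ℝ → ℝ} (hF : PRep F f) (hG : PRep G g) : PRep (F * G) (fun q => f q * g q) := by
  obtain ⟨r, hr, H⟩ := hF
  obtain ⟨s, hs, K⟩ := hG
  refine ⟨min r s, lt_min hr hs, fun q h0 h1 => ?_⟩
  have a := H q h0 (h1.trans_le (min_le_left _ _))
  have b := K q h0 (h1.trans_le (min_le_right _ _))
  have an := a.summable.norm
  have bn := b.summable.norm
  have hs := (summable_norm_sum_mul_antidiagonal_of_summable_norm an bn).of_norm
  have := tsum_mul_tsum_eq_tsum_sum_antidiagonal_of_summable_norm an bn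
  rw [a.tsum_eq, b.tsum_eq] at this
  change HasSum _ (f q * g q)
  rw [this]
  refine hs.hasSum.congr_fun' fun n => ?_
  rw [PowerSeries.coeff_mul, Finset.sum_mul]
  refine Finset.sum_congr rfl fun x hx => ?_
  have hx' : x.1 + x.2 = n := by simpa using hx
  rw [← hx', pow_add]; ring

lemma PRep.X : PRep (PowerSeries.X) (fun q => q) := by
  refine ⟨1, one_pos, fun q _ _ => ?_⟩
  have := hasSum_single (f := fun n => PowerSeries.coeff n (PowerSeries.X : PSR) * q ^ n) 1 (fun n hn => by
    simp [PowerSeries.coeff_X, hn])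
  simpa using this

lemma PRep.one : PRep 1 (fun _ => 1) := by
  refine ⟨1, one_pos, fun q _ _ => ?_⟩
  have := hasSum_single (f := fun n => PowerSeries.coeff n (1 : PSR) * q ^ n) 0 (fun n hn => by
    simp [PowerSeries.coeff_one, hn])
  simpa using this

lemma PRep.eq_zero {F : PSR} (hF : PRep F (fun _ => 0)) : F = 0 := by
  obtain ⟨r, hr, H⟩ := hF
  ext n
  rw [map_zero]
  induction n using Nat.strong_induction_on with
  | _ n ih =>
    set a : ℕ → ℝ := fun n => PowerSeries.coeff n F with ha
    have hr2 : 0 < r / 2 := by linarith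
    have hS : Summable fun i => |a (i + (n + 1))| * (r / 2) ^ i := by
      have h1 := ((summable_nat_add_iff (n + 1)).2 (H (r / 2) hr2 (by linarith)).summable).norm
      have h2 := h1.mul_left (((r / 2) ^ (n + 1))⁻¹)
      refine h2.congr fun i => ?_
      rw [norm_mul, Real.norm_eq_abs, Real.norm_eq_abs, abs_of_pos (by positivity : 0 < (r / 2) ^ (i + (n + 1))), pow_add (r / 2) i (n + 1)]
      change _ = |PowerSeries.coeff (i + (n + 1)) F| * _
      have h3 : ((r / 2) ^ (n + 1)) ≠ 0 := by positivity
      generalize (r / 2) ^ (n + 1) = y at *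
      field_simp
    set C := ∑' i, |a (i + (n + 1))| * (r / 2) ^ i with hC
    have key : ∀ q, 0 < q → q < r / 2 → |a n| ≤ q * C := by
      intro q h0 h1
      have h := H q h0 (by linarith)
      have e := h.summable.sum_add_tsum_nat_add (n + 1)
      rw [h.tsum_eq, Finset.sum_range_succ, Finset.sum_eq_zero (fun i hi => by
        rw [ih i (Finset.mem_range.1 hi), zero_mul]), zero_add] at e
      have e2 : ∑' i, PowerSeries.coeff (i + (n + 1)) F * q ^ (i + (n + 1)) =
          q ^ n * (q * ∑' i, a (i + (n + 1)) * q ^ i) := by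
        rw [← tsum_mul_left, ← tsum_mul_left]
        refine tsum_congr fun i => ?_
        rw [pow_add, pow_succ]; simp only [ha]; ring
      rw [e2] at e
      have hqn : q ^ n ≠ 0 := by positivity
      have e3 : a n = - (q * ∑' i, a (i + (n + 1)) * q ^ i) := by
        apply mul_right_cancel₀ hqn
        linear_combination e
      rw [e3, abs_neg, abs_mul, abs_of_pos h0]
      refine mul_le_mul_of_nonneg_left ?_ h0.le
      rw [← Real.norm_eq_abs]
      refine tsum_of_norm_bounded (f := fun i => a (i + (n + 1)) * q ^ i) hS.hasSum fun i => ?_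
      rw [norm_mul, Real.norm_eq_abs, norm_pow, Real.norm_eq_abs, abs_of_pos h0]
      exact mul_le_mul_of_nonneg_left (pow_le_pow_left₀ h0.le h1.le _) (abs_nonneg _)
    have hC0 : 0 ≤ C := tsum_nonneg fun i => by positivity
    by_contra hne
    have hpos : 0 < |a n| := abs_pos.2 hne
    set t := min (r / 4) (|a n| / (2 * (C + 1))) with ht
    have ht0 : 0 < t := lt_min (by linarith) (by positivity)
    have h1 := key t ht0 (lt_of_le_of_lt (min_le_left _ _) (by linarith))
    have h2 : t ≤ |a n| / (2 * (C + 1)) := min_le_right _ _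
    have h3 : t * C ≤ |a n| / (2 * (C + 1)) * (C + 1) := by
      apply mul_le_mul h2 (by linarith) hC0 (by positivity)
    have h4 : |a n| / (2 * (C + 1)) * (C + 1) = |a n| / 2 := by field_simp
    linarith

lemma PRep.unique {F G : PSR} {f g : ℝ → ℝ} (hF : PRep F f) (hG : PRep G g) (r : ℝ) (hr : 0 < r)
    (h : ∀ q, 0 < q → q < r → f q = g q) : F = G := by
  have h1 : PRep (F - G) (fun _ => 0) := (hF.sub hG).congr r hr (fun q h0 h1 => by rw [h q h0 h1]; ring)
  exact sub_eq_zero.1 h1.eq_zero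

/-- generating series of a weighted family -/
noncomputable def fam {ι : Type*} (e : ι → ℕ) (c : ι → ℝ) : PSR :=
  PowerSeries.mk fun n => ∑' i : {i // e i = n}, c i

lemma coeff_fam {ι : Type*} (e : ι → ℕ) (c : ι → ℝ) (n : ℕ) :
    PowerSeries.coeff n (fam e c) = ∑' i : {i // e i = n}, c i := PowerSeries.coeff_mk _ _

lemma hasSum_fam {ι : Type*} (e : ι → ℕ) (c : ι → ℝ) {q : ℝ} (h0 : 0 < q)
    (hs : Summable fun i => c i * q ^ e i) :
    HasSum (fun n => PowerSeries.coeff n (fam e c) * q ^ n) (∑' i, c i * q ^ e i) := by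
  have h := (Equiv.sigmaFiberEquiv e).hasSum_iff.2 hs.hasSum
  refine (h.sigma (g := fun n => ∑' x : {i // e i = n}, c x * q ^ n) fun n => ?_).congr_fun' fun n => ?_
  · have h1 := h.summable.sigma_factor n
    have h2 := h1.hasSum
    have h3 : ∀ x : {i // e i = n}, ((fun i => c i * q ^ e i) ∘ (Equiv.sigmaFiberEquiv e)) ⟨n, x⟩ = c x * q ^ n := by
      rintro ⟨x, rfl⟩; rfl
    rw [tsum_congr h3] at h2
    exact h2
  · rw [coeff_fam, tsum_mul_right]

lemma rep_fam {ι : Type*} (e : ι → ℕ) (c : ι → ℝ) (r : ℝ) (hr : 0 < r)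
    (hs : ∀ q, 0 < q → q < r → Summable fun i => c i * q ^ e i) :
    PRep (fam e c) (fun q => ∑' i, c i * q ^ e i) :=
  ⟨r, hr, fun q h0 h1 => hasSum_fam e c h0 (hs q h0 h1)⟩

/-- 5-section. -/
noncomputable def sec5 (F : PSR) (i : ℕ) : PSR := PowerSeries.mk fun n => PowerSeries.coeff (i + 5 * n) F

lemma rep_sec5 {F : PSR} {f : ℝ → ℝ} (hF : PRep F f) (i : ℕ) :
    PRep (sec5 F i) (fun p => ∑' n, PowerSeries.coeff (i + 5 * n) F * p ^ n) := by
  obtain ⟨r, hr, H⟩ := hF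
  refine ⟨(min r 1) ^ 5, by positivity, fun p h0 h1 => ?_⟩
  obtain ⟨q, hq0, rfl⟩ : ∃ q : ℝ, 0 < q ∧ q ^ 5 = p :=
    ⟨p ^ ((5 : ℝ)⁻¹), by positivity, by
      have := Real.rpow_inv_natCast_pow h0.le (n := 5) (by norm_num)
      simpa using this⟩
  have hq1 : q < min r 1 := lt_of_pow_lt_pow_left₀ 5 (by positivity) h1
  have h := (H q hq0 (hq1.trans_le (min_le_left _ _))).summable
  have h2 : Summable fun n : ℕ => PowerSeries.coeff (i + 5 * n) F * q ^ (i + 5 * n) :=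
    h.comp_injective (i := fun n : ℕ => i + 5 * n) (fun a b h => by simp at h; exact h)
  have h3 : Summable fun n : ℕ => PowerSeries.coeff (i + 5 * n) F * (q ^ 5) ^ n := by
    refine (h2.mul_left ((q ^ i)⁻¹)).congr fun n => ?_
    rw [pow_add, pow_mul]; field_simp
  refine h3.hasSum.congr_fun' fun n => ?_
  rw [sec5, PowerSeries.coeff_mk]

lemma sec5_sum {F : PSR} {f : ℝ → ℝ} (hF : PRep F f) : ∃ r > 0, ∀ q, 0 < q → q < r →
    f q = ∑ i ∈ range 5, q ^ i * ∑' n, PowerSeries.coeff (i + 5 * n) F * (q ^ 5) ^ n := by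
  obtain ⟨r, hr, H⟩ := hF
  refine ⟨r, hr, fun q h0 h1 => ?_⟩
  have h := H q h0 h1
  rw [← h.tsum_eq, Nat.sumByResidueClasses h.summable 5]
  have e : ∀ i : ℕ, q ^ i * ∑' n, PowerSeries.coeff (i + 5 * n) F * (q ^ 5) ^ n =
      ∑' n, PowerSeries.coeff (i + 5 * n) F * q ^ (i + 5 * n) := by
    intro i; rw [← tsum_mul_left]
    refine tsum_congr fun n => ?_
    rw [pow_add, pow_mul]; ring
  rw [Finset.sum_congr rfl fun i _ => e i]
  exact (Finset.sum_range (fun i : ℕ => ∑' n, PowerSeries.coeff (i + 5 * n) F * q ^ (i + 5 * n))).symm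

lemma dis5_zero {H : ℕ → PSR} {h : ℕ → ℝ → ℝ} (hH : ∀ i < 5, PRep (H i) (h i)) (r : ℝ) (hr : 0 < r)
    (hz : ∀ q, 0 < q → q < r → ∑ i ∈ range 5, q ^ i * h i (q ^ 5) = 0) : ∀ i < 5, H i = 0 := by
  have key : PRep (PowerSeries.mk fun n => PowerSeries.coeff (n / 5) (H (n % 5))) (fun _ => 0) := by
    choose! s hs K using hH
    obtain ⟨t, ht0, htle⟩ : ∃ t > 0, ∀ i < 5, t ≤ s i := by
      refine ⟨min (s 0) (min (s 1) (min (s 2) (min (s 3) (s 4)))), ?_, fun i hi => ?_⟩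
      · simp only [gt_iff_lt, lt_min_iff]
        exact ⟨hs 0 (by norm_num), hs 1 (by norm_num), hs 2 (by norm_num), hs 3 (by norm_num), hs 4 (by norm_num)⟩
      · interval_cases i <;> simp
    refine ⟨min r (min t 1), lt_min hr (lt_min ht0 one_pos), fun q h0 h1 => ?_⟩
    have hq1 : q < 1 := h1.trans_le ((min_le_right _ _).trans (min_le_right _ _))
    have hqt : q < t := h1.trans_le ((min_le_right _ _).trans (min_le_left _ _))
    have hqr : q < r := h1.trans_le (min_le_left _ _)
    rw [← hz q h0 hqr]
    have h5 : q ^ 5 ≤ q := by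
      have := pow_le_pow_of_le_one h0.le hq1.le (show 1 ≤ 5 by norm_num); simpa using this
    have each : ∀ i ∈ range 5, HasSum (fun n => if n % 5 = i then PowerSeries.coeff (n / 5) (H i) * q ^ n else 0)
        (q ^ i * h i (q ^ 5)) := by
      intro i hi
      have hi' := Finset.mem_range.1 hi
      have h2 := (K i hi' (q ^ 5) (by positivity) (h5.trans_lt (hqt.trans_le (htle i hi')))).mul_left (q ^ i)
      have inj : Function.Injective fun n : ℕ => i + 5 * n := fun a b h => by simp at h; exact h
      refine (inj.hasSum_iff ?_).1 (h2.congr_fun' fun n => ?_)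
      · intro n hn
        rw [if_neg]
        intro hc
        exact hn ⟨n / 5, by simp only; omega⟩
      · simp only [Function.comp]
        rw [if_pos (by omega), show (i + 5 * n) / 5 = n by omega, pow_add, pow_mul]; ring
    refine (hasSum_sum each).congr_fun' fun n => ?_
    rw [Finset.sum_ite_eq, if_pos (Finset.mem_range.2 (Nat.mod_lt _ (by norm_num))), PowerSeries.coeff_mk]
  have := key.eq_zero
  intro i hi
  ext n
  have h2 := congrArg (PowerSeries.coeff (i + 5 * n)) this
  rw [PowerSeries.coeff_mk, show (i + 5 * n) / 5 = n by omega, show (i + 5 * n) % 5 = i by omega] at h2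
  rw [h2, map_zero, map_zero]


/-! ### The Appell-type sums, nonnegativity of `AA / jj 5` -/

noncomputable def GG (P : ℝ) (k : ℕ) : ℝ := ∑' n : ℕ, (-1) ^ n * P ^ (n ^ 2 + n + n * k)

lemma summ_GG {P : ℝ} (h0 : 0 < P) (h1 : P < 1) (k : ℕ) :
    Summable fun n : ℕ => (-1 : ℝ) ^ n * P ^ (n ^ 2 + n + n * k) := by
  refine Summable.of_norm_bounded (summable_geometric_of_lt_one h0.le h1) fun n => ?_
  rw [norm_mul, norm_pow, norm_neg, norm_one, one_pow, one_mul, Real.norm_eq_abs, abs_of_pos (by positivity)]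
  exact pow_le_pow_of_le_one h0.le h1.le (by nlinarith)

lemma GG_succ (P : ℝ) (k : ℕ) : P ^ (k + 1) * GG P (k + 1) = SS P k := by
  unfold GG SS
  rw [← tsum_mul_left]
  refine tsum_congr fun n => ?_
  rw [mul_left_comm, ← pow_add]
  congr 2; ring

lemma GG_zero {P : ℝ} (h0 : 0 < P) (h1 : P < 1) : GG P 0 = 1 - SS P 1 := by
  unfold GG SS
  rw [(summ_GG h0 h1 0).tsum_eq_zero_add, sub_eq_add_neg, ← tsum_neg]
  congr 1
  · simp
  · refine tsum_congr fun n => ?_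
    rw [pow_succ, mul_comm _ (-1 : ℝ), mul_assoc, neg_one_mul]
    congr 3; ring

noncomputable def gmm (k : ℕ) (s : Pt) : ℝ :=
  if k = 0 then 1 - om (s.rk - 1) / 2 else if s.1 = 0 then 0 else om (s.rk - k + 1) / 2

lemma gmm_nonneg (k : ℕ) (s : Pt) : 0 ≤ gmm k s := by
  unfold gmm
  split_ifs
  · have := om_le (s.rk - 1); linarith
  · exact le_rfl
  · have := om_nonneg (s.rk - k + 1); linarith

lemma gmm_le (k : ℕ) (s : Pt) : gmm k s ≤ 1 := by
  unfold gmm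
  split_ifs
  · have := om_nonneg (s.rk - 1); linarith
  · norm_num
  · have := om_le (s.rk - k + 1); linarith

lemma gmm_abs (k : ℕ) (s : Pt) : |gmm k s| ≤ 1 := by
  rw [abs_of_nonneg (gmm_nonneg k s)]; exact gmm_le k s

lemma Pt.sup_le_sz (s : Pt) : s.1.sup ≤ s.sz :=
  Multiset.sup_le.2 fun _ hb => Multiset.single_le_sum (fun _ _ => Nat.zero_le _) _ hb

lemma gmm_ne {k : ℕ} {s : Pt} (h : gmm k s ≠ 0) : k ≤ s.sz := by
  by_contra hk
  push Not at hk
  apply h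
  unfold gmm
  rw [if_neg (by omega)]
  split_ifs with h2
  · rfl
  · have h3 : 0 < s.1.card := Multiset.card_pos.2 h2
    have h4 := s.sup_le_sz
    rw [om_neg]; · simp
    unfold Pt.rk; omega

lemma PB_GG {P : ℝ} (h0 : 0 < P) (hP : P < 1 / 8) (k : ℕ) :
    P ^ k * (GG P k * PB P) = PS P (gmm k) := by
  rcases k with _ | k
  · have h := UU_eq h0 hP 1
    simp only [one_ne_zero, if_false, zero_add, Nat.cast_one] at h
    rw [pow_zero, one_mul, GG_zero h0 (by linarith)]
    have h2 : PS P (gmm 0) = PB P - UU P 1 / 2 := by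
      unfold PB UU PS
      rw [← tsum_div_const, ← Summable.tsum_sub (by simpa using Pt.summ_base h0 hP) ((summ_UU h0 hP 1).div_const 2)]
      refine tsum_congr fun s => ?_
      unfold gmm; rw [if_pos rfl]; ring
    rw [h2, h]; ring
  · have h := UU_eq h0 hP k
    rw [← mul_assoc, GG_succ]
    have h2 : PS P (gmm (k + 1)) = (UU P k - if k = 0 then 1 else 0) / 2 := by
      have h3 : HasSum (fun s : Pt => if s = Pt.nil then (if k = 0 then (1 : ℝ) else 0) else 0) (if k = 0 then (1 : ℝ) else 0) :=
        hasSum_ite_eq Pt.nil _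
      have h4 := ((summ_UU h0 hP k).hasSum.sub h3).div_const 2
      unfold PS
      rw [UU, PS, ← h4.tsum_eq]
      refine tsum_congr fun s => ?_
      unfold gmm; rw [if_neg (by omega)]
      by_cases hs : s = Pt.nil
      · subst hs
        rw [if_pos rfl, if_pos (show Pt.nil.1 = 0 from rfl), Pt.rk_nil, Pt.sz_nil, Pt.wt_nil]
        by_cases hk : k = 0
        · subst hk; simp [om]
        · rw [if_neg hk, om_neg (by omega)]; simp
      · rw [if_neg hs, if_neg (show ¬ s.1 = 0 from fun h => hs (Subtype.ext h))]
        push_cast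
        rw [show s.rk - ((k : ℤ) + 1) + 1 = s.rk - k by ring]; ring
    rw [h2, h]; ring

noncomputable def TT (p : ℝ) (b d : ℕ) : ℝ :=
  ∑' n : ℕ, (-1) ^ n * p ^ (5 * n ^ 2 + 5 * n + d * (5 * n + b)) * (1 - p ^ (5 * n + b))⁻¹

lemma AA_TT {p : ℝ} (h0 : 0 < p) (h1 : p < 1) (b : ℕ) (hb : 0 < b) (hb' : b < 5) :
    AA p b 5 = TT p b 0 + TT p (5 - b) 1 := by
  have hs := summ_AA h0 h1 b 5
  unfold AA
  rw [tsum_of_nat_of_neg_add_one (f := fun n : ℤ => sg n * p ^ (5 * n ^ 2 + 5 * n) * (1 - p ^ ((b : ℤ) + 5 * n))⁻¹)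
    (hs.comp_injective Nat.cast_injective)
    (hs.comp_injective (i := fun n : ℕ => -((n : ℤ) + 1)) (fun a b h => by simp at h; exact h))]
  unfold TT
  congr 1
  · refine tsum_congr fun n => ?_
    rw [show 5 * (n : ℤ) ^ 2 + 5 * n = ((5 * n ^ 2 + 5 * n + 0 * (5 * n + b) : ℕ) : ℤ) by push_cast; ring,
      show (b : ℤ) + 5 * n = ((5 * n + b : ℕ) : ℤ) by push_cast; ring, zpow_natCast, zpow_natCast]
    simp [sg]
  · refine tsum_congr fun n => ?_
    rw [inv_flip h0, show -((b : ℤ) + 5 * -((n : ℤ) + 1)) = ((5 * n + (5 - b) : ℕ) : ℤ) by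
      push_cast [Nat.cast_sub hb'.le]; ring,
      show 5 * (-((n : ℤ) + 1)) ^ 2 + 5 * -((n : ℤ) + 1) = ((5 * n ^ 2 + 5 * n : ℕ) : ℤ) by push_cast; ring,
      zpow_natCast, zpow_natCast, sg_neg, sg_add, sg_one, one_mul, pow_add p _ (5 * n + (5 - b))]
    simp only [sg, zpow_natCast]
    ring

lemma TT_GG {p : ℝ} (h0 : 0 < p) (h1 : p < 1) (b d : ℕ) (hb : 0 < b) :
    HasSum (fun k : ℕ => p ^ (b * (k + d)) * GG (p ^ 5) (k + d)) (TT p b d) := by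
  have hs : Summable fun x : ℕ × ℕ => (-1 : ℝ) ^ x.1 * p ^ (5 * x.1 ^ 2 + 5 * x.1 + (x.2 + d) * (5 * x.1 + b)) := by
    have hg := summable_geometric_of_lt_one h0.le h1
    have := summable_mul_of_summable_norm hg.norm hg.norm
    refine Summable.of_norm_bounded this fun x => ?_
    rw [norm_mul, norm_pow, norm_neg, norm_one, one_pow, one_mul, Real.norm_eq_abs, abs_of_pos (by positivity),
      ← pow_add]
    apply pow_le_pow_of_le_one h0.le h1.le
    have : x.2 * 1 ≤ (x.2 + d) * (5 * x.1 + b) := Nat.mul_le_mul (by omega) (by omega)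
    nlinarith
  have e1 : TT p b d = ∑' n : ℕ, ∑' k : ℕ, (-1 : ℝ) ^ n * p ^ (5 * n ^ 2 + 5 * n + (k + d) * (5 * n + b)) := by
    unfold TT
    refine tsum_congr fun n => ?_
    have hl : p ^ (5 * n + b) < 1 := pow_lt_one₀ h0.le h1 (by omega)
    rw [← tsum_geometric_of_lt_one (by positivity) hl, ← tsum_mul_left]
    refine tsum_congr fun k => ?_
    rw [← pow_mul, mul_assoc, ← pow_add]
    congr 2; ring
  have e2 := Summable.tsum_comm (f := fun n k : ℕ => (-1 : ℝ) ^ n * p ^ (5 * n ^ 2 + 5 * n + (k + d) * (5 * n + b))) hs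
  rw [e1, ← e2]
  have h3 := hs.prod_symm.prod.hasSum
  refine h3.congr_fun' fun k => ?_
  unfold GG
  rw [← tsum_mul_left]
  refine tsum_congr fun n => ?_
  simp only [Prod.swap]
  rw [mul_left_comm, ← pow_mul, ← pow_add]
  congr 2; ring

def eTT (b d : ℕ) (x : ℕ × Pt) : ℕ := 5 * x.2.sz - (5 - b) * (x.1 + d)
noncomputable def cTT (d : ℕ) (x : ℕ × Pt) : ℝ := x.2.wt * gmm (x.1 + d) x.2

lemma cTT_nonneg (d : ℕ) (x : ℕ × Pt) : 0 ≤ cTT d x := mul_nonneg x.2.wt_pos.le (gmm_nonneg _ _)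

lemma summ_TT {p : ℝ} (h0 : 0 < p) (h1 : p < 1 / 64) (b d : ℕ) (hb : 0 < b) (hb' : b < 5) :
    Summable fun x : ℕ × Pt => cTT d x * p ^ eTT b d x := by
  obtain ⟨r, hr0, rfl⟩ : ∃ r : ℝ, 0 < r ∧ r ^ 2 = p := ⟨√p, Real.sqrt_pos.2 h0, Real.sq_sqrt h0.le⟩
  have hr : r < 1 / 8 := by nlinarith
  have hg := summable_geometric_of_lt_one hr0.le (by linarith : r < 1)
  have := summable_mul_of_summable_norm hg.norm (Pt.summ_base hr0 hr).norm
  refine Summable.of_norm_bounded this fun x => ?_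
  rw [Real.norm_eq_abs, abs_of_nonneg (mul_nonneg (cTT_nonneg _ _) (by positivity))]
  unfold cTT
  by_cases hg : gmm (x.1 + d) x.2 = 0
  · rw [hg, mul_zero, zero_mul]; exact mul_nonneg (by positivity) (mul_nonneg x.2.wt_pos.le (by positivity))
  have hk := gmm_ne hg
  have hw := x.2.wt_pos
  calc x.2.wt * gmm (x.1 + d) x.2 * (r ^ 2) ^ eTT b d x ≤ x.2.wt * 1 * (r ^ x.1 * r ^ x.2.sz) := by
        rw [← pow_mul, ← pow_add]
        have h3 : x.1 + x.2.sz ≤ 2 * eTT b d x := by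
          unfold eTT
          have : (5 - b) * (x.1 + d) ≤ 4 * (x.1 + d) := Nat.mul_le_mul (by omega) le_rfl
          omega
        exact mul_le_mul (mul_le_mul_of_nonneg_left (gmm_le _ _) hw.le)
          (pow_le_pow_of_le_one hr0.le (by linarith) h3) (by positivity) (by positivity)
    _ = r ^ x.1 * (x.2.wt * r ^ x.2.sz) := by ring

lemma tsum_TT {p : ℝ} (h0 : 0 < p) (h1 : p < 1 / 64) (b d : ℕ) (hb : 0 < b) (hb' : b < 5) :
    ∑' x : ℕ × Pt, cTT d x * p ^ eTT b d x = TT p b d * PB (p ^ 5) := by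
  have hP : p ^ 5 < 1 / 8 := by
    have := pow_le_pow_of_le_one h0.le (by linarith : p ≤ 1) (show 1 ≤ 5 by norm_num)
    rw [pow_one] at this; linarith
  rw [(summ_TT h0 h1 b d hb hb').tsum_prod, ← (TT_GG h0 (by linarith) b d hb).tsum_eq, ← tsum_mul_right]
  refine tsum_congr fun k => ?_
  have h := PB_GG (pow_pos h0 5) hP (k + d)
  have hne : p ^ (5 * (k + d)) ≠ 0 := by positivity
  apply mul_left_cancel₀ hne
  calc p ^ (5 * (k + d)) * ∑' s : Pt, cTT d (k, s) * p ^ eTT b d (k, s)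
      = p ^ (b * (k + d)) * PS (p ^ 5) (gmm (k + d)) := by
        unfold PS
        rw [← tsum_mul_left, ← tsum_mul_left]
        refine tsum_congr fun s => ?_
        simp only [cTT, eTT]
        by_cases hg : gmm (k + d) s = 0
        · rw [hg]; ring
        have hk := gmm_ne hg
        rw [← pow_mul]
        have e : p ^ (5 * (k + d)) * p ^ (5 * s.sz - (5 - b) * (k + d)) = p ^ (b * (k + d)) * p ^ (5 * s.sz) := by
          rw [← pow_add, ← pow_add]; congr 1
          have : (5 - b) * (k + d) ≤ 5 * (k + d) := Nat.mul_le_mul (by omega) le_rfl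
          have e2 : (5 - b) * (k + d) + b * (k + d) = 5 * (k + d) := by rw [← add_mul]; congr 1; omega
          omega
        linear_combination s.wt * gmm (k + d) s * e
    _ = _ := by rw [← h, ← pow_mul]; ring

/-- The series `AA p b 5 / jj p 5`. -/
noncomputable def MM (b : ℕ) : PSR := fam (eTT b 0) (cTT 0) + fam (eTT (5 - b) 1) (cTT 1)

lemma rep_MM (b : ℕ) (hb : 0 < b) (hb' : b < 5) : PRep (MM b) (fun p => AA p b 5 * PB (p ^ 5)) := by
  have h1 := rep_fam (eTT b 0) (cTT 0) (1 / 64) (by norm_num) (fun q h0 h1 => summ_TT h0 h1 b 0 hb hb')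
  have h2 := rep_fam (eTT (5 - b) 1) (cTT 1) (1 / 64) (by norm_num)
    (fun q h0 h1 => summ_TT h0 h1 (5 - b) 1 (by omega) (by omega))
  refine (h1.add h2).congr (1 / 64) (by norm_num) fun q h0 h1 => ?_
  rw [tsum_TT h0 h1 b 0 hb hb', tsum_TT h0 h1 (5 - b) 1 (by omega) (by omega), AA_TT h0 (by linarith) b hb hb']
  ring

lemma fam_nonneg {ι : Type*} (e : ι → ℕ) (c : ι → ℝ) (hc : ∀ i, 0 ≤ c i) (n : ℕ) :
    0 ≤ PowerSeries.coeff n (fam e c) := by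
  rw [coeff_fam]; exact tsum_nonneg fun i => hc i

lemma fam_pos {ι : Type*} (e : ι → ℕ) (c : ι → ℝ) (hc : ∀ i, 0 ≤ c i) {q : ℝ} (h0 : 0 < q)
    (hs : Summable fun i => c i * q ^ e i) (i : ι) (hi : 0 < c i) :
    0 < PowerSeries.coeff (e i) (fam e c) := by
  rw [coeff_fam]
  have h1 : Summable fun j : {j // e j = e i} => c j := by
    have := (hs.subtype {j | e j = e i}).mul_right ((q ^ e i)⁻¹)
    refine this.congr fun j => ?_
    have hj : e j.1 = e i := j.2
    simp only [Function.comp]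
    rw [hj]; field_simp
  exact lt_of_lt_of_le hi (h1.le_tsum (⟨i, rfl⟩ : {j // e j = e i}) (fun j _ => hc j))

lemma MM_nonneg (b n : ℕ) : 0 ≤ PowerSeries.coeff n (MM b) := by
  rw [MM, map_add]
  exact add_nonneg (fam_nonneg _ _ (cTT_nonneg _) _) (fam_nonneg _ _ (cTT_nonneg _) _)

lemma MM_zero (b : ℕ) (hb : 0 < b) (hb' : b < 5) : 0 < PowerSeries.coeff 0 (MM b) := by
  rw [MM, map_add]
  refine add_pos_of_pos_of_nonneg ?_ (fam_nonneg _ _ (cTT_nonneg _) _)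
  have := fam_pos (eTT b 0) (cTT 0) (cTT_nonneg _) (q := 1 / 128) (by norm_num)
    (summ_TT (by norm_num) (by norm_num) b 0 hb hb') (0, Pt.nil) (by
      simp [cTT, gmm, Pt.rk_nil, Pt.wt_nil, om])
  have e0 : eTT b 0 (0, Pt.nil) = 0 := by simp [eTT, Pt.sz_nil]
  rwa [e0] at this


/-! ### Transfer to formal power series -/

lemma PRep.ne_zero {F : PSR} {f : ℝ → ℝ} (hF : PRep F f) (h : PowerSeries.coeff 0 F ≠ 0) :
    ∃ r > 0, ∀ q, 0 < q → q < r → f q ≠ 0 := by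
  obtain ⟨r, hr, H⟩ := hF
  have hr2 : 0 < r / 2 := by linarith
  have hS := (H (r / 2) hr2 (by linarith)).summable.norm
  set B := ∑' n, ‖PowerSeries.coeff n F * (r / 2) ^ n‖ with hB
  have hB0 : 0 ≤ B := tsum_nonneg fun n => norm_nonneg _
  have ha : 0 < |PowerSeries.coeff 0 F| := abs_pos.2 h
  refine ⟨min (r / 2) ((r / 2) * (|PowerSeries.coeff 0 F| / (B + 1))), by positivity, fun q h0 h1 hz => ?_⟩
  have hq1 : q < r / 2 := h1.trans_le (min_le_left _ _)
  have hq2 := h1.trans_le (min_le_right _ _)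
  have hs := H q h0 (by linarith)
  rw [hz] at hs
  have e := hs.summable.tsum_eq_zero_add
  rw [hs.tsum_eq, pow_zero, mul_one] at e
  have hb : ‖∑' n : ℕ, PowerSeries.coeff (n + 1) F * q ^ (n + 1)‖ ≤ (q / (r / 2)) * B := by
    have h3 := ((summable_nat_add_iff 1).2 hS)
    have h4 : ∑' n : ℕ, ‖PowerSeries.coeff (n + 1) F * (r / 2) ^ (n + 1)‖ ≤ B := by
      rw [hB, hS.tsum_eq_zero_add]; have := norm_nonneg (PowerSeries.coeff 0 F * (r / 2) ^ 0); linarith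
    have h5 := tsum_of_norm_bounded (f := fun n : ℕ => PowerSeries.coeff (n + 1) F * q ^ (n + 1))
      (h3.hasSum.mul_left (q / (r / 2))) (fun n => by
        rw [norm_mul, norm_mul, norm_pow, norm_pow, Real.norm_of_nonneg h0.le, Real.norm_of_nonneg hr2.le]
        have h6 : q ^ (n + 1) ≤ q / (r / 2) * (r / 2) ^ (n + 1) := by
          rw [pow_succ, pow_succ]
          have : q ^ n ≤ (r / 2) ^ n := pow_le_pow_left₀ h0.le hq1.le n
          calc q ^ n * q ≤ (r / 2) ^ n * q := mul_le_mul_of_nonneg_right this h0.le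
            _ = q / (r / 2) * ((r / 2) ^ n * (r / 2)) := by field_simp
        calc ‖PowerSeries.coeff (n + 1) F‖ * q ^ (n + 1) ≤ ‖PowerSeries.coeff (n + 1) F‖ * (q / (r / 2) * (r / 2) ^ (n + 1)) :=
              mul_le_mul_of_nonneg_left h6 (norm_nonneg _)
          _ = _ := by ring)
    refine h5.trans (mul_le_mul_of_nonneg_left h4 (by positivity))
  have h7 : |PowerSeries.coeff 0 F| ≤ (q / (r / 2)) * B := by
    rw [← Real.norm_eq_abs, show PowerSeries.coeff 0 F = -∑' n : ℕ, PowerSeries.coeff (n + 1) F * q ^ (n + 1) by linarith, norm_neg]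
    exact hb
  have h8 : q / (r / 2) < |PowerSeries.coeff 0 F| / (B + 1) := by
    rw [div_lt_iff₀ hr2]; linarith
  have h9 : (q / (r / 2)) * (B + 1) < |PowerSeries.coeff 0 F| := by
    rwa [lt_div_iff₀ (by linarith)] at h8
  have h10 : 0 < q / (r / 2) := by positivity
  nlinarith

def eJ (a : ℤ) (n : ℤ) : ℕ := (5 * n ^ 2 - 5 * n + a * n).toNat

lemma eJ_cast {a : ℤ} (h0 : 0 ≤ a) (h1 : a ≤ 10) (n : ℤ) : (eJ a n : ℤ) = 5 * n ^ 2 - 5 * n + a * n := by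
  unfold eJ
  rw [Int.toNat_of_nonneg]
  rcases lt_or_ge n 0 with h | h
  · nlinarith
  · rcases h.eq_or_lt with h | h
    · subst h; norm_num
    · nlinarith

noncomputable def JS (a : ℤ) : PSR := fam (eJ a) sg

lemma rep_JS {a : ℤ} (h0 : 0 ≤ a) (h1 : a ≤ 10) : PRep (JS a) (fun p => jj p a) := by
  have key : ∀ q : ℝ, ∀ n : ℤ, sg n * q ^ eJ a n = sg n * q ^ (5 * n ^ 2 - 5 * n + a * n) := fun q n => by
    rw [← eJ_cast h0 h1, zpow_natCast]
  refine (rep_fam (eJ a) sg 1 one_pos (fun q hq0 hq1 => (summ_jj hq0 hq1 a).congr fun n => (key q n).symm)).congr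
    1 one_pos fun q _ _ => ?_
  unfold jj
  exact tsum_congr fun n => (key q n).symm

lemma JS_zero {a : ℤ} (h0 : 0 < a) (h1 : a < 10) : PowerSeries.coeff 0 (JS a) = 1 := by
  rw [JS, coeff_fam]
  have hu : ∀ n : ℤ, eJ a n = 0 ↔ n = 0 := by
    intro n
    have h := eJ_cast h0.le h1.le n
    constructor
    · intro h2
      rw [h2] at h
      by_contra hn
      rcases lt_or_gt_of_ne hn with h3 | h3
      · push_cast at h; nlinarith
      · push_cast at h; nlinarith
    · rintro rfl; simp [eJ]
  haveI : Unique {n : ℤ // eJ a n = 0} :=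
    ⟨⟨⟨0, (hu 0).2 rfl⟩⟩, fun x => Subtype.ext ((hu _).1 x.2)⟩
  have : ((default : {n : ℤ // eJ a n = 0}) : ℤ) = 0 := (hu _).1 (default : {n : ℤ // eJ a n = 0}).2
  rw [tsum_fintype, Fintype.sum_unique, this]; simp [sg]

lemma JS_ne {a : ℤ} (h0 : 0 < a) (h1 : a < 10) : JS a ≠ 0 := by
  intro h
  have := JS_zero h0 h1
  rw [h, map_zero] at this
  exact zero_ne_one this

lemma good_ev : ∃ r > 0, ∀ p, 0 < p → p < r → Good p := by
  have key : ∀ a : ℤ, 0 < a → a < 10 → ∃ r > 0, ∀ p, 0 < p → p < r → jj p a ≠ 0 := fun a h0 h1 =>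
    (rep_JS h0.le h1.le).ne_zero (by rw [JS_zero h0 h1]; exact one_ne_zero)
  obtain ⟨r1, p1, k1⟩ := key 1 (by norm_num) (by norm_num)
  obtain ⟨r2, p2, k2⟩ := key 2 (by norm_num) (by norm_num)
  obtain ⟨r3, p3, k3⟩ := key 3 (by norm_num) (by norm_num)
  obtain ⟨r4, p4, k4⟩ := key 4 (by norm_num) (by norm_num)
  obtain ⟨r5, p5, k5⟩ := key 5 (by norm_num) (by norm_num)
  refine ⟨min 1 (min r1 (min r2 (min r3 (min r4 r5)))), by positivity, fun p h0 h => ?_⟩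
  simp only [lt_min_iff] at h
  obtain ⟨h, h1, h2, h3, h4, h5⟩ := h
  exact ⟨h0, h, k1 p h0 h1, k2 p h0 h2, k3 p h0 h3, k4 p h0 h4, k5 p h0 h5⟩

def eD (a b : ℕ) (x : ℕ × ℕ) : ℕ := 10 * x.1 * x.2 + a * x.1 + b * x.2
noncomputable def DSs (a b : ℕ) : PSR := fam (eD a b) (fun _ => 1)

lemma rep_DSs {a b : ℕ} (ha : 0 < a) (hb : 0 < b) : PRep (DSs a b) (fun p => DS p a b) := by
  refine (rep_fam (eD a b) (fun _ => 1) 1 one_pos (fun q hq0 hq1 => (summ_DS hq0 hq1 ha hb).congr fun n => ?_)).congr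
    1 one_pos fun q _ _ => ?_
  · rw [one_mul]; rfl
  · unfold DS; exact tsum_congr fun n => by rw [one_mul]; rfl

lemma PRep.X_pow (c : ℕ) : PRep (PowerSeries.X ^ c) (fun q => q ^ c) := by
  induction c with
  | zero => simpa using PRep.one
  | succ c ih => simpa [pow_succ] using ih.mul PRep.X

noncomputable def KS (a b c : ℕ) : PSR := DSs a b - PowerSeries.X ^ c * DSs (10 - a) (10 - b)

lemma rep_KS {a b c : ℕ} (ha : 0 < a) (hb : 0 < b) (hc : a + b + c = 10) :
    PRep (KS a b c) (fun p => KK p 10 a b) := by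
  by_cases ha' : a < 10 ∧ b < 10
  swap
  · omega
  refine ((rep_DSs ha hb).sub ((PRep.X_pow c).mul (rep_DSs (by omega : 0 < 10 - a) (by omega : 0 < 10 - b)))).congr
    1 one_pos fun q h0 h1 => ?_
  rw [KK_eq_DS h0 h1 ha hb ha'.1 ha'.2, show (10 - a - b : ℤ) = (c : ℕ) by omega, zpow_natCast]

lemma jj5_phi (p : ℝ) : jj p 5 = phi (p ^ 5) := by
  unfold jj phi
  refine tsum_congr fun n => ?_
  rw [show 5 * n ^ 2 - 5 * n + 5 * n = ((5 : ℕ) : ℤ) * n ^ 2 by push_cast; ring, zpow_mul, zpow_natCast]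

/-- The generating series of rank differences. -/
noncomputable def DD : PSR := fam Pt.sz (fun s => s.wt * c5 s.rk)

lemma rep_DD : PRep DD (fun q => PS q (fun s => c5 s.rk)) := by
  refine (rep_fam Pt.sz (fun s => s.wt * c5 s.rk) (1 / 8) (by norm_num) (fun q h0 h1 =>
    (summ_PS h0 h1 (χ := fun s => c5 s.rk) 2 (fun _ => c5_abs _)).congr fun s => by ring)).congr 1 one_pos fun q _ _ => ?_
  unfold PS
  exact tsum_congr fun s => by ring

noncomputable def Nser (i : ℕ) : PSR := match i with
  | 0 => JS 3 * JS 5 * (KS 1 8 1 - PowerSeries.C 3 * (PowerSeries.X * KS 3 6 1))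
  | 1 => PowerSeries.C 2 * (KS 2 2 6 * (JS 1 * JS 5)) + PowerSeries.C 6 * (PowerSeries.X * (JS 1 * JS 3 * JS 5 * MM 2))
  | 2 => PowerSeries.C (-2) * (KS 1 4 5 * (JS 1 * JS 3))
  | 3 => PowerSeries.C 4 * (KS 2 7 1 * (JS 3 * JS 5))
  | _ => PowerSeries.C 8 * (JS 3 * JS 3 * KS 2 7 1) -
      PowerSeries.C 2 * (JS 1 * JS 3 * (KS 1 8 1 - PowerSeries.C 3 * (PowerSeries.X * KS 3 6 1))) -
      PowerSeries.C 8 * (JS 1 * JS 3 * JS 5 * MM 1)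

noncomputable def Nfun (i : ℕ) (p : ℝ) : ℝ := match i with
  | 0 => jj p 3 * jj p 5 * (KK p 10 1 8 - 3 * (p * KK p 10 3 6))
  | 1 => 2 * (KK p 10 2 2 * (jj p 1 * jj p 5)) + 6 * (p * (jj p 1 * jj p 3 * jj p 5 * (AA p 2 5 * PB (p ^ 5))))
  | 2 => (-2) * (KK p 10 1 4 * (jj p 1 * jj p 3))
  | 3 => 4 * (KK p 10 2 7 * (jj p 3 * jj p 5))
  | _ => 8 * (jj p 3 * jj p 3 * KK p 10 2 7) -
      2 * (jj p 1 * jj p 3 * (KK p 10 1 8 - 3 * (p * KK p 10 3 6))) -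
      8 * (jj p 1 * jj p 3 * jj p 5 * (AA p 1 5 * PB (p ^ 5)))

lemma rep_N (i : ℕ) : PRep (Nser i) (Nfun i) := by
  have j1 := rep_JS (a := 1) (by norm_num) (by norm_num)
  have j3 := rep_JS (a := 3) (by norm_num) (by norm_num)
  have j5 := rep_JS (a := 5) (by norm_num) (by norm_num)
  have k18 := rep_KS (a := 1) (b := 8) (c := 1) (by norm_num) (by norm_num) (by norm_num)
  have k36 := rep_KS (a := 3) (b := 6) (c := 1) (by norm_num) (by norm_num) (by norm_num)
  have k22 := rep_KS (a := 2) (b := 2) (c := 6) (by norm_num) (by norm_num) (by norm_num)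
  have k14 := rep_KS (a := 1) (b := 4) (c := 5) (by norm_num) (by norm_num) (by norm_num)
  have k27 := rep_KS (a := 2) (b := 7) (c := 1) (by norm_num) (by norm_num) (by norm_num)
  have m1 := rep_MM 1 (by norm_num) (by norm_num)
  have m2 := rep_MM 2 (by norm_num) (by norm_num)
  match i with
  | 0 => exact (j3.mul j5).mul (k18.sub ((PRep.X.mul k36).smul 3))
  | 1 => exact ((k22.mul (j1.mul j5)).smul 2).add ((PRep.X.mul (((j1.mul j3).mul j5).mul m2)).smul 6)
  | 2 => exact (k14.mul (j1.mul j3)).smul (-2)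
  | 3 => exact (k27.mul (j3.mul j5)).smul 4
  | (n + 4) =>
    exact ((((j3.mul j3).mul k27).smul 8).sub (((j1.mul j3).mul (k18.sub ((PRep.X.mul k36).smul 3))).smul 2)).sub
      ((((j1.mul j3).mul j5).mul m1).smul 8)

lemma transfer : ∀ i < 5, JS 1 * JS 3 * JS 5 * sec5 DD i = Nser i := by
  have j1 := rep_JS (a := 1) (by norm_num) (by norm_num)
  have j3 := rep_JS (a := 3) (by norm_num) (by norm_num)
  have j5 := rep_JS (a := 5) (by norm_num) (by norm_num)
  obtain ⟨r, hr, hgood⟩ := good_ev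
  obtain ⟨s, hs, hsum⟩ := sec5_sum rep_DD
  have key := dis5_zero (H := fun i => JS 1 * JS 3 * JS 5 * sec5 DD i - Nser i)
    (h := fun i p => jj p 1 * jj p 3 * jj p 5 * (∑' n, PowerSeries.coeff (i + 5 * n) DD * p ^ n) - Nfun i p)
    (fun i _ => (((j1.mul j3).mul j5).mul (rep_sec5 rep_DD i)).sub (rep_N i))
    (min (min r s) (1 / 8)) (by positivity) (fun q h0 h1 => by
      simp only [lt_min_iff] at h1
      obtain ⟨⟨hqr, hqs⟩, hq⟩ := h1
      have h51 : q ^ 5 ≤ q := by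
        have := pow_le_pow_of_le_one h0.le (by linarith : q ≤ 1) (show 1 ≤ 5 by norm_num); simpa using this
      have g := hgood (q ^ 5) (by positivity) (by linarith)
      have e1 := main_real h0 (by linarith) g
      have e2 := phi_D h0 hq
      have e3 := PB_phi h0 hq
      have hphi : phi q ≠ 0 := right_ne_zero_of_mul_eq_one e3
      have e4 := mul_left_cancel₀ hphi (e1.trans e2.symm)
      rw [hsum q h0 hqs] at e4
      have n1 := g.j1
      have n3 := g.j3
      have n5 := g.j5
      have h55 : (q ^ 5) ^ 5 < 1 / 8 := by
        have := pow_le_pow_of_le_one (pow_pos h0 5).le (by linarith : q ^ 5 ≤ 1) (show 1 ≤ 5 by norm_num)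
        rw [pow_one] at this; linarith
      have e6 := PB_phi (pow_pos (pow_pos h0 5) 5) h55
      rw [← jj5_phi] at e6
      simp only [Finset.sum_range_succ, Finset.sum_range_zero, zero_add, pow_zero, one_mul, pow_one] at e4 ⊢
      generalize hp : q ^ 5 = p at *
      have N0 : Nfun 0 p = jj p 1 * jj p 3 * jj p 5 * dd0 p := by
        simp only [Nfun, dd0]; field_simp
      have N1 : Nfun 1 p = jj p 1 * jj p 3 * jj p 5 * dd1 p := by
        simp only [Nfun, dd1]; field_simp
        linear_combination 6 * p * jj p 3 * AA p 2 5 * e6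
      have N2 : Nfun 2 p = jj p 1 * jj p 3 * jj p 5 * dd2 p := by
        simp only [Nfun, dd2]; field_simp
      have N3 : Nfun 3 p = jj p 1 * jj p 3 * jj p 5 * dd3 p := by
        simp only [Nfun, dd3]; field_simp
      have N4 : Nfun 4 p = jj p 1 * jj p 3 * jj p 5 * dd4 p := by
        simp only [Nfun, dd4, dd3, dd0]; field_simp
        linear_combination -8 * jj p 1 * AA p 1 5 * e6
      rw [N0, N1, N2, N3, N4]
      linear_combination -(jj p 1 * jj p 3 * jj p 5) * e4)
  intro i hi
  exact sub_eq_zero.1 (key i hi)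

theorem D3_eq : JS 1 * sec5 DD 3 = PowerSeries.C 4 * KS 2 7 1 := by
  have h := transfer 3 (by norm_num)
  have h3 : JS 3 * JS 5 ≠ 0 := mul_ne_zero (JS_ne (by norm_num) (by norm_num)) (JS_ne (by norm_num) (by norm_num))
  apply mul_left_cancel₀ h3
  simp only [Nser] at h
  linear_combination h

theorem D0_eq : JS 1 * sec5 DD 0 = KS 1 8 1 - PowerSeries.C 3 * (PowerSeries.X * KS 3 6 1) := by
  have h := transfer 0 (by norm_num)
  have h3 : JS 3 * JS 5 ≠ 0 := mul_ne_zero (JS_ne (by norm_num) (by norm_num)) (JS_ne (by norm_num) (by norm_num))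
  apply mul_left_cancel₀ h3
  simp only [Nser] at h
  linear_combination h

theorem D1_eq : JS 3 * (sec5 DD 1 - PowerSeries.C 6 * (PowerSeries.X * MM 2)) = PowerSeries.C 2 * KS 2 2 6 := by
  have h := transfer 1 (by norm_num)
  have h3 : JS 1 * JS 5 ≠ 0 := mul_ne_zero (JS_ne (by norm_num) (by norm_num)) (JS_ne (by norm_num) (by norm_num))
  apply mul_left_cancel₀ h3
  simp only [Nser] at h
  linear_combination h


/-! ### Counting -/

def ovEquiv (n : ℕ) (a : ℤ) (c : ℕ) : {P : Overpartition n // P.rank ≡ a [ZMOD (c : ℤ)]} ≃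
    Σ π : {π : n.Partition // (π.parts.sup : ℤ) - (π.parts.card : ℤ) ≡ a [ZMOD (c : ℤ)]},
      {T : Finset ℕ // T ∈ π.1.parts.toFinset.powerset} where
  toFun P := ⟨⟨P.1.1.1, P.2⟩, ⟨P.1.1.2, Finset.mem_powerset.2 P.1.2⟩⟩
  invFun x := ⟨⟨(x.1.1, x.2.1), Finset.mem_powerset.1 x.2.2⟩, x.1.2⟩
  left_inv _ := rfl
  right_inv _ := rfl

open Classical in
lemma nbar_sum (a : ℤ) (n : ℕ) : (nbar a 5 n : ℝ) =
    ∑ π : n.Partition, if (π.parts.sup : ℤ) - (π.parts.card : ℤ) ≡ a [ZMOD (5 : ℕ)] then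
      (2 : ℝ) ^ π.parts.toFinset.card else 0 := by
  unfold nbar
  rw [Nat.card_congr (ovEquiv n a 5), Nat.card_eq_fintype_card, Fintype.card_sigma, ← Finset.sum_filter]
  have e := (Finset.sum_subtype (F := inferInstance) (p := fun π : n.Partition => (π.parts.sup : ℤ) - (π.parts.card : ℤ) ≡ a [ZMOD (5 : ℕ)])
      (Finset.univ.filter fun π : n.Partition => (π.parts.sup : ℤ) - (π.parts.card : ℤ) ≡ a [ZMOD (5 : ℕ)]) (by simp)
      (fun π => (2 : ℝ) ^ π.parts.toFinset.card))
  rw [e, Nat.cast_sum]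
  refine Finset.sum_congr (by ext; simp) fun π _ => ?_
  rw [Fintype.card_coe, Finset.card_powerset]; push_cast; rfl

theorem coeff_DD (n : ℕ) : PowerSeries.coeff n DD = (nbar 0 5 n : ℝ) - nbar 1 5 n := by
  classical
  rw [DD, coeff_fam, tsum_fintype, nbar_sum, nbar_sum, ← Finset.sum_sub_distrib,
    ← (Pt.fibEquiv n).sum_comp]
  refine Finset.sum_congr rfl fun s _ => ?_
  change s.1.wt * c5 s.1.rk = (if s.1.rk ≡ 0 [ZMOD (5 : ℕ)] then s.1.wt else 0) -
    (if s.1.rk ≡ 1 [ZMOD (5 : ℕ)] then s.1.wt else 0)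
  have h0 : s.1.rk ≡ 0 [ZMOD (5 : ℕ)] ↔ s.1.rk % 5 = 0 := by
    unfold Int.ModEq; norm_num
  have h1 : s.1.rk ≡ 1 [ZMOD (5 : ℕ)] ↔ s.1.rk % 5 = 1 := by
    unfold Int.ModEq; norm_num
  unfold c5
  by_cases a0 : s.1.rk % 5 = 0
  · rw [if_pos a0, if_pos (h0.2 a0), if_neg (by omega), if_neg (fun h => by have := h1.1 h; omega)]; ring
  · rw [if_neg a0, if_neg (fun h => a0 (h0.1 h))]
    by_cases a1 : s.1.rk % 5 = 1
    · rw [if_pos a1, if_pos (h1.2 a1)]; ring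
    · rw [if_neg a1, if_neg (fun h => a1 (h1.1 h))]; ring

lemma nbar_lt_of {n i m : ℕ} (hn : n = i + 5 * m) (h : 0 < PowerSeries.coeff m (sec5 DD i)) :
    nbar 1 5 n < nbar 0 5 n := by
  rw [sec5, PowerSeries.coeff_mk, ← hn, coeff_DD] at h
  have : (nbar 1 5 n : ℝ) < nbar 0 5 n := by linarith
  exact_mod_cast this


/-! ### Finite form of the Jacobi triple product -/

section gbs
variable {R : Type*} [CommRing R]

def gb (Q : R) : ℕ → ℕ → R
  | _, 0 => 1
  | 0, _ + 1 => 0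
  | M + 1, j + 1 => gb Q M (j + 1) + Q ^ (M - j) * gb Q M j

lemma gb_zero (Q : R) (M : ℕ) : gb Q M 0 = 1 := by cases M <;> rfl

lemma gb_gt (Q : R) : ∀ M j : ℕ, M < j → gb Q M j = 0
  | 0, 0, h => by omega
  | 0, j + 1, _ => rfl
  | M + 1, 0, h => by omega
  | M + 1, j + 1, h => by
    rw [gb, gb_gt Q M (j + 1) (by omega), gb_gt Q M j (by omega)]; ring

lemma qbinom (Q x y : R) (M : ℕ) : ∏ k ∈ range M, (y - x * Q ^ k) =
    ∑ j ∈ range (M + 1), (-1) ^ j * gb Q M j * Q ^ (j.choose 2) * x ^ j * y ^ (M - j) := by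
  induction M with
  | zero => simp [gb_zero]
  | succ M ih =>
    rw [Finset.prod_range_succ, ih]
    rw [Finset.sum_range_succ' _ (M + 1)]
    have e1 : ∀ j ∈ range (M + 1), (-1) ^ (j + 1) * gb Q (M + 1) (j + 1) * Q ^ ((j + 1).choose 2) * x ^ (j + 1) *
        y ^ (M + 1 - (j + 1)) = (-1) ^ (j + 1) * gb Q M (j + 1) * Q ^ ((j + 1).choose 2) * x ^ (j + 1) * y ^ (M - j)
        - x * Q ^ M * ((-1) ^ j * gb Q M j * Q ^ (j.choose 2) * x ^ j * y ^ (M - j)) := by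
      intro j hj
      have hj' : j ≤ M := by have := Finset.mem_range.1 hj; omega
      have hc : (j + 1).choose 2 = j + j.choose 2 := by
        rw [Nat.choose_succ_succ' j 1, Nat.choose_one_right]
      have hM : Q ^ M = Q ^ (M - j) * Q ^ j := by rw [← pow_add]; congr 1; omega
      rw [gb, hc, show M + 1 - (j + 1) = M - j by omega, hM]
      ring
    rw [Finset.sum_congr rfl e1, Finset.sum_sub_distrib, ← Finset.mul_sum]
    have e2 : ∑ j ∈ range (M + 1), (-1) ^ (j + 1) * gb Q M (j + 1) * Q ^ ((j + 1).choose 2) * x ^ (j + 1) * y ^ (M - j)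
        + (-1) ^ 0 * gb Q (M + 1) 0 * Q ^ (Nat.choose 0 2) * x ^ 0 * y ^ (M + 1 - 0) =
        y * ∑ j ∈ range (M + 1), (-1) ^ j * gb Q M j * Q ^ (j.choose 2) * x ^ j * y ^ (M - j) := by
      rw [Finset.sum_range_succ, gb_gt Q M (M + 1) (by omega), Finset.sum_range_succ' _ M, mul_add, Finset.mul_sum]
      rw [gb_zero, gb_zero]
      simp only [mul_zero, zero_mul, add_zero, pow_zero, one_mul, Nat.sub_zero, mul_one, Nat.choose_zero_succ]
      congr 1
      · refine Finset.sum_congr rfl fun j hj => ?_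
        have hj' := Finset.mem_range.1 hj
        rw [show M - j = M - (j + 1) + 1 by omega, pow_succ]; ring
      · rw [pow_succ]; ring
    linear_combination -e2

lemma gb_prod (Q : R) (M j : ℕ) : gb Q M j * ∏ i ∈ range j, (1 - Q ^ (i + 1)) = ∏ i ∈ range j, (1 - Q ^ (M - i)) := by
  induction M generalizing j with
  | zero =>
    cases j with
    | zero => simp [gb_zero]
    | succ j =>
      rw [gb_gt Q 0 (j + 1) (by omega), zero_mul, Finset.prod_eq_zero (Finset.mem_range.2 (Nat.succ_pos j))]
      simp
  | succ M ih =>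
    cases j with
    | zero => simp [gb_zero]
    | succ j =>
      rw [gb, add_mul, ih (j + 1), Finset.prod_range_succ (fun i => 1 - Q ^ (i + 1)), Finset.prod_range_succ' (fun i => 1 - Q ^ (M + 1 - i)),
        Finset.prod_range_succ]
      have e : ∏ k ∈ range j, (1 - Q ^ (M + 1 - (k + 1))) = ∏ k ∈ range j, (1 - Q ^ (M - k)) :=
        Finset.prod_congr rfl fun k _ => by rw [Nat.add_sub_add_right]
      rw [e, Nat.sub_zero, ← ih j]
      by_cases hj : j ≤ M
      · have hM : Q ^ (M + 1) = Q ^ (M - j) * Q ^ (j + 1) := by rw [← pow_add]; congr 1; omega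
        rw [hM]; ring
      · rw [gb_gt Q M j (by omega)]; ring

lemma dvd_prod_one_sub (Y : R) {s : Finset ℕ} {f : ℕ → R} (h : ∀ i ∈ s, Y ∣ f i) : Y ∣ ∏ i ∈ s, (1 - f i) - 1 := by
  classical
  induction s using Finset.induction_on with
  | empty => simp
  | insert a s ha ih =>
    rw [Finset.prod_insert ha]
    have h1 := ih fun i hi => h i (Finset.mem_insert_of_mem hi)
    have h2 := h a (Finset.mem_insert_self _ _)
    have := (h1.mul_left (1 - f a)).sub h2
    refine this.trans (dvd_of_eq (by ring))

lemma gb_cong (Q : R) (N j : ℕ) (hj : j ≤ 2 * N) :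
    Q ^ (min j (2 * N - j) + 1) ∣ gb Q (2 * N) j * ∏ i ∈ range N, (1 - Q ^ (i + 1)) - 1 := by
  have hv := gb_prod Q (2 * N) j
  have hv1 : Q ^ (2 * N - j + 1) ∣ ∏ i ∈ range j, (1 - Q ^ (2 * N - i)) - 1 :=
    dvd_prod_one_sub _ fun i hi => pow_dvd_pow _ (by have := Finset.mem_range.1 hi; omega)
  rw [← hv] at hv1
  rcases le_total N j with h | h
  · have hu := Finset.prod_range_mul_prod_Ico (fun i => 1 - Q ^ (i + 1)) h
    have hu1 : Q ^ (N + 1) ∣ ∏ i ∈ Ico N j, (1 - Q ^ (i + 1)) - 1 :=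
      dvd_prod_one_sub _ fun i hi => pow_dvd_pow _ (by have := (Finset.mem_Ico.1 hi).1; omega)
    rw [← hu] at hv1
    have a1 := (pow_dvd_pow Q (show min j (2 * N - j) + 1 ≤ 2 * N - j + 1 by omega)).trans hv1
    have a2 := (pow_dvd_pow Q (show min j (2 * N - j) + 1 ≤ N + 1 by omega)).trans hu1
    have := a1.sub (a2.mul_left (gb Q (2 * N) j * ∏ i ∈ range N, (1 - Q ^ (i + 1))))
    exact this.trans (dvd_of_eq (by ring))
  · have hu := Finset.prod_range_mul_prod_Ico (fun i => 1 - Q ^ (i + 1)) h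
    have hu1 : Q ^ (j + 1) ∣ ∏ i ∈ Ico j N, (1 - Q ^ (i + 1)) - 1 :=
      dvd_prod_one_sub _ fun i hi => pow_dvd_pow _ (by have := (Finset.mem_Ico.1 hi).1; omega)
    rw [← hu]
    have a1 := (pow_dvd_pow Q (show min j (2 * N - j) + 1 ≤ 2 * N - j + 1 by omega)).trans hv1
    have a2 := (pow_dvd_pow Q (show min j (2 * N - j) + 1 ≤ j + 1 by omega)).trans hu1
    have := (a1.mul_left (∏ i ∈ Ico j N, (1 - Q ^ (i + 1)))).add a2
    exact this.trans (dvd_of_eq (by ring))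

end gbs

/-- The finite product. -/
noncomputable def TP (a N : ℕ) : PSR :=
  ∏ i ∈ range N, ((1 - PowerSeries.X ^ (10 * i + a)) * (1 - PowerSeries.X ^ (10 * i + (10 - a))))

lemma sum_id_two (N : ℕ) : 2 * ∑ i ∈ range N, i = N * (N - 1) := by
  rw [mul_comm]; exact Finset.sum_range_id_mul_two N

lemma TP_eq (a N : ℕ) (ha : a ≤ 10) : TP a N =
    ∑ j ∈ range (2 * N + 1), (-1) ^ (j + N) * gb ((PowerSeries.X : PSR) ^ 10) (2 * N) j *
      PowerSeries.X ^ (eJ a ((j : ℤ) - N)) := by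
  set X : PSR := PowerSeries.X with hX
  have hq := qbinom (X ^ 10) (X ^ a) ((X ^ 10) ^ N) (2 * N)
  set B := a * N + 10 * (∑ i ∈ range N, i) + 10 * N * N with hB
  have hl : ∏ k ∈ range (2 * N), ((X ^ 10) ^ N - X ^ a * (X ^ 10) ^ k) = (-1) ^ N * X ^ B * TP a N := by
    rw [two_mul, Finset.prod_range_add]
    have e1 : ∏ k ∈ range N, ((X ^ 10) ^ N - X ^ a * (X ^ 10) ^ k) =
        (-1) ^ N * X ^ (a * N + 10 * ∑ i ∈ range N, i) * ∏ i ∈ range N, (1 - X ^ (10 * i + (10 - a))) := by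
      have : ∀ k ∈ range N, (X ^ 10) ^ N - X ^ a * (X ^ 10) ^ k =
          ((-1) * (X ^ a * (X ^ 10) ^ k)) * (1 - X ^ (10 * (N - 1 - k) + (10 - a))) := by
        intro k hk
        have hk' := Finset.mem_range.1 hk
        have : (X ^ 10) ^ N = X ^ a * (X ^ 10) ^ k * X ^ (10 * (N - 1 - k) + (10 - a)) := by
          rw [← pow_mul, ← pow_mul, ← pow_add, ← pow_add]; congr 1; omega
        rw [this]; ring
      rw [Finset.prod_congr rfl this, Finset.prod_mul_distrib, Finset.prod_mul_distrib, Finset.prod_mul_distrib,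
        Finset.prod_range_reflect (fun k => 1 - X ^ (10 * k + (10 - a))) N,
        show ∏ k ∈ range N, (X ^ 10) ^ k = (X ^ 10) ^ (∑ i ∈ range N, i) from Finset.prod_pow_eq_pow_sum _ _ _]
      simp only [Finset.prod_const, Finset.card_range]
      rw [pow_add, pow_mul, pow_mul]
    have e2 : ∏ k ∈ range N, ((X ^ 10) ^ N - X ^ a * (X ^ 10) ^ (N + k)) =
        X ^ (10 * N * N) * ∏ i ∈ range N, (1 - X ^ (10 * i + a)) := by
      have : ∀ k ∈ range N, (X ^ 10) ^ N - X ^ a * (X ^ 10) ^ (N + k) = (X ^ 10) ^ N * (1 - X ^ (10 * k + a)) := by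
        intro k _
        rw [pow_add, pow_add, pow_mul]; ring
      rw [Finset.prod_congr rfl this, Finset.prod_mul_distrib]
      simp only [Finset.prod_const, Finset.card_range]
      rw [← pow_mul, ← pow_mul, mul_assoc]
    rw [e1, e2, TP, Finset.prod_mul_distrib, hB, pow_add X (_ + _)]
    ring
  rw [hl] at hq
  have hne : (-1 : PSR) ^ N * X ^ B ≠ 0 :=
    mul_ne_zero (pow_ne_zero _ (by norm_num)) (pow_ne_zero _ PowerSeries.X_ne_zero)
  apply mul_left_cancel₀ hne
  rw [hq, Finset.mul_sum]
  refine Finset.sum_congr rfl fun j hj => ?_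
  have hj' : j ≤ 2 * N := by have := Finset.mem_range.1 hj; omega
  have he : 10 * j.choose 2 + a * j + 10 * N * (2 * N - j) = B + eJ a ((j : ℤ) - N) := by
    have hc : (2 * (j.choose 2) : ℤ) = j * (j - 1) := by
      have h1 : 2 * j.choose 2 = j * (j - 1) := by
        rw [Nat.choose_two_right]; exact Nat.mul_div_cancel' (Nat.even_mul_pred_self j).two_dvd
      rcases j with _ | j
      · simp
      · have : ((2 * (j + 1).choose 2 : ℕ) : ℤ) = (((j + 1) * (j + 1 - 1) : ℕ) : ℤ) := by rw [h1]
        push_cast at this ⊢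
        rw [this]; simp
    have hs : (2 * ((∑ i ∈ range N, i : ℕ) : ℤ)) = N * (N - 1) := by
      have h1 := sum_id_two N
      rcases N with _ | N
      · simp
      · have : ((2 * ∑ i ∈ range (N + 1), i : ℕ) : ℤ) = (((N + 1) * (N + 1 - 1) : ℕ) : ℤ) := by rw [h1]
        push_cast at this ⊢
        rw [this]; simp
    have hE := eJ_cast (a := a) (by positivity) (by exact_mod_cast ha) ((j : ℤ) - N)
    zify [hj']
    rw [hE, hB]
    push_cast [-Nat.cast_sum]
    linear_combination 5 * hc - 5 * hs
  have hp : X ^ (10 * j.choose 2) * X ^ (a * j) * X ^ (10 * N * (2 * N - j)) = X ^ B * X ^ (eJ a ((j : ℤ) - N)) := by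
    rw [← pow_add, ← pow_add, he, pow_add]
  have hs1 : (-1 : PSR) ^ N * (-1) ^ (j + N) = (-1) ^ j := by
    rw [← pow_add, show N + (j + N) = j + 2 * N by ring, pow_add, pow_mul]; simp
  rw [← hs1, ← pow_mul, ← pow_mul, ← pow_mul, ← pow_mul]
  linear_combination (-1 : PSR) ^ N * (-1) ^ (j + N) * gb (X ^ 10) (2 * N) j * hp


/-! ### The triple product modulo X^N -/

lemma natAbs_le_eJ {a : ℕ} (h0 : 0 < a) (h1 : a < 10) (n : ℤ) : n.natAbs ≤ eJ a n := by
  zify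
  rw [eJ_cast (by omega) (by omega)]
  rcases lt_trichotomy n 0 with h | h | h
  · rw [abs_of_neg h]
    have : (a : ℤ) * n ≥ 9 * n := by nlinarith
    nlinarith
  · subst h; simp
  · rw [abs_of_pos h]
    have : (a : ℤ) * n ≥ 1 * n := by nlinarith
    nlinarith

lemma coeff_JS {a : ℕ} (h0 : 0 < a) (h1 : a < 10) {N m : ℕ} (hm : m < N) :
    PowerSeries.coeff m (JS a) =
      ∑ j ∈ range (2 * N + 1), if eJ a ((j : ℤ) - N) = m then (-1 : ℝ) ^ (j + N) else 0 := by
  rw [JS, coeff_fam]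
  have e1 : ∑' i : {i // eJ a i = m}, sg i = ∑' i : ℤ, ({i | eJ a i = m} : Set ℤ).indicator sg i :=
    _root_.tsum_subtype ({i | eJ a i = m} : Set ℤ) sg
  rw [e1, tsum_eq_sum (s := (range (2 * N + 1)).image (fun j : ℕ => (j : ℤ) - N)),
    Finset.sum_image (by intro x _ y _ h; simp at h; exact h)]
  · refine Finset.sum_congr rfl fun j _ => ?_
    rw [Set.indicator_apply]
    simp only [Set.mem_ofPred_eq]
    congr 1
    unfold sg
    rw [zpow_sub₀ (by norm_num), pow_add, zpow_natCast, zpow_natCast, div_eq_mul_inv, ← inv_pow]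
    norm_num
  · intro b hb
    rw [Set.indicator_apply, if_neg]
    intro h
    simp only [Set.mem_ofPred_eq] at h
    have := natAbs_le_eJ h0 h1 b
    apply hb
    rw [Finset.mem_image]
    refine ⟨(b + N).toNat, by rw [Finset.mem_range]; omega, by omega⟩

lemma JTP_mod {a : ℕ} (h0 : 0 < a) (h1 : a < 10) (N : ℕ) :
    (PowerSeries.X : PSR) ^ N ∣
      TP a N * ∏ i ∈ range N, (1 - ((PowerSeries.X : PSR) ^ 10) ^ (i + 1)) - JS a := by
  set X : PSR := PowerSeries.X with hX
  set P := ∏ i ∈ range N, (1 - (X ^ 10) ^ (i + 1)) with hP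
  set T : PSR := ∑ j ∈ range (2 * N + 1), (-1) ^ (j + N) * X ^ (eJ a ((j : ℤ) - N)) with hT
  have A : X ^ N ∣ TP a N * P - T := by
    rw [TP_eq a N h1.le, hT, Finset.sum_mul, ← Finset.sum_sub_distrib]
    refine Finset.dvd_sum fun j hj => ?_
    have hj' : j ≤ 2 * N := by have := Finset.mem_range.1 hj; omega
    have hc := gb_cong (X ^ 10) N j hj'
    have e : (-1) ^ (j + N) * gb (X ^ 10) (2 * N) j * X ^ (eJ a ((j : ℤ) - N)) * P
        - (-1) ^ (j + N) * X ^ (eJ a ((j : ℤ) - N)) =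
        (-1) ^ (j + N) * (X ^ (eJ a ((j : ℤ) - N)) * (gb (X ^ 10) (2 * N) j * P - 1)) := by ring
    rw [e]
    apply Dvd.dvd.mul_left
    have h2 := mul_dvd_mul (dvd_refl (X ^ (eJ a ((j : ℤ) - N)))) hc
    refine dvd_trans ?_ h2
    rw [← pow_mul, ← pow_add]
    apply pow_dvd_pow
    have := natAbs_le_eJ h0 h1 ((j : ℤ) - N)
    omega
  have B : X ^ N ∣ T - JS a := by
    rw [PowerSeries.X_pow_dvd_iff]
    intro m hm
    rw [map_sub, coeff_JS h0 h1 hm, hT, map_sum, sub_eq_zero]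
    refine Finset.sum_congr rfl fun j _ => ?_
    have : ((-1 : PSR)) ^ (j + N) = PowerSeries.C ((-1 : ℝ) ^ (j + N)) := by simp
    rw [this, PowerSeries.coeff_C_mul, hX, PowerSeries.coeff_X_pow]
    simp only [eq_comm (a := m), mul_ite, mul_one, mul_zero]
  have := dvd_add A B
  simpa using this

/-- exponents occurring in the triple product -/
def Sset (a N : ℕ) : Finset ℕ :=
  (range (10 * N + 1)).filter fun c => c ≠ 0 ∧ (c % 10 = 0 ∨ c % 10 = a ∨ c % 10 = 10 - a)

lemma prod_Sset {a : ℕ} (h0 : 0 < a) (h1 : a < 5) (N : ℕ) :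
    ∏ c ∈ Sset a N, (1 - (PowerSeries.X : PSR) ^ c) =
      TP a N * ∏ i ∈ range N, (1 - ((PowerSeries.X : PSR) ^ 10) ^ (i + 1)) := by
  induction N with
  | zero =>
    have : Sset a 0 = ∅ := by
      ext c
      simp only [Sset, Finset.mem_filter, Finset.mem_range, Finset.notMem_empty, iff_false, mul_zero, zero_add]
      omega
    simp [this, TP]
  | succ N ih =>
    have hS : Sset a (N + 1) = insert (10 * N + 10) (insert (10 * N + a) (insert (10 * N + (10 - a)) (Sset a N))) := by
      ext c
      simp only [Sset, Finset.mem_filter, Finset.mem_range, Finset.mem_insert]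
      omega
    rw [hS, Finset.prod_insert, Finset.prod_insert, Finset.prod_insert, ih, TP, TP, Finset.prod_range_succ,
      Finset.prod_range_succ, ← pow_mul, show 10 * (N + 1) = 10 * N + 10 by ring]
    · ring
    all_goals
      simp only [Sset, Finset.mem_filter, Finset.mem_range, Finset.mem_insert]
      omega

/-- main product congruence -/
lemma dvd_prod_Sset {a : ℕ} (h0 : 0 < a) (h1 : a < 5) (N : ℕ) {D K : PSR} (h : JS a * D = K) :
    (PowerSeries.X : PSR) ^ N ∣ (∏ c ∈ Sset a N, (1 - (PowerSeries.X : PSR) ^ c)) * D - K := by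
  have := JTP_mod h0 (by omega : a < 10) N
  rw [← prod_Sset h0 h1] at this
  have h2 := this.mul_right D
  rwa [sub_mul, h] at h2

lemma isUnit_one_sub_X_pow {d : ℕ} (hd : 0 < d) : IsUnit (1 - (PowerSeries.X : PSR) ^ d) := by
  rw [PowerSeries.isUnit_iff_constantCoeff]
  simp [hd.ne']

lemma dvd_prod_erase {a : ℕ} (h0 : 0 < a) (h1 : a < 5) (N : ℕ) {D K H : PSR} (h : JS a * D = K) {d : ℕ}
    (hd : d ∈ Sset a N) (hK : K = (1 - (PowerSeries.X : PSR) ^ d) * H) :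
    (PowerSeries.X : PSR) ^ N ∣ (∏ c ∈ (Sset a N).erase d, (1 - (PowerSeries.X : PSR) ^ c)) * D - H := by
  have h2 := dvd_prod_Sset h0 h1 N h
  rw [← Finset.mul_prod_erase _ _ hd, hK, mul_assoc, ← mul_sub] at h2
  have hd0 : 0 < d := by
    rw [Sset, Finset.mem_filter] at hd; omega
  exact (isUnit_one_sub_X_pow hd0).dvd_mul_left.1 h2

lemma coeff_one_sub_mul (c n : ℕ) (D : PSR) :
    PowerSeries.coeff n ((1 - (PowerSeries.X : PSR) ^ c) * D) =
      PowerSeries.coeff n D - if c ≤ n then PowerSeries.coeff (n - c) D else 0 := by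
  rw [sub_mul, one_mul, map_sub, PowerSeries.coeff_X_pow_mul']

lemma peel_nonneg (S : Finset ℕ) (hS : ∀ c ∈ S, 0 < c) (N : ℕ) (h : ℕ → ℝ) (hh : ∀ n, 0 ≤ h n) :
    ∀ D : PSR, (∀ n < N, h n ≤ PowerSeries.coeff n ((∏ c ∈ S, (1 - (PowerSeries.X : PSR) ^ c)) * D)) →
      ∀ n < N, h n ≤ PowerSeries.coeff n D := by
  induction S using Finset.induction_on with
  | empty => intro D hD; simpa using hD
  | insert c S hc ih =>
    intro D hD
    rw [Finset.prod_insert hc] at hD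
    have h1 := ih (fun x hx => hS x (Finset.mem_insert_of_mem hx)) ((1 - (PowerSeries.X : PSR) ^ c) * D)
      (fun n hn => by have := hD n hn; rwa [mul_comm (1 - _), mul_assoc] at this)
    have hc0 := hS c (Finset.mem_insert_self _ _)
    intro n
    induction n using Nat.strong_induction_on with
    | _ n ihn =>
      intro hn
      have h2 := h1 n hn
      rw [coeff_one_sub_mul] at h2
      split_ifs at h2 with hcn
      · have h3 := ihn (n - c) (by omega) (by omega)
        have := hh (n - c)
        linarith
      · linarith

lemma coeff_eq_of_dvd_sub {N n : ℕ} (hn : n < N) {A B : PSR} (h : (PowerSeries.X : PSR) ^ N ∣ A - B) :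
    PowerSeries.coeff n A = PowerSeries.coeff n B := by
  rw [PowerSeries.X_pow_dvd_iff] at h
  have := h n hn
  rwa [map_sub, sub_eq_zero] at this


/-! ### Positive expansions of the Lambert-type series -/

/-- box -/
def bx (R : ℕ) : Finset (ℕ × ℕ) := range (R + 1) ×ˢ range (R + 1)

lemma mem_bx {R : ℕ} {x : ℕ × ℕ} : x ∈ bx R ↔ x.1 ≤ R ∧ x.2 ≤ R := by
  simp only [bx, Finset.mem_product, Finset.mem_range]; omega

lemma le_eD {a b : ℕ} (ha : 0 < a) (hb : 0 < b) (x : ℕ × ℕ) : x.1 + x.2 ≤ eD a b x := by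
  unfold eD; nlinarith [Nat.zero_le (x.1 * x.2)]

lemma coeff_DSs {a b : ℕ} (ha : 0 < a) (hb : 0 < b) {n R : ℕ} (hn : n ≤ R) :
    PowerSeries.coeff n (DSs a b) = ∑ x ∈ bx R, if eD a b x = n then (1 : ℝ) else 0 := by
  rw [DSs, coeff_fam]
  have e1 : ∑' i : {i // eD a b i = n}, (fun _ => (1 : ℝ)) i =
      ∑' i : ℕ × ℕ, ({i | eD a b i = n} : Set (ℕ × ℕ)).indicator (fun _ => (1 : ℝ)) i :=
    _root_.tsum_subtype ({i | eD a b i = n} : Set (ℕ × ℕ)) (fun _ => (1 : ℝ))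
  rw [e1, tsum_eq_sum (s := bx R)]
  · refine Finset.sum_congr rfl fun x _ => ?_
    rw [Set.indicator_apply]; rfl
  · intro x hx
    rw [Set.indicator_apply, if_neg]
    intro h
    simp only [Set.mem_ofPred_eq] at h
    have := le_eD ha hb x
    exact hx (mem_bx.2 (by omega))

/-- the positive series -/
noncomputable def Sser (a b t d : ℕ) : PSR := PowerSeries.mk fun M =>
  ∑ x ∈ bx M, ∑ i ∈ range (t * (x.1 + x.2 + 1)), if eD a b x + d * i = M then (1 : ℝ) else 0

lemma coeff_Sser {a b : ℕ} (t d : ℕ) (ha : 0 < a) (hb : 0 < b) {M R : ℕ} (h : M ≤ R) :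
    PowerSeries.coeff M (Sser a b t d) =
      ∑ x ∈ bx R, ∑ i ∈ range (t * (x.1 + x.2 + 1)), if eD a b x + d * i = M then (1 : ℝ) else 0 := by
  rw [Sser, PowerSeries.coeff_mk]
  apply Finset.sum_subset
  · intro x hx; rw [mem_bx] at hx ⊢; omega
  · intro x _ hx
    apply Finset.sum_eq_zero
    intro i _
    rw [if_neg]
    intro hh
    have := le_eD ha hb x
    have h3 := Nat.zero_le (d * i)
    exact hx (mem_bx.2 (by omega))

lemma Sser_mul {a b t d : ℕ} (ha : 0 < a) (hb : 0 < b) (h : a + b + d * t = 10) :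
    (1 - (PowerSeries.X : PSR) ^ d) * Sser a b t d = KS a b (d * t) := by
  ext n
  have hsw : ∀ f : ℕ × ℕ → ℝ, ∑ x ∈ bx n, f x.swap = ∑ x ∈ bx n, f x := by
    intro f
    refine Finset.sum_nbij' Prod.swap Prod.swap ?_ ?_ ?_ ?_ ?_ <;> simp [mem_bx] <;> tauto
  have hR : PowerSeries.coeff n (KS a b (d * t)) =
      ∑ x ∈ bx n, ((if eD a b x = n then (1 : ℝ) else 0) -
        if eD a b x + d * (t * (x.1 + x.2 + 1)) = n then 1 else 0) := by
    rw [KS, map_sub, coeff_DSs ha hb le_rfl, PowerSeries.coeff_X_pow_mul', Finset.sum_sub_distrib]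
    congr 1
    have e : ∀ x : ℕ × ℕ, eD (10 - a) (10 - b) x.swap + d * t = eD a b x + d * (t * (x.1 + x.2 + 1)) := by
      intro x
      have h1 : 10 - a = b + d * t := by omega
      have h2 : 10 - b = a + d * t := by omega
      rw [h1, h2]; unfold eD; simp only [Prod.fst_swap, Prod.snd_swap]; ring
    split_ifs with hc
    · rw [coeff_DSs (by omega) (by omega) (by omega : n - d * t ≤ n), ← hsw]
      refine Finset.sum_congr rfl fun x _ => ?_
      rw [← e x]
      congr 1
      simp only [eq_iff_iff]; omega
    · symm
      apply Finset.sum_eq_zero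
      intro x _
      rw [← e x, if_neg]; omega
  have hS : (if d ≤ n then PowerSeries.coeff (n - d) (Sser a b t d) else 0) =
      ∑ x ∈ bx n, ∑ i ∈ range (t * (x.1 + x.2 + 1)), if eD a b x + d * (i + 1) = n then (1 : ℝ) else 0 := by
    split_ifs with hc
    · rw [coeff_Sser t d ha hb (by omega : n - d ≤ n)]
      refine Finset.sum_congr rfl fun x _ => Finset.sum_congr rfl fun i _ => ?_
      congr 1
      simp only [eq_iff_iff, mul_add, mul_one]; omega
    · symm
      apply Finset.sum_eq_zero
      intro x _
      apply Finset.sum_eq_zero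
      intro i _
      rw [if_neg]; rw [mul_add]; omega
  rw [coeff_one_sub_mul, hR, hS, coeff_Sser t d ha hb le_rfl, ← Finset.sum_sub_distrib]
  refine Finset.sum_congr rfl fun x _ => ?_
  rw [← Finset.sum_sub_distrib,
    Finset.sum_range_sub' (fun i => if eD a b x + d * i = n then (1 : ℝ) else 0)]
  simp

lemma Sser_nonneg (a b t d M : ℕ) : 0 ≤ PowerSeries.coeff M (Sser a b t d) := by
  rw [Sser, PowerSeries.coeff_mk]
  refine Finset.sum_nonneg fun x _ => Finset.sum_nonneg fun i _ => ?_
  split_ifs <;> norm_num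

lemma Sser_pos {a b t d M : ℕ} (ha : 0 < a) (hb : 0 < b) (x : ℕ × ℕ) (i : ℕ) (hi : i < t * (x.1 + x.2 + 1))
    (h : eD a b x + d * i = M) : 1 ≤ PowerSeries.coeff M (Sser a b t d) := by
  have hx : x ∈ bx M := by
    have := le_eD ha hb x
    have h3 := Nat.zero_le (d * i)
    exact mem_bx.2 (by omega)
  rw [Sser, PowerSeries.coeff_mk]
  have h1 : ∀ x ∈ bx M, 0 ≤ ∑ i ∈ range (t * (x.1 + x.2 + 1)), if eD a b x + d * i = M then (1 : ℝ) else 0 :=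
    fun x _ => Finset.sum_nonneg fun i _ => by split_ifs <;> norm_num
  refine le_trans ?_ (Finset.single_le_sum h1 hx)
  refine le_trans ?_ (Finset.single_le_sum (f := fun i => if eD a b x + d * i = M then (1 : ℝ) else 0)
    (fun i _ => by split_ifs <;> norm_num) (Finset.mem_range.2 hi))
  simp [h]

theorem D3_pos {m : ℕ} (hm : m ≠ 1) : 0 < PowerSeries.coeff m (sec5 DD 3) := by
  have hd : 1 ∈ Sset 1 (m + 1) := by simp [Sset]
  have h := dvd_prod_erase (a := 1) (by norm_num) (by norm_num) (m + 1) (D := sec5 DD 3)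
    (H := PowerSeries.C 4 * Sser 2 7 1 1) D3_eq hd (by
      rw [← Sser_mul (a := 2) (b := 7) (t := 1) (d := 1) (by norm_num) (by norm_num) (by norm_num)]; ring)
  have hp := peel_nonneg _ (fun c hc => by
      simp only [Sset, Finset.mem_erase, Finset.mem_filter] at hc; omega) (m + 1)
    (fun n => PowerSeries.coeff n (PowerSeries.C 4 * Sser 2 7 1 1))
    (fun n => by rw [PowerSeries.coeff_C_mul]; have := Sser_nonneg 2 7 1 1 n; positivity) (sec5 DD 3)
    (fun n hn => (coeff_eq_of_dvd_sub hn h).ge) m (by omega)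
  refine lt_of_lt_of_le ?_ hp
  rw [PowerSeries.coeff_C_mul]
  have := Sser_pos (a := 2) (b := 7) (t := 1) (d := 1) (M := m) (by norm_num) (by norm_num) (m / 2, 0) (m % 2)
    (by dsimp only; omega) (by unfold eD; dsimp only; omega)
  linarith

theorem D1_pos (m : ℕ) : 0 < PowerSeries.coeff m (sec5 DD 1) := by
  have hd : 3 ∈ Sset 3 (m + 1) := by
    simp only [Sset, Finset.mem_filter, Finset.mem_range]; exact ⟨by omega, by norm_num, by norm_num⟩
  have h := dvd_prod_erase (a := 3) (by norm_num) (by norm_num) (m + 1)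
    (D := sec5 DD 1 - PowerSeries.C 6 * (PowerSeries.X * MM 2))
    (H := PowerSeries.C 2 * Sser 2 2 2 3) D1_eq hd (by
      rw [show KS 2 2 6 = KS 2 2 (3 * 2) from rfl,
        ← Sser_mul (a := 2) (b := 2) (t := 2) (d := 3) (by norm_num) (by norm_num) (by norm_num)]; ring)
  have hp := peel_nonneg _ (fun c hc => by
      simp only [Sset, Finset.mem_erase, Finset.mem_filter] at hc; omega) (m + 1)
    (fun n => PowerSeries.coeff n (PowerSeries.C 2 * Sser 2 2 2 3))
    (fun n => by rw [PowerSeries.coeff_C_mul]; have := Sser_nonneg 2 2 2 3 n; positivity) _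
    (fun n hn => (coeff_eq_of_dvd_sub hn h).ge) m (by omega)
  rw [map_sub, PowerSeries.coeff_C_mul, PowerSeries.coeff_C_mul] at hp
  rcases m with _ | m
  · rw [PowerSeries.coeff_zero_X_mul] at hp
    have := Sser_pos (a := 2) (b := 2) (t := 2) (d := 3) (M := 0) (by norm_num) (by norm_num) (0, 0) 0
      (by norm_num) (by norm_num [eD])
    linarith
  · rw [PowerSeries.coeff_succ_X_mul] at hp
    rcases m with _ | m
    · have := MM_zero 2 (by norm_num) (by norm_num)
      have := Sser_nonneg 2 2 2 3 (0 + 1)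
      linarith
    · have h0 := MM_nonneg 2 (m + 1)
      have : 1 ≤ PowerSeries.coeff (m + 1 + 1) (Sser 2 2 2 3) := by
        rcases Nat.even_or_odd' m with ⟨k, hk | hk⟩
        · exact Sser_pos (by norm_num) (by norm_num) (k + 1, 0) 0 (by dsimp only; omega)
            (by unfold eD; dsimp only; omega)
        · exact Sser_pos (by norm_num) (by norm_num) (k, 0) 1 (by dsimp only; omega)
            (by unfold eD; dsimp only; omega)
      linarith


/-! ### Counting for the residue class 0 -/

/-- number of `(m, n)` with `10mn + am + bn ≤ M ≤ 10mn + (a+1)m + (b+1)n` -/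
def cnt (a b M : ℕ) : ℕ := ∑ m ∈ range (M / a + 1), ∑ n ∈ range (M / b + 1),
  if 10 * m * n + a * m + b * n ≤ M ∧ M ≤ 10 * m * n + a * m + b * n + (m + n) then 1 else 0

def cset (a b M : ℕ) : Finset (ℕ × ℕ) :=
  (range (M / a + 1) ×ˢ range (M / b + 1)).filter fun x => eD a b x ≤ M ∧ M ≤ eD a b x + (x.1 + x.2)

lemma mem_cset {a b M : ℕ} {x : ℕ × ℕ} : x ∈ cset a b M ↔ (x.1 < M / a + 1 ∧ x.2 < M / b + 1) ∧
    10 * x.1 * x.2 + a * x.1 + b * x.2 ≤ M ∧ M ≤ 10 * x.1 * x.2 + a * x.1 + b * x.2 + (x.1 + x.2) := by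
  rw [cset, Finset.mem_filter, Finset.mem_product, Finset.mem_range, Finset.mem_range]; rfl

lemma cnt_eq (a b M : ℕ) : cnt a b M = (cset a b M).card := by
  rw [cset, Finset.card_filter, Finset.sum_product]; rfl

lemma coeff_S1 {a b : ℕ} (ha : 0 < a) (hb : 0 < b) (M : ℕ) :
    PowerSeries.coeff M (Sser a b 1 1) = cnt a b M := by
  have h1 : ∀ x : ℕ × ℕ, (∑ i ∈ range (1 * (x.1 + x.2 + 1)), if eD a b x + 1 * i = M then (1 : ℝ) else 0) =
      if eD a b x ≤ M ∧ M ≤ eD a b x + (x.1 + x.2) then 1 else 0 := by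
    intro x
    split_ifs with h
    · rw [Finset.sum_eq_single (M - eD a b x)]
      · rw [if_pos]; omega
      · intro i _ hi; rw [if_neg]; omega
      · intro hh; exfalso; apply hh; rw [Finset.mem_range]; omega
    · apply Finset.sum_eq_zero
      intro i hi
      rw [Finset.mem_range] at hi
      rw [if_neg]; omega
  rw [Sser, PowerSeries.coeff_mk, Finset.sum_congr rfl (fun x _ => h1 x), cnt_eq, Finset.sum_boole]
  congr 2
  ext x
  simp only [cset, Finset.mem_filter, mem_bx, Finset.mem_product, Finset.mem_range]
  constructor
  · rintro ⟨_, h2, h3⟩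
    refine ⟨⟨?_, ?_⟩, h2, h3⟩
    · rw [Nat.lt_succ_iff, Nat.le_div_iff_mul_le ha]
      unfold eD at h2; nlinarith [Nat.zero_le (x.1 * x.2), Nat.zero_le (b * x.2)]
    · rw [Nat.lt_succ_iff, Nat.le_div_iff_mul_le hb]
      unfold eD at h2; nlinarith [Nat.zero_le (x.1 * x.2), Nat.zero_le (a * x.1)]
  · rintro ⟨_, h2, h3⟩
    have := le_eD ha hb x
    exact ⟨by omega, h2, h3⟩

lemma cnt18_ge (M : ℕ) : M / 2 + 1 ≤ cnt 1 8 M := by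
  rw [cnt_eq]
  have : ((Finset.Icc (M - M / 2) M).map ⟨fun m => (m, 0), fun x y h => by simpa using h⟩) ⊆ cset 1 8 M := by
    intro x hx
    rw [Finset.mem_map] at hx
    obtain ⟨m, hm, rfl⟩ := hx
    rw [Finset.mem_Icc] at hm
    change (m, 0) ∈ cset 1 8 M
    rw [mem_cset]
    simp only [mul_zero, zero_add, add_zero, one_mul, Nat.div_one]
    omega
  have h2 := Finset.card_le_card this
  rw [Finset.card_map, Nat.card_Icc] at h2
  omega

lemma card_le_diam (A : Finset ℕ) (w v : ℕ) (hw : 0 < w) (h : ∀ x ∈ A, ∀ y ∈ A, x ≤ y → (y - x) * w ≤ v) :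
    A.card ≤ v / w + 1 := by
  rcases A.eq_empty_or_nonempty with rfl | hA
  · simp
  · have hs : A ⊆ Finset.Icc (A.min' hA) (A.min' hA + v / w) := by
      intro y hy
      have h1 := A.min'_le y hy
      have h2 := h _ (A.min'_mem hA) y hy h1
      rw [← Nat.le_div_iff_mul_le hw] at h2
      rw [Finset.mem_Icc]; omega
    have := Finset.card_le_card hs
    rw [Nat.card_Icc] at this
    generalize v / w = z at *
    omega

/-- explicit upper bound -/
def Ubd (T L : ℕ) : ℕ := ∑ n ∈ range (T + 1), ((L + 10 * n * n) / ((10 * n + 3) * (10 * n + 4)) + 1) +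
  ∑ m ∈ range (T + 1), ((L + 10 * m * m + 3 * m) / ((10 * m + 6) * (10 * m + 7)) + 1)

lemma cnt36_le (T L : ℕ) (hT : L < 10 * (T + 1) * (T + 1)) : cnt 3 6 L ≤ Ubd T L := by
  rw [cnt_eq]
  let P1 : ℕ → Finset (ℕ × ℕ) := fun n => (cset 3 6 L).filter fun x => x.2 = n
  let P2 : ℕ → Finset (ℕ × ℕ) := fun m => (cset 3 6 L).filter fun x => x.1 = m
  have hsub : cset 3 6 L ⊆ (range (T + 1)).biUnion P1 ∪ (range (T + 1)).biUnion P2 := by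
    intro x hx
    rw [Finset.mem_union, Finset.mem_biUnion, Finset.mem_biUnion]
    by_cases h1 : x.2 ≤ T
    · left; exact ⟨x.2, by rw [Finset.mem_range]; omega, by simp [P1, hx]⟩
    · right
      refine ⟨x.1, ?_, by simp [P2, hx]⟩
      by_contra h2
      rw [Finset.mem_range] at h2
      have h3 : (T + 1) * (T + 1) ≤ x.1 * x.2 := Nat.mul_le_mul (by omega) (by omega)
      rw [mem_cset] at hx
      nlinarith [hx.2.1, Nat.zero_le x.1, Nat.zero_le x.2]
  refine (Finset.card_le_card hsub).trans ((Finset.card_union_le _ _).trans ?_)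
  refine Nat.add_le_add (Finset.card_biUnion_le.trans (Finset.sum_le_sum fun n _ => ?_))
    (Finset.card_biUnion_le.trans (Finset.sum_le_sum fun m _ => ?_))
  · have hi : ((P1 n).image Prod.fst).card = (P1 n).card := by
      apply Finset.card_image_of_injOn
      intro x hx y hy hxy
      simp only [P1, Finset.coe_filter, Set.mem_ofPred_eq] at hx hy
      exact Prod.ext hxy (hx.2.trans hy.2.symm)
    rw [← hi]
    apply card_le_diam _ _ _ (by positivity)
    intro x hx y hy hxy
    rw [Finset.mem_image] at hx hy
    obtain ⟨⟨x, x2⟩, hx, rfl⟩ := hx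
    obtain ⟨⟨y, y2⟩, hy, rfl⟩ := hy
    simp only [P1, Finset.mem_filter, mem_cset] at hx hy hxy ⊢
    obtain ⟨⟨_, hx1, hx2⟩, rfl⟩ := hx
    obtain ⟨⟨_, hy1, hy2⟩, rfl⟩ := hy
    obtain ⟨d, rfl⟩ := Nat.exists_eq_add_of_le hxy
    rw [Nat.add_sub_cancel_left]
    zify at *
    have a1 : ((x : ℤ) + d) * (10 * y2 + 3) ≤ L - 6 * y2 := by linarith
    have a2 : (L : ℤ) - 7 * y2 ≤ x * (10 * y2 + 4) := by linarith
    have b1 := mul_le_mul_of_nonneg_right a1 (by positivity : (0 : ℤ) ≤ 10 * y2 + 4)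
    have b2 := mul_le_mul_of_nonneg_right a2 (by positivity : (0 : ℤ) ≤ 10 * y2 + 3)
    have b3 : (0 : ℤ) ≤ y2 := by positivity
    linarith
  · have hi : ((P2 m).image Prod.snd).card = (P2 m).card := by
      apply Finset.card_image_of_injOn
      intro x hx y hy hxy
      simp only [P2, Finset.coe_filter, Set.mem_ofPred_eq] at hx hy
      exact Prod.ext (hx.2.trans hy.2.symm) hxy
    rw [← hi]
    apply card_le_diam _ _ _ (by positivity)
    intro x hx y hy hxy
    rw [Finset.mem_image] at hx hy
    obtain ⟨⟨x2, x⟩, hx, rfl⟩ := hx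
    obtain ⟨⟨y2, y⟩, hy, rfl⟩ := hy
    simp only [P2, Finset.mem_filter, mem_cset] at hx hy hxy ⊢
    obtain ⟨⟨_, hx1, hx2⟩, rfl⟩ := hx
    obtain ⟨⟨_, hy1, hy2⟩, rfl⟩ := hy
    obtain ⟨d, rfl⟩ := Nat.exists_eq_add_of_le hxy
    rw [Nat.add_sub_cancel_left]
    zify at *
    have a1 : ((x : ℤ) + d) * (10 * y2 + 6) ≤ L - 3 * y2 := by linarith
    have a2 : (L : ℤ) - 4 * y2 ≤ x * (10 * y2 + 7) := by linarith
    have b1 := mul_le_mul_of_nonneg_right a1 (by positivity : (0 : ℤ) ≤ 10 * y2 + 7)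
    have b2 := mul_le_mul_of_nonneg_right a2 (by positivity : (0 : ℤ) ≤ 10 * y2 + 6)
    linarith

lemma sumA (T : ℕ) : ∑ n ∈ range (T + 1), (1 : ℝ) / ((10 * n + 3) * (10 * n + 4)) ≤
    1 / 12 + 1 / 85 - 1 / (100 * T + 85) := by
  induction T with
  | zero => norm_num
  | succ T ih =>
    rw [Finset.sum_range_succ]
    have h0 : (0 : ℝ) ≤ T := by positivity
    have : (1 : ℝ) / ((10 * ((T + 1 : ℕ) : ℝ) + 3) * (10 * ((T + 1 : ℕ) : ℝ) + 4)) ≤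
        1 / (100 * T + 85) - 1 / (100 * ((T + 1 : ℕ) : ℝ) + 85) := by
      push_cast
      rw [div_sub_div _ _ (by positivity) (by positivity), div_le_div_iff₀ (by positivity) (by positivity)]
      nlinarith
    linarith

lemma sumB (T : ℕ) : ∑ m ∈ range (T + 1), (1 : ℝ) / ((10 * m + 6) * (10 * m + 7)) ≤
    1 / 42 + 1 / 115 - 1 / (100 * T + 115) := by
  induction T with
  | zero => norm_num
  | succ T ih =>
    rw [Finset.sum_range_succ]
    have h0 : (0 : ℝ) ≤ T := by positivity
    have : (1 : ℝ) / ((10 * ((T + 1 : ℕ) : ℝ) + 6) * (10 * ((T + 1 : ℕ) : ℝ) + 7)) ≤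
        1 / (100 * T + 115) - 1 / (100 * ((T + 1 : ℕ) : ℝ) + 115) := by
      push_cast
      rw [div_sub_div _ _ (by positivity) (by positivity), div_le_div_iff₀ (by positivity) (by positivity)]
      nlinarith
    linarith

lemma Ubd_le (T L : ℕ) : (Ubd T L : ℝ) ≤ L * (1 / 12 + 1 / 85 + 1 / 42 + 1 / 115) + 2.2 * (T + 1) := by
  have h1 : ∀ n ∈ range (T + 1), (((L + 10 * n * n) / ((10 * n + 3) * (10 * n + 4)) + 1 : ℕ) : ℝ) ≤
      L * (1 / ((10 * n + 3) * (10 * n + 4))) + 1.1 := by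
    intro n _
    have h0 : (0 : ℝ) ≤ n := by positivity
    have := Nat.cast_div_le (α := ℝ) (m := L + 10 * n * n) (n := (10 * n + 3) * (10 * n + 4))
    push_cast at this ⊢
    have h2 : (10 * (n : ℝ) * n) / ((10 * n + 3) * (10 * n + 4)) ≤ 0.1 := by
      rw [div_le_iff₀ (by positivity)]; nlinarith
    rw [add_div] at this
    rw [mul_one_div]
    linarith
  have h2 : ∀ m ∈ range (T + 1), (((L + 10 * m * m + 3 * m) / ((10 * m + 6) * (10 * m + 7)) + 1 : ℕ) : ℝ) ≤
      L * (1 / ((10 * m + 6) * (10 * m + 7))) + 1.1 := by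
    intro n _
    have h0 : (0 : ℝ) ≤ n := by positivity
    have := Nat.cast_div_le (α := ℝ) (m := L + 10 * n * n + 3 * n) (n := (10 * n + 6) * (10 * n + 7))
    push_cast at this ⊢
    have h2 : (10 * (n : ℝ) * n + 3 * n) / ((10 * n + 6) * (10 * n + 7)) ≤ 0.1 := by
      rw [div_le_iff₀ (by positivity)]; nlinarith
    rw [add_assoc (L : ℝ), add_div] at this
    rw [mul_one_div]
    linarith
  have h3 := Finset.sum_le_sum h1
  have h4 := Finset.sum_le_sum h2
  rw [Finset.sum_add_distrib, ← Finset.mul_sum] at h3 h4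
  have hL : (0 : ℝ) ≤ L := by positivity
  have h5 := mul_le_mul_of_nonneg_left (sumA T) hL
  have h6 := mul_le_mul_of_nonneg_left (sumB T) hL
  have h7 : (0 : ℝ) ≤ L * (1 / (100 * T + 85)) := by positivity
  have h8 : (0 : ℝ) ≤ L * (1 / (100 * T + 115)) := by positivity
  simp only [Finset.sum_const, Finset.card_range, nsmul_eq_mul] at h3 h4
  rw [Ubd, Nat.cast_add, Nat.cast_sum, Nat.cast_sum]
  push_cast at h3 h4 ⊢
  linarith

lemma Ubd_large (T L : ℕ) (hT : 7 ≤ T) (hL : 10 * T * T ≤ L) : 3 * Ubd T L ≤ (L + 1) / 2 + 1 := by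
  have h := Ubd_le T L
  have hL' : (10 : ℝ) * T * T ≤ L := by exact_mod_cast hL
  have hT' : (7 : ℝ) ≤ T := by exact_mod_cast hT
  have h2 : 3 * (Ubd T L : ℝ) ≤ L / 2 + 1 := by
    norm_num at h
    nlinarith
  have h3 : 6 * Ubd T L ≤ L + 2 := by
    have : (6 : ℝ) * Ubd T L ≤ L + 2 := by linarith
    exact_mod_cast this
  omega

lemma Ubd_small : ∀ L < 490, 111 ≤ L → 3 * Ubd (Nat.sqrt (L / 10)) L ≤ (L + 1) / 2 + 1 := by
  decide +kernel

lemma cnt_small : ∀ L < 111, 13 ≤ L → 3 * cnt 3 6 L ≤ cnt 1 8 (L + 1) := by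
  decide +kernel

lemma cnt_diff (L : ℕ) (hL : 13 ≤ L) : 3 * cnt 3 6 L ≤ cnt 1 8 (L + 1) := by
  rcases lt_or_ge L 111 with h | h
  · exact cnt_small L h hL
  · have h1 := cnt18_ge (L + 1)
    have h2 := Nat.lt_succ_sqrt (L / 10)
    have h3 := Nat.sqrt_le (L / 10)
    set T := Nat.sqrt (L / 10) with hT
    have h4 : L < 10 * (T + 1) * (T + 1) := by
      rw [Nat.succ_eq_add_one] at h2
      rw [mul_assoc]; omega
    have h5 := cnt36_le T L h4
    rcases lt_or_ge L 490 with h' | h'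
    · have := Ubd_small L h' h
      rw [← hT] at this; omega
    · have h6 : 7 ≤ T := by rw [hT, Nat.le_sqrt]; omega
      have := Ubd_large T L h6 (by rw [mul_assoc]; omega)
      omega


/-! ### Residue class 0 -/

lemma peel_one {c N : ℕ} (hc : 0 < c) {A B : PSR} (a b : ℕ → ℤ)
    (hAB : ∀ n < N, PowerSeries.coeff n ((1 - (PowerSeries.X : PSR) ^ c) * B) = PowerSeries.coeff n A)
    (ha : ∀ n < N, (a n : ℝ) ≤ PowerSeries.coeff n A)
    (hab : ∀ n, b n ≤ a n + if c ≤ n then b (n - c) else 0) :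
    ∀ n < N, (b n : ℝ) ≤ PowerSeries.coeff n B := by
  intro n
  induction n using Nat.strong_induction_on with
  | _ n ih =>
    intro hn
    have h1 := hAB n hn
    rw [coeff_one_sub_mul] at h1
    have h2 := ha n hn
    have h3 := hab n
    split_ifs at h1 h3 with h
    · have h4 := ih (n - c) (by omega) (by omega)
      have h5 : (b n : ℝ) ≤ a n + b (n - c) := by exact_mod_cast h3
      linarith
    · have h5 : (b n : ℝ) ≤ a n := by simpa using (Int.cast_le (R := ℝ)).2 h3
      linarith

def l0 : List ℤ := [1, -2, 2, 2, 0, 0, 4, -2, 0, 3, 3, 3, 4, -2, 2, 2, 4, 4, 8, 2, 0, 0, 0, 6, 8, 2, 6, 6, 3, 3, 11, 5]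
def l1 : List ℤ := [1, -2, 2, 2, 0, 0, 4, -2, 0, 4, 1, 5, 6, -2, 2, 6, 2, 4, 12, 3, 5, 6, -2, 8, 14, 4, 10, 18, 6, 8, 17, 3]
def l2 : List ℤ := [1, -2, 2, 2, 0, 0, 4, -2, 0, 4, 2, 3, 8, 0, 2, 6, 6, 2, 12, 7, 7, 9, 6, 8, 16, 10, 16, 20, 18, 15, 24, 12]
def l3 : List ℤ := [1, -2, 2, 2, 0, 0, 4, -2, 0, 4, 2, 4, 6, 2, 4]

def b0 (n : ℕ) : ℤ := l0.getD n 0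
def b1 (n : ℕ) : ℤ := l1.getD n 3
def b2 (n : ℕ) : ℤ := l2.getD n 6
def b3 (n : ℕ) : ℤ := l3.getD n 5

lemma b0_ge {n : ℕ} (h : 32 ≤ n) : b0 n = 0 := List.getD_eq_default _ _ h
lemma b1_ge {n : ℕ} (h : 32 ≤ n) : b1 n = 3 := List.getD_eq_default _ _ h
lemma b2_ge {n : ℕ} (h : 32 ≤ n) : b2 n = 6 := List.getD_eq_default _ _ h
lemma b3_ge {n : ℕ} (h : 15 ≤ n) : b3 n = 5 := List.getD_eq_default _ _ h

lemma b01 (n : ℕ) : b1 n ≤ b0 n + if 9 ≤ n then b1 (n - 9) else 0 := by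
  rcases lt_or_ge n 45 with h | h
  · revert n; decide +kernel
  · rw [b1_ge (by omega), b0_ge (by omega), b1_ge (by omega), if_pos (by omega)]; norm_num

lemma b12 (n : ℕ) : b2 n ≤ b1 n + if 10 ≤ n then b2 (n - 10) else 0 := by
  rcases lt_or_ge n 45 with h | h
  · revert n; decide +kernel
  · rw [b2_ge (by omega), b1_ge (by omega), b2_ge (by omega), if_pos (by omega)]; norm_num

lemma b23 (n : ℕ) : b3 n ≤ b2 n + if 11 ≤ n then b3 (n - 11) else 0 := by
  rcases lt_or_ge n 45 with h | h
  · revert n; decide +kernel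
  · rw [b3_ge (by omega), b2_ge (by omega), b3_ge (by omega), if_pos (by omega)]; norm_num

lemma b3_nonneg : ∀ n, n ≠ 1 → n ≠ 7 → 0 ≤ b3 n := by
  intro n h1 h7
  rcases lt_or_ge n 15 with h | h
  · have key : ∀ n < 15, n ≠ 1 → n ≠ 7 → 0 ≤ b3 n := by decide +kernel
    exact key n h h1 h7
  · rw [b3_ge h]; norm_num

lemma b3_neg : ∀ n, -2 ≤ b3 n := by
  intro n
  by_cases h1 : n = 1
  · subst h1; decide +kernel
  by_cases h7 : n = 7
  · subst h7; decide +kernel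
  have := b3_nonneg n h1 h7
  omega

lemma b3_pos : ∀ n, n ≠ 1 → n ≠ 4 → n ≠ 5 → n ≠ 7 → n ≠ 8 → n < 15 → 0 < b3 n := by
  intro n h1 h4 h5 h7 h8 h
  have key : ∀ n < 15, n ∈ [1, 4, 5, 7, 8] ∨ 0 < b3 n := by decide +kernel
  rcases key n h with hh | hh
  · simp [h1, h4, h5, h7, h8] at hh
  · exact hh

lemma cntb : ∀ n < 31, b0 (n + 1) ≤ (cnt 1 8 (n + 1) : ℤ) - 3 * cnt 3 6 n := by decide +kernel

noncomputable def Ss : PSR := Sser 1 8 1 1 - PowerSeries.C 3 * (PowerSeries.X * Sser 3 6 1 1)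

lemma Ss_ge (n : ℕ) : (b0 n : ℝ) ≤ PowerSeries.coeff n Ss := by
  rw [Ss, map_sub, PowerSeries.coeff_C_mul, coeff_S1 (by norm_num) (by norm_num)]
  rcases n with _ | n
  · rw [PowerSeries.coeff_zero_X_mul]
    have h : b0 0 = 1 := by decide +kernel
    have h2 : cnt 1 8 0 = 1 := by decide +kernel
    rw [h, h2]; norm_num
  · rw [PowerSeries.coeff_succ_X_mul, coeff_S1 (by norm_num) (by norm_num)]
    have : b0 (n + 1) ≤ (cnt 1 8 (n + 1) : ℤ) - 3 * cnt 3 6 n := by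
      rcases lt_or_ge n 31 with h | h
      · exact cntb n h
      · rw [b0_ge (by omega)]
        have := cnt_diff n (by omega)
        omega
    exact_mod_cast this

lemma Ss_mul : (1 - (PowerSeries.X : PSR) ^ 1) * Ss =
    KS 1 8 1 - PowerSeries.C 3 * (PowerSeries.X * KS 3 6 1) := by
  have h1 := Sser_mul (a := 1) (b := 8) (t := 1) (d := 1) (by norm_num) (by norm_num) (by norm_num)
  have h2 := Sser_mul (a := 3) (b := 6) (t := 1) (d := 1) (by norm_num) (by norm_num) (by norm_num)
  rw [show 1 * 1 = 1 from rfl] at h1 h2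
  rw [← h1, ← h2, Ss]; ring

lemma peel_big (S : Finset ℕ) (hS : ∀ c ∈ S, 19 ≤ c) (N : ℕ) :
    ∀ D : PSR, (∀ n < N, (b3 n : ℝ) ≤ PowerSeries.coeff n ((∏ c ∈ S, (1 - (PowerSeries.X : PSR) ^ c)) * D)) →
      ∀ n < N, (n < 15 → (b3 n : ℝ) ≤ PowerSeries.coeff n D) ∧
        (15 ≤ n → (5 : ℝ) - (if n - 1 ∈ S then 2 else 0) - (if n - 7 ∈ S then 2 else 0) ≤ PowerSeries.coeff n D) := by
  induction S using Finset.induction_on with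
  | empty =>
    intro D hD n hn
    have := hD n hn
    rw [Finset.prod_empty, one_mul] at this
    refine ⟨fun _ => this, fun h => ?_⟩
    rw [b3_ge h] at this
    simpa using this
  | insert c S hc ih =>
    intro D hD
    rw [Finset.prod_insert hc] at hD
    have h1 := ih (fun x hx => hS x (Finset.mem_insert_of_mem hx)) ((1 - (PowerSeries.X : PSR) ^ c) * D)
      (fun n hn => by have := hD n hn; rwa [mul_comm (1 - _), mul_assoc] at this)
    have hc0 := hS c (Finset.mem_insert_self _ _)
    intro n
    induction n using Nat.strong_induction_on with
    | _ n ihn =>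
      intro hn
      have h2 := h1 n hn
      rw [coeff_one_sub_mul] at h2
      have m1 : n - 1 ∈ S → n - 1 ∈ insert c S := fun h => Finset.mem_insert_of_mem h
      have m7 : n - 7 ∈ S → n - 7 ∈ insert c S := fun h => Finset.mem_insert_of_mem h
      have q1 : (if n - 1 ∈ S then (2 : ℝ) else 0) ≤ if n - 1 ∈ insert c S then 2 else 0 := by
        split_ifs with u v <;> first | exact absurd (m1 u) v | norm_num
      have q7 : (if n - 7 ∈ S then (2 : ℝ) else 0) ≤ if n - 7 ∈ insert c S then 2 else 0 := by
        split_ifs with u v <;> first | exact absurd (m7 u) v | norm_num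
      by_cases hcn : c ≤ n
      · rw [if_pos hcn] at h2
        refine ⟨fun h => by omega, fun h => ?_⟩
        have h3 := h2.2 h
        have h4 := ihn (n - c) (by omega) (by omega)
        rcases lt_or_ge (n - c) 15 with h5 | h5
        · have h6 := h4.1 h5
          by_cases e1 : n - c = 1
          · have e : n - 1 = c := by omega
            have hm : (-2 : ℝ) ≤ b3 (n - c) := by exact_mod_cast b3_neg (n - c)
            rw [e] at h3 ⊢
            rw [if_neg hc] at h3
            rw [if_pos (Finset.mem_insert_self _ _)]
            linarith
          · by_cases e7 : n - c = 7
            · have e : n - 7 = c := by omega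
              have hm : (-2 : ℝ) ≤ b3 (n - c) := by exact_mod_cast b3_neg (n - c)
              rw [e] at h3 ⊢
              rw [if_neg hc] at h3
              rw [if_pos (Finset.mem_insert_self _ _)]
              linarith
            · have hm : (0 : ℝ) ≤ b3 (n - c) := by exact_mod_cast b3_nonneg (n - c) e1 e7
              linarith
        · have h6 := h4.2 h5
          have h7 : (0 : ℝ) ≤ PowerSeries.coeff (n - c) D := by
            split_ifs at h6 <;> linarith
          linarith
      · rw [if_neg hcn, sub_zero] at h2
        exact ⟨h2.1, fun h => by have := h2.2 h; linarith⟩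

theorem D0_pos {m : ℕ} (h1 : m ≠ 1) (h4 : m ≠ 4) (h5 : m ≠ 5) (h7 : m ≠ 7) (h8 : m ≠ 8) :
    0 < PowerSeries.coeff m (sec5 DD 0) := by
  have hd : 1 ∈ Sset 1 (m + 2) := by simp [Sset]
  have h := dvd_prod_erase (a := 1) (by norm_num) (by norm_num) (m + 2) (D := sec5 DD 0) D0_eq hd Ss_mul.symm
  set R := (Sset 1 (m + 2)).filter fun c => 19 ≤ c with hR
  have hE : (Sset 1 (m + 2)).erase 1 = insert 9 (insert 10 (insert 11 R)) := by
    ext c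
    simp only [hR, Sset, Finset.mem_erase, Finset.mem_filter, Finset.mem_insert, Finset.mem_range]
    omega
  have hmem : ∀ k, k < 19 → k ∉ R := fun k hk hh => by
    rw [hR, Finset.mem_filter] at hh; omega
  rw [hE, Finset.prod_insert, Finset.prod_insert, Finset.prod_insert] at h
  rotate_left
  · exact hmem _ (by norm_num)
  · rw [Finset.mem_insert, not_or]; exact ⟨by norm_num, hmem _ (by norm_num)⟩
  · rw [Finset.mem_insert, not_or, Finset.mem_insert, not_or]
    exact ⟨by norm_num, by norm_num, hmem _ (by norm_num)⟩
  rw [mul_assoc, mul_assoc, mul_assoc] at h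
  have p1 := peel_one (c := 9) (N := m + 2) (by norm_num) b0 b1 (fun n hn => coeff_eq_of_dvd_sub hn h)
    (fun n _ => Ss_ge n) b01
  have p2 := peel_one (c := 10) (N := m + 2) (by norm_num) b1 b2 (fun n _ => rfl) p1 b12
  have p3 := peel_one (c := 11) (N := m + 2) (by norm_num) b2 b3 (fun n _ => rfl) p2 b23
  have p4 := peel_big R (fun c hc => (Finset.mem_filter.1 hc).2) (m + 2) _ p3 m (by omega)
  rcases lt_or_ge m 15 with hm | hm
  · have := b3_pos m h1 h4 h5 h7 h8 hm
    refine lt_of_lt_of_le ?_ (p4.1 hm)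
    exact_mod_cast this
  · have := p4.2 hm
    split_ifs at this <;> linarith

theorem stmt1 (n : ℕ) (hn : 0 < n) (h5 : n % 5 = 0 ∨ n % 5 = 1 ∨ n % 5 = 3)
    (hex : n ∉ ({5, 8, 20, 25, 35, 40} : Set ℕ)) :
    nbar 1 5 n < nbar 0 5 n := by
  simp only [Set.mem_insert_iff, Set.mem_singleton_iff, not_or] at hex
  rcases h5 with h | h | h
  · exact nbar_lt_of (i := 0) (m := n / 5) (by omega)
      (D0_pos (by omega) (by omega) (by omega) (by omega) (by omega))
  · exact nbar_lt_of (i := 1) (m := n / 5) (by omega) (D1_pos _)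
  · exact nbar_lt_of (i := 3) (m := n / 5) (by omega) (D3_pos (by omega))
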